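/- arXiv:1007.1491 — 3 statements merged into one kernel-verified Lean document; each statement's English description precedes it below -/
import Mathlib

section
/- Let n ≥ 2, α ≥ 0 and β ∈ ℝ satisfy 1 < β − 2α < n. Then there exists a constant C = C(n, α, β) such that for every Schwartz function φ₀ on ℝⁿ, the solution φ of i φ_t = (−Δ)^{β/2} φ with φ(·,0) = φ₀ satisfies ∫_{−∞}^{∞} ∫_{ℝⁿ} | |∇|^α φ(x,t) |² / |x|^{β−2α} dx dt ≤ C ‖φ₀‖_{L²(ℝⁿ)}². -/
open MeasureTheory Real SchwartzMap

noncomputable section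

/-- The Fourier transform `φ̂₀(ξ) = ∫ e^{-i x·ξ} φ₀(x) dx` on `ℝⁿ`. -/
def fourierInt {n : ℕ} (f : EuclideanSpace ℝ (Fin n) → ℂ) (ξ : EuclideanSpace ℝ (Fin n)) : ℂ :=
  ∫ x : EuclideanSpace ℝ (Fin n), Complex.exp (-(Complex.I * ((inner ℝ x ξ : ℝ) : ℂ))) * f x

/-- `|∇|^α φ(x,t) = (2π)^{-n} ∫ |ξ|^α e^{i x·ξ} e^{-i t |ξ|^β} φ̂₀(ξ) dξ`, where `φ` is the
solution of `i φ_t = (-Δ)^{β/2} φ` with initial data `φ₀`. -/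
def gradProp {n : ℕ} (α β : ℝ) (φ₀ : 𝓢(EuclideanSpace ℝ (Fin n), ℂ))
    (x : EuclideanSpace ℝ (Fin n)) (t : ℝ) : ℂ :=
  ((2 * π) ^ n : ℝ)⁻¹ *
    ∫ ξ : EuclideanSpace ℝ (Fin n),
      ((‖ξ‖ ^ α : ℝ) : ℂ) * Complex.exp (Complex.I * ((inner ℝ x ξ : ℝ) : ℂ)) *
        Complex.exp (-(Complex.I * (t : ℂ) * ((‖ξ‖ ^ β : ℝ) : ℂ))) *
          fourierInt (fun y => φ₀ y) ξ

end

open scoped ENNReal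

/-- A Gaussian superposition dominates the power weight `r ^ (-γ)`. -/
lemma exists_inv_rpow_le_lintegral_gaussian (γ : ℝ) (hγ : 0 < γ) :
    ∃ C : ℝ≥0∞, C ≠ ∞ ∧ ∀ r : ℝ, 0 ≤ r →
      ENNReal.ofReal (r ^ γ)⁻¹ ≤ C * ∫⁻ s in Set.Ioi (0 : ℝ),
        ENNReal.ofReal (s ^ (-γ / 2 - 1)) * ENNReal.ofReal (exp (-(1 / (4 * s)) * r ^ 2)) := by
  set c : ℝ := 2 ^ (-γ / 2 - 1) * exp (-1 / 4) with hc
  have hc0 : 0 < c := by positivity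
  refine ⟨ENNReal.ofReal c⁻¹, ENNReal.ofReal_ne_top, fun r hr => ?_⟩
  rcases hr.eq_or_lt with rfl | hr
  · simp [Real.zero_rpow hγ.ne']
  have hr2 : 0 < r ^ 2 := by positivity
  have key : ENNReal.ofReal (c * (r ^ γ)⁻¹) ≤ ∫⁻ s in Set.Ioi (0 : ℝ),
      ENNReal.ofReal (s ^ (-γ / 2 - 1)) * ENNReal.ofReal (exp (-(1 / (4 * s)) * r ^ 2)) := by
    calc ENNReal.ofReal (c * (r ^ γ)⁻¹)
        = ∫⁻ s in Set.Ioc (r ^ 2) (2 * r ^ 2),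
            ENNReal.ofReal ((2 * r ^ 2) ^ (-γ / 2 - 1) * exp (-1 / 4)) := by
          rw [setLIntegral_const, Real.volume_Ioc, ← ENNReal.ofReal_mul (by positivity)]
          congr 1
          rw [Real.mul_rpow (by norm_num) hr2.le, hc, ← Real.rpow_neg hr.le]
          have : (r ^ 2) ^ (-γ / 2 - 1) * r ^ 2 = r ^ (-γ) := by
            rw [← Real.rpow_natCast r 2, ← Real.rpow_mul hr.le, ← Real.rpow_add hr]
            congr 1; push_cast; ring
          rw [← this]; ring
      _ ≤ ∫⁻ s in Set.Ioc (r ^ 2) (2 * r ^ 2), ENNReal.ofReal (s ^ (-γ / 2 - 1)) *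
            ENNReal.ofReal (exp (-(1 / (4 * s)) * r ^ 2)) := by
          refine setLIntegral_mono' measurableSet_Ioc fun s hs => ?_
          have hs0 : 0 < s := hr2.trans hs.1
          rw [← ENNReal.ofReal_mul (by positivity)]
          refine ENNReal.ofReal_le_ofReal (mul_le_mul ?_ ?_ (by positivity) (by positivity))
          · exact Real.rpow_le_rpow_of_nonpos hs0 hs.2 (by linarith)
          · rw [exp_le_exp]
            have : 1 / (4 * s) * r ^ 2 ≤ 1 / 4 := by
              rw [div_mul_eq_mul_div, div_le_div_iff₀ (by positivity) (by norm_num)]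
              linarith [hs.1]
            linarith
      _ ≤ _ := lintegral_mono_set fun s hs => hr2.trans hs.1
  calc ENNReal.ofReal (r ^ γ)⁻¹
      = ENNReal.ofReal c⁻¹ * ENNReal.ofReal (c * (r ^ γ)⁻¹) := by
        rw [← ENNReal.ofReal_mul (by positivity)]
        congr 1; field_simp
    _ ≤ _ := by gcongr

lemma lintegral_rpow_mul_exp_neg_le {a : ℝ} (ha : 0 < a) {v : ℝ} (hv : 0 ≤ v) :
    ∫⁻ s in Set.Ioi (0 : ℝ), ENNReal.ofReal (s ^ (a - 1)) * ENNReal.ofReal (exp (-s * v ^ 2)) ≤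
      ENNReal.ofReal (Gamma a) * ENNReal.ofReal v ^ (-(2 * a)) := by
  have hG := Real.Gamma_pos_of_pos ha
  rcases hv.eq_or_lt with rfl | hv
  · rw [ENNReal.ofReal_zero, ENNReal.zero_rpow_of_neg (by linarith), ENNReal.mul_top (by simpa)]
    exact le_top
  have hv2 : 0 < v ^ 2 := by positivity
  have hI := Real.integral_rpow_mul_exp_neg_mul_Ioi ha hv2
  have hint : IntegrableOn (fun t : ℝ => t ^ (a - 1) * exp (-(v ^ 2 * t))) (Set.Ioi 0) := by
    by_contra h
    rw [integral_undef h] at hI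
    exact absurd hI.symm (by positivity)
  apply le_of_eq
  calc _ = ∫⁻ s in Set.Ioi (0 : ℝ), ENNReal.ofReal (s ^ (a - 1) * exp (-(v ^ 2 * s))) := by
        refine setLIntegral_congr_fun measurableSet_Ioi fun s hs => ?_
        have hs : 0 < s := hs
        rw [← ENNReal.ofReal_mul (by positivity)]
        congr 3; ring
    _ = _ := by
        rw [← ofReal_integral_eq_lintegral_ofReal hint, hI, ENNReal.ofReal_rpow_of_pos hv, mul_comm,
          ENNReal.ofReal_mul hG.le]
        · congr 2
          rw [one_div, Real.inv_rpow hv2.le, ← Real.rpow_neg hv2.le, ← Real.rpow_natCast v 2,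
            ← Real.rpow_mul hv.le]
          congr 1; push_cast; ring
        · filter_upwards [ae_restrict_mem measurableSet_Ioi] with s hs
          have hs : 0 < s := hs
          positivity

lemma lintegral_pi_prod_eq_prod {n : ℕ} (g : Fin n → ℝ → ℝ≥0∞) (hg : ∀ i, Measurable (g i)) :
    ∫⁻ x : Fin n → ℝ, ∏ i, g i (x i) = ∏ i, ∫⁻ t, g i t := by
  induction n with
  | zero => simp [volume_pi]
  | succ n ih =>
    rw [← ((volume_preserving_piFinSuccAbove (fun _ : Fin (n + 1) => ℝ) 0).symm).lintegral_comp_emb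
      (MeasurableEquiv.measurableEmbedding _)]
    simp only [MeasurableEquiv.piFinSuccAbove_symm_apply, Fin.prod_univ_succ, Fin.insertNthEquiv,
      Equiv.coe_fn_mk, Fin.insertNth_zero, Fin.cons_zero, Fin.cons_succ, Fin.zero_succAbove]
    rw [Measure.volume_eq_prod, ← ih (fun i => g (Fin.succ i)) fun i => hg (Fin.succ i)]
    exact lintegral_prod_mul (hg 0).aemeasurable
      (Finset.measurable_prod _ fun i _ => (hg (Fin.succ i)).comp (measurable_pi_apply i)).aemeasurable

/-- Polar coordinates for a radial function times a homogeneous function. -/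
lemma lintegral_radial_mul_homogeneous {n : ℕ} (hn : 1 ≤ n) {γ : ℝ}
    {h : EuclideanSpace ℝ (Fin n) → ℝ≥0∞} (hh : Measurable h)
    (hom : ∀ r : ℝ, 0 < r → ∀ y, h (r • y) = ENNReal.ofReal (r ^ (γ - n)) * h y)
    {F : ℝ → ℝ≥0∞} (hF : Measurable F) :
    ∫⁻ y, F ‖y‖ * h y =
      (∫⁻ ω, h ω ∂(volume : Measure (EuclideanSpace ℝ (Fin n))).toSphere) *
        ∫⁻ r in Set.Ioi (0 : ℝ), F r * ENNReal.ofReal (r ^ (γ - 1)) := by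
  have : Nonempty (Fin n) := ⟨⟨0, hn⟩⟩
  have hmp := (volume : Measure (EuclideanSpace ℝ (Fin n))).measurePreserving_homeomorphUnitSphereProd
  have e0 : ∫⁻ y, F ‖y‖ * h y = ∫⁻ y : ({0}ᶜ : Set (EuclideanSpace ℝ (Fin n))), F ‖y.1‖ * h y
      ∂(Measure.comap Subtype.val volume) := by
    rw [lintegral_subtype_comap (measurableSet_singleton _).compl (fun y => F ‖y‖ * h y),
      restrict_compl_singleton]
  have e1 : ∀ y : ({0}ᶜ : Set (EuclideanSpace ℝ (Fin n))), F ‖(y : EuclideanSpace ℝ (Fin n))‖ * h y =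
      (fun z : Metric.sphere (0 : EuclideanSpace ℝ (Fin n)) 1 × Set.Ioi (0 : ℝ) =>
        h z.1 * (F z.2 * ENNReal.ofReal ((z.2 : ℝ) ^ (γ - n))))
        (homeomorphUnitSphereProd (EuclideanSpace ℝ (Fin n)) y) := by
    intro y
    have hy : 0 < ‖(y : EuclideanSpace ℝ (Fin n))‖ := norm_pos_iff.2 y.2
    have h2 := hom _ hy (‖(y : EuclideanSpace ℝ (Fin n))‖⁻¹ • y)
    rw [smul_smul, mul_inv_cancel₀ hy.ne', one_smul] at h2
    simp only [homeomorphUnitSphereProd_apply_snd_coe, homeomorphUnitSphereProd_apply_fst_coe]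
    nth_rewrite 1 [h2]
    ring
  rw [e0, lintegral_congr e1, hmp.lintegral_comp_emb (Homeomorph.measurableEmbedding _)
    (fun z : Metric.sphere (0 : EuclideanSpace ℝ (Fin n)) 1 × Set.Ioi (0 : ℝ) =>
        h z.1 * (F z.2 * ENNReal.ofReal ((z.2 : ℝ) ^ (γ - n))))]
  rw [lintegral_prod_mul (f := fun ω : Metric.sphere (0 : EuclideanSpace ℝ (Fin n)) 1 => h ω)
    (g := fun r : Set.Ioi (0 : ℝ) => F r * ENNReal.ofReal ((r : ℝ) ^ (γ - n))) (by fun_prop)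
    (by fun_prop)]
  congr 1
  rw [Measure.volumeIoiPow, lintegral_withDensity_eq_lintegral_mul _ (by fun_prop) (by fun_prop),
    ← lintegral_subtype_comap measurableSet_Ioi]
  refine lintegral_congr fun r => ?_
  have hr : 0 < (r : ℝ) := r.2
  simp only [Pi.mul_apply]
  rw [mul_left_comm, ← ENNReal.ofReal_mul (by positivity), ← Real.rpow_natCast, ← Real.rpow_add hr]
  congr 3
  simp only [finrank_euclideanSpace, Fintype.card_fin]
  push_cast [hn]
  ring

lemma lintegral_gaussian_comp_rpow_le {β ε : ℝ} (hβ : 0 < β) (hε : 0 < ε) (ρ : ℝ) :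
    ∫⁻ r in Set.Ioi (0 : ℝ), ENNReal.ofReal (exp (-(ρ - r ^ β) ^ 2 / (4 * ε))) *
        ENNReal.ofReal (r ^ (β - 1)) ≤ ENNReal.ofReal (√(4 * π * ε) / β) := by
  have hcv := lintegral_image_eq_lintegral_abs_deriv_mul (s := Set.Ioi (0 : ℝ))
    (f := fun r => r ^ β) (f' := fun r => β * r ^ (β - 1)) measurableSet_Ioi
    (fun r hr => (Real.hasDerivAt_rpow_const (Or.inl (ne_of_gt hr))).hasDerivWithinAt)
    ((Real.strictMonoOn_rpow_Ici_of_exponent_pos hβ).injOn.mono Set.Ioi_subset_Ici_self)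
    (fun l => ENNReal.ofReal (exp (-(ρ - l) ^ 2 / (4 * ε))))
  have hg : ∫⁻ l : ℝ, ENNReal.ofReal (exp (-(ρ - l) ^ 2 / (4 * ε))) =
      ENNReal.ofReal √(4 * π * ε) := by
    rw [lintegral_sub_left_eq_self (fun l : ℝ => ENNReal.ofReal (exp (-l ^ 2 / (4 * ε)))) ρ]
    have e : ∀ l : ℝ, -l ^ 2 / (4 * ε) = -(1 / (4 * ε)) * l ^ 2 := fun l => by ring
    simp_rw [e]
    rw [← ofReal_integral_eq_lintegral_ofReal (integrable_exp_neg_mul_sq (by positivity))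
      (Filter.Eventually.of_forall fun _ => (exp_pos _).le), integral_gaussian]
    congr 2; field_simp
  calc _ = ENNReal.ofReal β⁻¹ * ∫⁻ r in Set.Ioi (0 : ℝ), ENNReal.ofReal |β * r ^ (β - 1)| *
          ENNReal.ofReal (exp (-(ρ - r ^ β) ^ 2 / (4 * ε))) := by
        rw [← lintegral_const_mul' _ _ ENNReal.ofReal_ne_top]
        refine setLIntegral_congr_fun measurableSet_Ioi fun r hr => ?_
        have hr : 0 < r := hr
        rw [abs_of_pos (by positivity), ← ENNReal.ofReal_mul (by positivity),
          ← ENNReal.ofReal_mul (by positivity), ← ENNReal.ofReal_mul (by positivity)]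
        congr 1; field_simp
    _ ≤ ENNReal.ofReal β⁻¹ * ENNReal.ofReal √(4 * π * ε) := by
        rw [← hcv, ← hg]
        gcongr
        exact Measure.restrict_le_self
    _ = _ := by
        rw [← ENNReal.ofReal_mul (by positivity)]
        congr 1; ring

/-- The product of the weights `|y i| ^ (-p)` over all coordinates other than `i₀`. -/
noncomputable def transverseWeight {n : ℕ} (i₀ : Fin n) (p : ℝ) (y : EuclideanSpace ℝ (Fin n)) :
    ℝ≥0∞ :=
  ∏ i ∈ Finset.univ.erase i₀, ‖y i‖ₑ ^ (-p)

lemma measurable_transverseWeight {n : ℕ} (i₀ : Fin n) (p : ℝ) :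
    Measurable (transverseWeight i₀ p) := by
  unfold transverseWeight
  fun_prop

lemma transverseWeight_smul {n : ℕ} (i₀ : Fin n) {p γ : ℝ} (hp : p * (n - 1) = n - γ)
    {r : ℝ} (hr : 0 < r) (y : EuclideanSpace ℝ (Fin n)) :
    transverseWeight i₀ p (r • y) = ENNReal.ofReal (r ^ (γ - n)) * transverseWeight i₀ p y := by
  have hn : 1 ≤ n := i₀.pos
  simp only [transverseWeight, PiLp.smul_apply, smul_eq_mul, enorm_mul]
  simp_rw [ENNReal.mul_rpow_of_ne_top enorm_ne_top enorm_ne_top]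
  rw [Finset.prod_mul_distrib, Finset.prod_const, Finset.card_erase_of_mem (Finset.mem_univ _),
    Finset.card_univ, Fintype.card_fin, ← ENNReal.rpow_natCast, ← ENNReal.rpow_mul,
    Real.enorm_of_nonneg hr.le, ENNReal.ofReal_rpow_of_pos hr]
  congr 3
  push_cast [hn]
  linarith

lemma lintegral_gaussian_mul_enorm_rpow_lt_top {p : ℝ} (hp : p < 1) :
    ∫⁻ t : ℝ, ENNReal.ofReal (exp (-t ^ 2)) * ‖t‖ₑ ^ (-p) < ∞ := by
  have h1 : IntegrableOn (fun x : ℝ => x ^ (-p) * exp (-1 * x ^ 2)) (Set.Ioi 0) :=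
    (integrable_rpow_mul_exp_neg_mul_sq one_pos (by linarith)).integrableOn
  have h2 : Integrable (fun x : ℝ => |x| ^ (-p) * exp (-1 * |x| ^ 2)) :=
    (integrable_fun_norm_addHaar volume (f := fun x : ℝ => x ^ (-p) * exp (-1 * x ^ 2))).2
      (by simpa using h1)
  refine lt_of_le_of_lt (le_of_eq ?_) h2.hasFiniteIntegral
  refine lintegral_congr_ae ?_
  filter_upwards [Measure.ae_ne volume (0 : ℝ)] with t ht
  have : 0 < |t| := abs_pos.2 ht
  rw [Real.enorm_eq_ofReal_abs t, Real.enorm_of_nonneg (by positivity),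
    ENNReal.ofReal_mul (by positivity), ← ENNReal.ofReal_rpow_of_pos this, mul_comm]
  simp

lemma lintegral_gaussian_mul_transverseWeight_lt_top {n : ℕ} (i₀ : Fin n) {p : ℝ} (hp : p < 1) :
    ∫⁻ y, ENNReal.ofReal (exp (-‖y‖ ^ 2)) * transverseWeight i₀ p y < ∞ := by
  set g : Fin n → ℝ → ℝ≥0∞ := fun i t =>
    ENNReal.ofReal (exp (-t ^ 2)) * if i = i₀ then 1 else ‖t‖ₑ ^ (-p) with hg
  have e : ∀ y : EuclideanSpace ℝ (Fin n),
      ENNReal.ofReal (exp (-‖y‖ ^ 2)) * transverseWeight i₀ p y = ∏ i, g i (WithLp.ofLp y i) := by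
    intro y
    simp only [hg, Finset.prod_mul_distrib]
    congr 1
    · rw [EuclideanSpace.norm_sq_eq, ← Finset.sum_neg_distrib, exp_sum,
        ENNReal.ofReal_prod_of_nonneg fun _ _ => (exp_pos _).le]
      simp
    · rw [transverseWeight, ← Finset.mul_prod_erase _ _ (Finset.mem_univ i₀)]
      simp only [if_true, one_mul]
      exact Finset.prod_congr rfl fun i hi => by rw [if_neg (Finset.ne_of_mem_erase hi)]
  have hgm : ∀ i, Measurable (g i) := by
    intro i
    by_cases hi : i = i₀ <;> simp only [hg, hi, if_true, if_false] <;> fun_prop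
  simp_rw [e]
  rw [(PiLp.volume_preserving_ofLp (Fin n)).lintegral_comp (f := fun x => ∏ i, g i (x i))
    (Finset.measurable_prod _ fun i _ => (hgm i).comp (measurable_pi_apply i)),
    lintegral_pi_prod_eq_prod g hgm]
  refine ENNReal.prod_lt_top fun i _ => ?_
  by_cases hi : i = i₀
  · simpa [hg, hi] using lintegral_gaussian_mul_enorm_rpow_lt_top (p := 0) one_pos
  · simpa only [hg, hi, if_false] using lintegral_gaussian_mul_enorm_rpow_lt_top hp

lemma lintegral_sphere_transverseWeight_ne_top {n : ℕ} (i₀ : Fin n) {p γ : ℝ} (hp1 : p < 1)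
    (hp : p * (n - 1) = n - γ) :
    ∫⁻ ω, transverseWeight i₀ p ω ∂(volume : Measure (EuclideanSpace ℝ (Fin n))).toSphere ≠ ∞ := by
  have h := lintegral_radial_mul_homogeneous i₀.pos (measurable_transverseWeight i₀ p)
    (fun r hr y => transverseWeight_smul i₀ hp hr y)
    (F := fun r => ENNReal.ofReal (exp (-r ^ 2))) (by fun_prop)
  have hlt := lintegral_gaussian_mul_transverseWeight_lt_top i₀ hp1
  rw [h] at hlt
  intro htop
  rw [htop, ENNReal.top_mul] at hlt
  · exact lt_irrefl _ hlt
  refine ((setLIntegral_pos_iff (by fun_prop)).2 ?_).ne'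
  refine lt_of_lt_of_le (b := volume (Set.Ioi (0 : ℝ))) (by simp) (measure_mono fun r hr => ⟨?_, hr⟩)
  have hr : 0 < r := hr
  rw [Function.mem_support, ← ENNReal.ofReal_mul (by positivity)]
  simp only [ne_eq, ENNReal.ofReal_eq_zero, not_le]
  positivity

lemma enorm_sub_rpow_le_transverseWeight {n : ℕ} (i₀ : Fin n) {p γ : ℝ} (hp0 : 0 ≤ p)
    (hp : p * (n - 1) = n - γ) {x y : EuclideanSpace ℝ (Fin n)} (hx : ∀ i, i ≠ i₀ → x i = 0) :
    ‖x - y‖ₑ ^ (γ - n) ≤ transverseWeight i₀ p y := by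
  have hn : 1 ≤ n := i₀.pos
  calc ‖x - y‖ₑ ^ (γ - n) = ∏ i ∈ Finset.univ.erase i₀, ‖x - y‖ₑ ^ (-p) := by
        rw [Finset.prod_const, Finset.card_erase_of_mem (Finset.mem_univ _),
          Finset.card_univ, Fintype.card_fin, ← ENNReal.rpow_natCast, ← ENNReal.rpow_mul]
        congr 1
        push_cast [hn]
        linarith
    _ ≤ _ := by
        refine Finset.prod_le_prod' fun i hi => ?_
        rw [ENNReal.rpow_neg, ENNReal.rpow_neg]
        refine ENNReal.inv_le_inv.2 (ENNReal.rpow_le_rpow ?_ hp0)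
        have := PiLp.norm_apply_le (x - y) i
        rw [PiLp.sub_apply, hx i (Finset.ne_of_mem_erase hi), zero_sub, norm_neg] at this
        exact enorm_le_iff_norm_le.2 this

lemma lintegral_radial_mul_enorm_sub_rpow_le {n : ℕ} (i₀ : Fin n) {p γ : ℝ} (hp0 : 0 ≤ p)
    (hp : p * (n - 1) = n - γ) (F : ℝ → ℝ≥0∞) (ξ : EuclideanSpace ℝ (Fin n)) :
    ∫⁻ η, F ‖η‖ * ‖ξ - η‖ₑ ^ (γ - n) ≤ ∫⁻ y, F ‖y‖ * transverseWeight i₀ p y := by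
  obtain ⟨b, hb⟩ : ∃ b : OrthonormalBasis (Fin n) ℝ (EuclideanSpace ℝ (Fin n)),
      ∀ i, i ≠ i₀ → b.repr ξ i = 0 := by
    rcases eq_or_ne ξ 0 with rfl | hξ
    · exact ⟨EuclideanSpace.basisFun _ _, by simp⟩
    have hξ' : ‖ξ‖ ≠ 0 := norm_ne_zero_iff.2 hξ
    obtain ⟨b, hb⟩ := Orthonormal.exists_orthonormalBasis_extension_of_card_eq (𝕜 := ℝ)
      (E := EuclideanSpace ℝ (Fin n)) (ι := Fin n) (by simp)
      (v := fun _ => ‖ξ‖⁻¹ • ξ) (s := {i₀}) (by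
        rw [orthonormal_iff_ite]
        rintro ⟨i, rfl⟩ ⟨j, rfl⟩
        simp [norm_smul, hξ'])
    refine ⟨b, fun i hi => ?_⟩
    have e : ξ = ‖ξ‖ • b i₀ := by rw [hb i₀ rfl, smul_smul, mul_inv_cancel₀ hξ', one_smul]
    rw [b.repr_apply_apply, e, real_inner_smul_right, b.inner_eq_ite, if_neg hi, mul_zero]
  calc ∫⁻ η, F ‖η‖ * ‖ξ - η‖ₑ ^ (γ - n)
      ≤ ∫⁻ η, (fun y => F ‖y‖ * transverseWeight i₀ p y) (b.repr η) := by
        refine lintegral_mono fun η => ?_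
        have h := enorm_sub_rpow_le_transverseWeight i₀ hp0 hp (y := b.repr η) hb
        rw [← map_sub, LinearIsometryEquiv.enorm_map] at h
        simp only [LinearIsometryEquiv.norm_map]
        gcongr
    _ = _ := b.measurePreserving_repr.lintegral_comp_emb
        b.repr.toHomeomorph.measurableEmbedding
        (fun y => F ‖y‖ * transverseWeight i₀ p y)

lemma exists_lintegral_weight_le {n : ℕ} (hn : 2 ≤ n) {α β : ℝ} (hα : 0 ≤ α)
    (h1 : 1 < β - 2 * α) (h2 : β - 2 * α < n) :
    ∃ C : ℝ≥0∞, C ≠ ∞ ∧ ∀ ε : ℝ, 0 < ε → ∀ ξ : EuclideanSpace ℝ (Fin n),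
      ∫⁻ η, ENNReal.ofReal (‖η‖ ^ α) ^ 2 * (ENNReal.ofReal √(π / ε) *
        ENNReal.ofReal (exp (-(‖ξ‖ ^ β - ‖η‖ ^ β) ^ 2 / (4 * ε))) *
          ‖ξ - η‖ₑ ^ (β - 2 * α - n)) ≤ C := by
  set γ := β - 2 * α with hγ
  have hβ : 0 < β := by linarith
  have hn' : (2 : ℝ) ≤ n := by exact_mod_cast hn
  set i₀ : Fin n := ⟨0, by omega⟩
  set p : ℝ := (n - γ) / (n - 1) with hpdef
  have hp : p * (n - 1) = n - γ := div_mul_cancel₀ _ (by linarith)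
  have hp0 : 0 ≤ p := div_nonneg (by linarith) (by linarith)
  have hp1 : p < 1 := by rw [hpdef, div_lt_one (by linarith)]; linarith
  set J := ∫⁻ ω, transverseWeight i₀ p ω ∂(volume : Measure (EuclideanSpace ℝ (Fin n))).toSphere
  have hJ : J ≠ ∞ := lintegral_sphere_transverseWeight_ne_top i₀ hp1 hp
  refine ⟨J * ENNReal.ofReal (2 * π / β), ENNReal.mul_ne_top hJ ENNReal.ofReal_ne_top,
    fun ε hε ξ => ?_⟩
  set F : ℝ → ℝ≥0∞ := fun r => ENNReal.ofReal √(π / ε) * (ENNReal.ofReal (r ^ α) ^ 2 *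
    ENNReal.ofReal (exp (-(‖ξ‖ ^ β - r ^ β) ^ 2 / (4 * ε)))) with hF
  have hFm : Measurable F := by fun_prop
  calc _ = ∫⁻ η, F ‖η‖ * ‖ξ - η‖ₑ ^ (γ - n) := lintegral_congr fun η => by simp only [hF]; ring
    _ ≤ ∫⁻ y, F ‖y‖ * transverseWeight i₀ p y := lintegral_radial_mul_enorm_sub_rpow_le i₀ hp0 hp F ξ
    _ = J * ∫⁻ r in Set.Ioi (0 : ℝ), F r * ENNReal.ofReal (r ^ (γ - 1)) :=
        lintegral_radial_mul_homogeneous i₀.pos (measurable_transverseWeight i₀ p)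
          (fun r hr y => transverseWeight_smul i₀ hp hr y) hFm
    _ = J * (ENNReal.ofReal √(π / ε) * ∫⁻ r in Set.Ioi (0 : ℝ),
          ENNReal.ofReal (exp (-(‖ξ‖ ^ β - r ^ β) ^ 2 / (4 * ε))) *
            ENNReal.ofReal (r ^ (β - 1))) := by
        rw [← lintegral_const_mul' _ _ ENNReal.ofReal_ne_top]
        congr 1
        refine setLIntegral_congr_fun measurableSet_Ioi fun r hr => ?_
        have hr : 0 < r := hr
        have : r ^ (β - 1) = (r ^ α) ^ 2 * r ^ (γ - 1) := by
          rw [← Real.rpow_natCast, ← Real.rpow_mul hr.le, ← Real.rpow_add hr]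
          congr 1; push_cast; rw [hγ]; ring
        simp only [hF]
        rw [this, ENNReal.ofReal_mul (by positivity), ENNReal.ofReal_pow (by positivity)]
        ring
    _ ≤ J * (ENNReal.ofReal √(π / ε) * ENNReal.ofReal (√(4 * π * ε) / β)) := by
        gcongr
        exact lintegral_gaussian_comp_rpow_le hβ hε _
    _ = _ := by
        rw [← ENNReal.ofReal_mul (by positivity), ← mul_div_assoc, ← Real.sqrt_mul (by positivity)]
        congr 3
        rw [show π / ε * (4 * π * ε) = (2 * π) ^ 2 by field_simp; norm_num,
          Real.sqrt_sq (by positivity)]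

/-- Schur's test for a symmetric kernel, with a weight `a`. -/
lemma lintegral_lintegral_mul_kernel_le {X : Type*} [MeasurableSpace X] {ν : Measure X} [SFinite ν]
    {a g : X → ℝ≥0∞} {K : X → X → ℝ≥0∞} (ha : Measurable a) (hg : Measurable g)
    (hK : Measurable (Function.uncurry K)) (hsymm : ∀ x y, K x y = K y x) {C : ℝ≥0∞}
    (hC : ∀ x, ∫⁻ y, a y ^ 2 * K x y ∂ν ≤ C) :
    ∫⁻ x, ∫⁻ y, (a x * g x) * (a y * g y) * K x y ∂ν ∂ν ≤ 2 * C * ∫⁻ x, g x ^ 2 ∂ν := by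
  have hm : Measurable (Function.uncurry fun x y => g x ^ 2 * (a y ^ 2 * K x y)) :=
    ((hg.comp measurable_fst).pow_const 2).mul (((ha.comp measurable_snd).pow_const 2).mul hK)
  have hm' : Measurable (Function.uncurry fun x y => g y ^ 2 * (a x ^ 2 * K y x)) :=
    hm.comp measurable_swap
  have h1 : ∫⁻ x, ∫⁻ y, g x ^ 2 * (a y ^ 2 * K x y) ∂ν ∂ν ≤ C * ∫⁻ x, g x ^ 2 ∂ν := by
    rw [← lintegral_const_mul _ (hg.pow_const 2)]
    refine lintegral_mono fun x => ?_
    rw [lintegral_const_mul _ (by fun_prop), mul_comm]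
    gcongr
    exact hC x
  calc _ ≤ ∫⁻ x, ∫⁻ y, g x ^ 2 * (a y ^ 2 * K x y) + g y ^ 2 * (a x ^ 2 * K y x) ∂ν ∂ν := by
        refine lintegral_mono fun x => lintegral_mono fun y => ?_
        have key : ∀ P Q : ℝ≥0∞, P * Q ≤ P ^ 2 + Q ^ 2 := by
          intro P Q
          rcases le_total P Q with h | h
          · exact le_add_left (by rw [sq]; gcongr)
          · exact le_add_right (by rw [sq]; gcongr)
        calc _ = (g x * a y) * (g y * a x) * K x y := by ring
          _ ≤ ((g x * a y) ^ 2 + (g y * a x) ^ 2) * K x y := by gcongr; exact key _ _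
          _ = _ := by rw [hsymm y x]; ring
    _ = ∫⁻ x, ∫⁻ y, g x ^ 2 * (a y ^ 2 * K x y) ∂ν ∂ν +
          ∫⁻ x, ∫⁻ y, g y ^ 2 * (a x ^ 2 * K y x) ∂ν ∂ν := by
        rw [← lintegral_add_left (f := fun x => ∫⁻ y, g x ^ 2 * (a y ^ 2 * K x y) ∂ν)
          hm.lintegral_prod_right']
        exact lintegral_congr fun x => lintegral_add_left hm.of_uncurry_left _
    _ ≤ C * ∫⁻ x, g x ^ 2 ∂ν + C * ∫⁻ x, g x ^ 2 ∂ν := by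
        rw [lintegral_lintegral_swap hm'.aemeasurable]
        gcongr
    _ = _ := by ring

/-- The `TT*` identity: the `L²(μ)` norm of `y ↦ ∫ e y x f x` is controlled by the kernel
`∫ e y x conj (e y x')`. -/
lemma lintegral_enorm_integral_sq_le {X Y : Type*} [MeasurableSpace X] [MeasurableSpace Y]
    {ν : Measure X} [SFinite ν] {μ : Measure Y} [IsFiniteMeasure μ] {e : Y → X → ℂ}
    (he : Measurable (Function.uncurry e)) (he1 : ∀ y x, ‖e y x‖ ≤ 1) {f : X → ℂ}
    (hf : Integrable f ν) :
    ∫⁻ y, ‖∫ x, e y x * f x ∂ν‖ₑ ^ 2 ∂μ ≤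
      ∫⁻ x, ∫⁻ x', ‖f x‖ₑ * ‖f x'‖ₑ *
        ‖∫ y, e y x * (starRingEnd ℂ) (e y x') ∂μ‖ₑ ∂ν ∂ν := by
  set U : Y → ℂ := fun y => ∫ x, e y x * f x ∂ν with hU
  have hUm : AEStronglyMeasurable U μ := by
    apply AEStronglyMeasurable.integral_prod_right' (f := fun z : Y × X => e z.1 z.2 * f z.2)
    exact he.aestronglyMeasurable.mul hf.1.comp_snd
  have hUb : ∀ y, ‖U y‖ ≤ ∫ x, ‖f x‖ ∂ν := by
    intro y
    refine (norm_integral_le_integral_norm _).trans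
      (integral_mono_of_nonneg (.of_forall fun _ => norm_nonneg _) hf.norm (.of_forall fun x => ?_))
    simp only [norm_mul]
    exact mul_le_of_le_one_left (norm_nonneg _) (he1 y x)
  set P : Y → X × X → ℂ := fun y z =>
    (e y z.1 * f z.1) * (starRingEnd ℂ) (e y z.2 * f z.2) with hP
  have hUP : ∀ y, U y * (starRingEnd ℂ) (U y) = ∫ z, P y z ∂(ν.prod ν) := by
    intro y
    rw [hU, ← integral_conj, ← integral_prod_mul]
  have hPint : Integrable (Function.uncurry P) (μ.prod (ν.prod ν)) := by
    have hb : Integrable (fun w : Y × (X × X) => (1 : ℝ) * (‖f w.2.1‖ * ‖f w.2.2‖))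
        (μ.prod (ν.prod ν)) :=
      (integrable_const (1 : ℝ)).mul_prod (hf.norm.mul_prod hf.norm)
    refine hb.mono' ?_ (.of_forall fun w => ?_)
    · have h1 : AEStronglyMeasurable (fun w : Y × (X × X) => e w.1 w.2.1) (μ.prod (ν.prod ν)) :=
        (he.comp (measurable_fst.prodMk measurable_snd.fst)).aestronglyMeasurable
      have h2 : AEStronglyMeasurable (fun w : Y × (X × X) => e w.1 w.2.2) (μ.prod (ν.prod ν)) :=
        (he.comp (measurable_fst.prodMk measurable_snd.snd)).aestronglyMeasurable
      have h3 : AEStronglyMeasurable (fun w : Y × (X × X) => f w.2.1) (μ.prod (ν.prod ν)) :=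
        hf.1.comp_fst.comp_snd
      have h4 : AEStronglyMeasurable (fun w : Y × (X × X) => f w.2.2) (μ.prod (ν.prod ν)) :=
        hf.1.comp_snd.comp_snd
      exact (h1.mul h3).mul (Complex.continuous_conj.comp_aestronglyMeasurable (h2.mul h4))
    · simp only [Function.uncurry, hP, norm_mul, RCLike.norm_conj, one_mul]
      exact mul_le_mul (mul_le_of_le_one_left (norm_nonneg _) (he1 _ _))
        (mul_le_of_le_one_left (norm_nonneg _) (he1 _ _)) (by positivity) (norm_nonneg _)
  have hU2 : ∫⁻ y, ‖U y‖ₑ ^ 2 ∂μ = ‖∫ y, ∫ z, P y z ∂(ν.prod ν) ∂μ‖ₑ := by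
    simp_rw [← hUP, Complex.mul_conj, Complex.normSq_eq_norm_sq]
    rw [integral_complex_ofReal]
    have hint : Integrable (fun y => ‖U y‖ ^ 2) μ := by
      refine Integrable.mono' (integrable_const ((∫ x, ‖f x‖ ∂ν) ^ 2)) (hUm.norm.pow 2)
        (.of_forall fun y => ?_)
      rw [Real.norm_of_nonneg (by positivity)]
      exact pow_le_pow_left₀ (norm_nonneg _) (hUb y) 2
    have h0 : 0 ≤ ∫ y, ‖U y‖ ^ 2 ∂μ := integral_nonneg fun _ => by positivity
    rw [← ofReal_norm, Complex.norm_real, Real.norm_of_nonneg h0,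
      ofReal_integral_eq_lintegral_ofReal hint (.of_forall fun _ => by positivity)]
    refine lintegral_congr fun y => ?_
    rw [ENNReal.ofReal_pow (norm_nonneg _), ofReal_norm]
  rw [hU2, integral_integral_swap hPint]
  refine (enorm_integral_le_lintegral_enorm _).trans ?_
  refine (lintegral_prod_le _).trans (lintegral_mono fun x => lintegral_mono fun x' => le_of_eq ?_)
  have hc : ‖f x'‖ₑ = ‖(starRingEnd ℂ) (f x')‖ₑ := by
    rw [← ofReal_norm, ← ofReal_norm, RCLike.norm_conj]
  rw [hc, ← enorm_mul, ← enorm_mul, ← integral_const_mul]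
  congr 2 with y
  simp only [hP, map_mul]
  ring

lemma norm_integral_gaussian_cexp {V : Type*} [NormedAddCommGroup V] [InnerProductSpace ℝ V]
    [FiniteDimensional ℝ V] [MeasurableSpace V] [BorelSpace V] {b : ℝ} (hb : 0 < b) {c : ℂ}
    (hc : c ^ 2 = -1) (w : V) :
    ‖∫ v : V, Complex.exp (-(b : ℂ) * (‖v‖ : ℂ) ^ 2 + c * ((inner ℝ w v : ℝ) : ℂ))‖ =
      (π / b) ^ ((Module.finrank ℝ V : ℝ) / 2) * exp (-‖w‖ ^ 2 / (4 * b)) := by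
  rw [GaussianFourier.integral_cexp_neg_mul_sq_norm_add (by simpa using hb), hc, norm_mul,
    Complex.norm_exp]
  congr 1
  · rw [← Complex.ofReal_div, Complex.norm_cpow_eq_rpow_re_of_pos (by positivity)]
    congr 1
    simp
  · congr 1
    norm_cast
    simp

/-- The space-time plane wave `e^{i x·ξ} e^{-i t |ξ|^β}`. -/
noncomputable def planeWave {n : ℕ} (β : ℝ) (z : EuclideanSpace ℝ (Fin n) × ℝ)
    (ξ : EuclideanSpace ℝ (Fin n)) : ℂ :=
  Complex.exp (Complex.I * ((inner ℝ z.1 ξ : ℝ) : ℂ)) *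
    Complex.exp (-(Complex.I * (z.2 : ℂ) * ((‖ξ‖ ^ β : ℝ) : ℂ)))

lemma measurable_planeWave {n : ℕ} (β : ℝ) :
    Measurable (Function.uncurry (planeWave (n := n) β)) := by
  unfold planeWave Function.uncurry
  fun_prop

lemma norm_planeWave {n : ℕ} (β : ℝ) (z : EuclideanSpace ℝ (Fin n) × ℝ)
    (ξ : EuclideanSpace ℝ (Fin n)) : ‖planeWave β z ξ‖ = 1 := by
  simp [planeWave, Complex.norm_exp]

/-- The Gaussian weight `e^{-b |x|²} e^{-ε t²}` on space-time. -/
noncomputable def gaussianWeight {n : ℕ} (b ε : ℝ) (z : EuclideanSpace ℝ (Fin n) × ℝ) : ℝ :=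
  exp (-b * ‖z.1‖ ^ 2) * exp (-ε * z.2 ^ 2)

lemma isFiniteMeasure_gaussianWeight {n : ℕ} {b ε : ℝ} (hb : 0 < b) (hε : 0 < ε) :
    IsFiniteMeasure ((volume : Measure (EuclideanSpace ℝ (Fin n) × ℝ)).withDensity
      fun z => ENNReal.ofReal (gaussianWeight b ε z)) := by
  refine isFiniteMeasure_withDensity_ofReal (Integrable.hasFiniteIntegral ?_)
  refine Integrable.mul_prod (f := fun x : EuclideanSpace ℝ (Fin n) => exp (-b * ‖x‖ ^ 2)) ?_
    (integrable_exp_neg_mul_sq hε)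
  have := (GaussianFourier.integrable_cexp_neg_mul_sq_norm_add (b := (b : ℂ)) (by simpa using hb) 0
    (0 : EuclideanSpace ℝ (Fin n))).norm
  refine this.congr (.of_forall fun x => ?_)
  simp only [Complex.norm_exp]
  norm_cast
  simp

lemma enorm_integral_planeWave_gaussianWeight {n : ℕ} (β : ℝ) {b ε : ℝ} (hb : 0 < b) (hε : 0 < ε)
    (ξ η : EuclideanSpace ℝ (Fin n)) :
    ‖∫ z, planeWave β z ξ * (starRingEnd ℂ) (planeWave β z η)
        ∂((volume : Measure (EuclideanSpace ℝ (Fin n) × ℝ)).withDensity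
          fun z => ENNReal.ofReal (gaussianWeight b ε z))‖ₑ =
      ENNReal.ofReal ((π / b) ^ ((n : ℝ) / 2)) * ENNReal.ofReal (exp (-‖ξ - η‖ ^ 2 / (4 * b))) *
        (ENNReal.ofReal √(π / ε) *
          ENNReal.ofReal (exp (-(‖ξ‖ ^ β - ‖η‖ ^ β) ^ 2 / (4 * ε)))) := by
  have hI : Complex.I ^ 2 = -1 := Complex.I_sq
  have hI' : (-Complex.I) ^ 2 = -1 := by rw [neg_sq, Complex.I_sq]
  have e : ∀ z : EuclideanSpace ℝ (Fin n) × ℝ,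
      (ENNReal.ofReal (gaussianWeight b ε z)).toReal •
        (planeWave β z ξ * (starRingEnd ℂ) (planeWave β z η)) =
      Complex.exp (-(b : ℂ) * (‖z.1‖ : ℂ) ^ 2 + Complex.I * ((inner ℝ (ξ - η) z.1 : ℝ) : ℂ)) *
      Complex.exp (-(ε : ℂ) * (‖z.2‖ : ℂ) ^ 2 +
        -Complex.I * ((inner ℝ (‖ξ‖ ^ β - ‖η‖ ^ β) z.2 : ℝ) : ℂ)) := by
    intro z
    have h2 : ((‖z.2‖ : ℝ) : ℂ) ^ 2 = (z.2 : ℂ) ^ 2 := by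
      norm_cast; simp
    rw [ENNReal.toReal_ofReal (by unfold gaussianWeight; positivity), Complex.real_smul,
      gaussianWeight, planeWave, planeWave, map_mul, ← Complex.exp_conj, ← Complex.exp_conj, h2,
      inner_sub_left, real_inner_comm, real_inner_comm z.1 η]
    simp only [map_neg, map_mul, Complex.conj_I, Complex.conj_ofReal, Complex.ofReal_mul,
      Complex.ofReal_exp, ← Complex.exp_add]
    congr 1
    simp only [RCLike.inner_apply, conj_trivial]
    push_cast
    ring
  rw [integral_withDensity_eq_integral_toReal_smul (by unfold gaussianWeight; fun_prop) (by simp)]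
  simp_rw [e]
  rw [Measure.volume_eq_prod, integral_prod_mul
    (fun x : EuclideanSpace ℝ (Fin n) => Complex.exp (-(b : ℂ) * (‖x‖ : ℂ) ^ 2 +
      Complex.I * ((inner ℝ (ξ - η) x : ℝ) : ℂ)))
    (fun t : ℝ => Complex.exp (-(ε : ℂ) * (‖t‖ : ℂ) ^ 2 +
        -Complex.I * ((inner ℝ (‖ξ‖ ^ β - ‖η‖ ^ β) t : ℝ) : ℂ))),
    enorm_mul, ← ofReal_norm, ← ofReal_norm, norm_integral_gaussian_cexp hb hI,
    norm_integral_gaussian_cexp hε hI', ENNReal.ofReal_mul (by positivity),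
    ENNReal.ofReal_mul (by positivity), Real.sqrt_eq_rpow]
  simp

set_option maxHeartbeats 800000 in
lemma exists_lintegral_gaussian_smoothing_le {n : ℕ} (hn : 2 ≤ n) {α β : ℝ} (hα : 0 ≤ α)
    (h1 : 1 < β - 2 * α) (h2 : β - 2 * α < n) :
    ∃ C : ℝ≥0∞, C ≠ ∞ ∧ ∀ g : EuclideanSpace ℝ (Fin n) → ℂ, Measurable g →
      Integrable (fun ξ => ((‖ξ‖ ^ α : ℝ) : ℂ) * g ξ) → ∀ ε : ℝ, 0 < ε →
        ∫⁻ z : EuclideanSpace ℝ (Fin n) × ℝ, ENNReal.ofReal (exp (-ε * z.2 ^ 2)) *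
          (ENNReal.ofReal (‖z.1‖ ^ (β - 2 * α))⁻¹ *
            ‖∫ ξ, planeWave β z ξ * (((‖ξ‖ ^ α : ℝ) : ℂ) * g ξ)‖ₑ ^ 2) ≤
          C * ∫⁻ ξ, ‖g ξ‖ₑ ^ 2 := by
  set γ := β - 2 * α with hγ
  have hn' : (2 : ℝ) ≤ n := by exact_mod_cast hn
  obtain ⟨C₁, hC₁, hw⟩ := exists_inv_rpow_le_lintegral_gaussian γ (by linarith)
  obtain ⟨C₂, hC₂, hk⟩ := exists_lintegral_weight_le hn hα h1 h2
  set a : ℝ := (n - γ) / 2 with ha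
  have ha0 : 0 < a := by rw [ha]; linarith
  set c : ℝ≥0∞ := ENNReal.ofReal ((4 * π) ^ ((n : ℝ) / 2)) * ENNReal.ofReal (Gamma a) with hc
  have hc' : c ≠ ∞ := ENNReal.mul_ne_top ENNReal.ofReal_ne_top ENNReal.ofReal_ne_top
  refine ⟨C₁ * (c * (2 * C₂)), ENNReal.mul_ne_top hC₁ (ENNReal.mul_ne_top hc'
    (ENNReal.mul_ne_top (by simp) hC₂)), fun g hg hint ε hε => ?_⟩
  set f : EuclideanSpace ℝ (Fin n) → ℂ := fun ξ => ((‖ξ‖ ^ α : ℝ) : ℂ) * g ξ with hf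
  have hfm : Measurable f := by fun_prop
  have hfe : ∀ ξ, ‖f ξ‖ₑ = ENNReal.ofReal (‖ξ‖ ^ α) * ‖g ξ‖ₑ := fun ξ => by
    rw [hf, enorm_mul, ← ofReal_norm, Complex.norm_real, Real.norm_of_nonneg (by positivity)]
  set U : EuclideanSpace ℝ (Fin n) × ℝ → ℂ := fun z => ∫ ξ, planeWave β z ξ * f ξ with hU
  have hUm : Measurable U := by
    refine (StronglyMeasurable.integral_prod_right' (f := fun w :
      (EuclideanSpace ℝ (Fin n) × ℝ) × EuclideanSpace ℝ (Fin n) => planeWave β w.1 w.2 * f w.2)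
      (Measurable.stronglyMeasurable ?_)).measurable
    exact (measurable_planeWave β).mul (hfm.comp measurable_snd)
  set D : EuclideanSpace ℝ (Fin n) → EuclideanSpace ℝ (Fin n) → ℝ≥0∞ := fun ξ η =>
    ENNReal.ofReal √(π / ε) * ENNReal.ofReal (exp (-(‖ξ‖ ^ β - ‖η‖ ^ β) ^ 2 / (4 * ε))) with hD
  have slice : ∀ s : ℝ, 0 < s →
      ∫⁻ z, ENNReal.ofReal (gaussianWeight (1 / (4 * s)) ε z) * ‖U z‖ₑ ^ 2 ≤
        ∫⁻ ξ, ∫⁻ η, ‖f ξ‖ₑ * ‖f η‖ₑ * (ENNReal.ofReal ((4 * π * s) ^ ((n : ℝ) / 2)) *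
          ENNReal.ofReal (exp (-s * ‖ξ - η‖ ^ 2)) * D ξ η) := by
    intro s hs
    have hb : 0 < 1 / (4 * s) := by positivity
    have := isFiniteMeasure_gaussianWeight (n := n) hb hε
    have h := lintegral_enorm_integral_sq_le (ν := volume)
      (μ := (volume : Measure (EuclideanSpace ℝ (Fin n) × ℝ)).withDensity
        fun z => ENNReal.ofReal (gaussianWeight (1 / (4 * s)) ε z))
      (measurable_planeWave β) (fun z ξ => (norm_planeWave β z ξ).le) hint
    rw [lintegral_withDensity_eq_lintegral_mul _ (by unfold gaussianWeight; fun_prop)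
      (hUm.enorm.pow_const 2)] at h
    refine h.trans (lintegral_mono fun ξ => lintegral_mono fun η => le_of_eq ?_)
    beta_reduce
    rw [enorm_integral_planeWave_gaussianWeight β hb hε]
    congr 5
    · field_simp
    · field_simp
  have hin : ∀ ξ η, ∫⁻ s in Set.Ioi (0 : ℝ), ENNReal.ofReal (s ^ (-γ / 2 - 1)) *
        (‖f ξ‖ₑ * ‖f η‖ₑ * (ENNReal.ofReal ((4 * π * s) ^ ((n : ℝ) / 2)) *
          ENNReal.ofReal (exp (-s * ‖ξ - η‖ ^ 2)) * D ξ η)) ≤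
      c * ((ENNReal.ofReal (‖ξ‖ ^ α) * ‖g ξ‖ₑ) * (ENNReal.ofReal (‖η‖ ^ α) * ‖g η‖ₑ) *
        (D ξ η * ‖ξ - η‖ₑ ^ (γ - n))) := by
    intro ξ η
    calc _ = ∫⁻ s in Set.Ioi (0 : ℝ), (‖f ξ‖ₑ * ‖f η‖ₑ * D ξ η *
            ENNReal.ofReal ((4 * π) ^ ((n : ℝ) / 2))) *
            (ENNReal.ofReal (s ^ (a - 1)) * ENNReal.ofReal (exp (-s * ‖ξ - η‖ ^ 2))) := by
          refine setLIntegral_congr_fun measurableSet_Ioi fun s hs => ?_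
          have hs : 0 < s := hs
          have e : s ^ (a - 1) = s ^ (-γ / 2 - 1) * s ^ ((n : ℝ) / 2) := by
            rw [← Real.rpow_add hs, ha]; congr 1; ring
          beta_reduce
          rw [e, Real.mul_rpow (by positivity) hs.le, ENNReal.ofReal_mul (by positivity),
            ENNReal.ofReal_mul (by positivity)]
          ring
      _ ≤ (‖f ξ‖ₑ * ‖f η‖ₑ * D ξ η * ENNReal.ofReal ((4 * π) ^ ((n : ℝ) / 2))) *
            (ENNReal.ofReal (Gamma a) * ENNReal.ofReal ‖ξ - η‖ ^ (-(2 * a))) := by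
          rw [lintegral_const_mul _ (by fun_prop)]
          gcongr
          exact lintegral_rpow_mul_exp_neg_le ha0 (norm_nonneg _)
      _ = _ := by
          rw [ofReal_norm, hfe, hfe, hc, show -(2 * a) = γ - n by rw [ha]; ring]
          ring
  calc _ ≤ ∫⁻ z : EuclideanSpace ℝ (Fin n) × ℝ, ENNReal.ofReal (exp (-ε * z.2 ^ 2)) *
          ((C₁ * ∫⁻ s in Set.Ioi (0 : ℝ), ENNReal.ofReal (s ^ (-γ / 2 - 1)) *
            ENNReal.ofReal (exp (-(1 / (4 * s)) * ‖z.1‖ ^ 2))) * ‖U z‖ₑ ^ 2) := by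
        gcongr with z
        exact hw _ (norm_nonneg _)
    _ = ∫⁻ z : EuclideanSpace ℝ (Fin n) × ℝ, C₁ * ∫⁻ s in Set.Ioi (0 : ℝ),
          ENNReal.ofReal (s ^ (-γ / 2 - 1)) *
            (ENNReal.ofReal (gaussianWeight (1 / (4 * s)) ε z) * ‖U z‖ₑ ^ 2) := by
        refine lintegral_congr fun z => ?_
        have e : ∀ s : ℝ, ENNReal.ofReal (s ^ (-γ / 2 - 1)) *
            (ENNReal.ofReal (gaussianWeight (1 / (4 * s)) ε z) * ‖U z‖ₑ ^ 2) =
            ENNReal.ofReal (s ^ (-γ / 2 - 1)) *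
              ENNReal.ofReal (exp (-(1 / (4 * s)) * ‖z.1‖ ^ 2)) *
                (ENNReal.ofReal (exp (-ε * z.2 ^ 2)) * ‖U z‖ₑ ^ 2) := fun s => by
          rw [gaussianWeight, ENNReal.ofReal_mul (by positivity)]
          ring
        simp_rw [e]
        rw [lintegral_mul_const' _ _ (by finiteness)]
        ring
    _ = C₁ * ∫⁻ s in Set.Ioi (0 : ℝ), ENNReal.ofReal (s ^ (-γ / 2 - 1)) *
          ∫⁻ z, ENNReal.ofReal (gaussianWeight (1 / (4 * s)) ε z) * ‖U z‖ₑ ^ 2 := by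
        rw [lintegral_const_mul' _ _ hC₁, lintegral_lintegral_swap]
        · congr 1
          refine lintegral_congr fun s => ?_
          rw [lintegral_const_mul' _ _ ENNReal.ofReal_ne_top]
        · unfold gaussianWeight Function.uncurry
          fun_prop
    _ ≤ C₁ * ∫⁻ s in Set.Ioi (0 : ℝ), ENNReal.ofReal (s ^ (-γ / 2 - 1)) *
          ∫⁻ w : EuclideanSpace ℝ (Fin n) × EuclideanSpace ℝ (Fin n), ‖f w.1‖ₑ * ‖f w.2‖ₑ *
            (ENNReal.ofReal ((4 * π * s) ^ ((n : ℝ) / 2)) *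
              ENNReal.ofReal (exp (-s * ‖w.1 - w.2‖ ^ 2)) * D w.1 w.2) := by
        gcongr 1
        refine setLIntegral_mono' measurableSet_Ioi fun s hs => ?_
        gcongr 1
        refine (slice s hs).trans_eq ?_
        rw [Measure.volume_eq_prod, lintegral_prod _ (by fun_prop)]
    _ = C₁ * ∫⁻ w : EuclideanSpace ℝ (Fin n) × EuclideanSpace ℝ (Fin n),
          ∫⁻ s in Set.Ioi (0 : ℝ), ENNReal.ofReal (s ^ (-γ / 2 - 1)) *
            (‖f w.1‖ₑ * ‖f w.2‖ₑ * (ENNReal.ofReal ((4 * π * s) ^ ((n : ℝ) / 2)) *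
              ENNReal.ofReal (exp (-s * ‖w.1 - w.2‖ ^ 2)) * D w.1 w.2)) := by
        rw [lintegral_lintegral_swap]
        · congr 1
          refine lintegral_congr fun s => ?_
          rw [lintegral_const_mul' _ _ ENNReal.ofReal_ne_top]
        · unfold Function.uncurry
          fun_prop
    _ ≤ C₁ * ∫⁻ w : EuclideanSpace ℝ (Fin n) × EuclideanSpace ℝ (Fin n),
          c * ((ENNReal.ofReal (‖w.1‖ ^ α) * ‖g w.1‖ₑ) * (ENNReal.ofReal (‖w.2‖ ^ α) * ‖g w.2‖ₑ) *
            (D w.1 w.2 * ‖w.1 - w.2‖ₑ ^ (γ - n))) := by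
        gcongr with w
        exact hin _ _
    _ = C₁ * (c * ∫⁻ ξ, ∫⁻ η, (ENNReal.ofReal (‖ξ‖ ^ α) * ‖g ξ‖ₑ) *
          (ENNReal.ofReal (‖η‖ ^ α) * ‖g η‖ₑ) * (D ξ η * ‖ξ - η‖ₑ ^ (γ - n))) := by
        rw [lintegral_const_mul' _ _ hc', Measure.volume_eq_prod, lintegral_prod _ (by fun_prop)]
    _ ≤ C₁ * (c * (2 * C₂ * ∫⁻ ξ, ‖g ξ‖ₑ ^ 2)) := by
        gcongr
        refine lintegral_lintegral_mul_kernel_le (K := fun ξ η => D ξ η * ‖ξ - η‖ₑ ^ (γ - n))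
          (a := fun ξ => ENNReal.ofReal (‖ξ‖ ^ α)) (g := fun ξ => ‖g ξ‖ₑ) (by fun_prop) (by fun_prop)
          ?_ (fun ξ η => ?_) (hk ε hε)
        · unfold Function.uncurry
          fun_prop
        · simp only [hD]
          rw [← enorm_neg, neg_sub, ← neg_sub (‖η‖ ^ β), neg_sq]
    _ = _ := by ring

lemma exists_lintegral_smoothing_le {n : ℕ} (hn : 2 ≤ n) {α β : ℝ} (hα : 0 ≤ α)
    (h1 : 1 < β - 2 * α) (h2 : β - 2 * α < n) :
    ∃ C : ℝ≥0∞, C ≠ ∞ ∧ ∀ g : EuclideanSpace ℝ (Fin n) → ℂ, Measurable g →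
      Integrable (fun ξ => ((‖ξ‖ ^ α : ℝ) : ℂ) * g ξ) →
        ∫⁻ t : ℝ, ∫⁻ x : EuclideanSpace ℝ (Fin n), ENNReal.ofReal (‖x‖ ^ (β - 2 * α))⁻¹ *
            ‖∫ ξ, planeWave β (x, t) ξ * (((‖ξ‖ ^ α : ℝ) : ℂ) * g ξ)‖ₑ ^ 2 ≤
          C * ∫⁻ ξ, ‖g ξ‖ₑ ^ 2 := by
  obtain ⟨C, hC, h⟩ := exists_lintegral_gaussian_smoothing_le hn hα h1 h2
  refine ⟨C, hC, fun g hg hint => ?_⟩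
  set F : EuclideanSpace ℝ (Fin n) × ℝ → ℝ≥0∞ := fun z =>
    ENNReal.ofReal (‖z.1‖ ^ (β - 2 * α))⁻¹ *
      ‖∫ ξ, planeWave β z ξ * (((‖ξ‖ ^ α : ℝ) : ℂ) * g ξ)‖ₑ ^ 2 with hF
  have hUm : Measurable fun z : EuclideanSpace ℝ (Fin n) × ℝ =>
      ∫ ξ, planeWave β z ξ * (((‖ξ‖ ^ α : ℝ) : ℂ) * g ξ) := by
    have hf : Measurable fun ξ => ((‖ξ‖ ^ α : ℝ) : ℂ) * g ξ := by fun_prop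
    refine (StronglyMeasurable.integral_prod_right' (f := fun w :
      (EuclideanSpace ℝ (Fin n) × ℝ) × EuclideanSpace ℝ (Fin n) =>
        planeWave β w.1 w.2 * (((‖w.2‖ ^ α : ℝ) : ℂ) * g w.2))
      (Measurable.stronglyMeasurable ?_)).measurable
    exact (measurable_planeWave β).mul (hf.comp measurable_snd)
  have hFm : Measurable F := by fun_prop
  have htend : ∀ z : EuclideanSpace ℝ (Fin n) × ℝ, Filter.Tendsto
      (fun k : ℕ => ENNReal.ofReal (exp (-(1 / ((k : ℝ) + 1)) * z.2 ^ 2)) * F z)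
      Filter.atTop (nhds (F z)) := by
    intro z
    have h0 : Filter.Tendsto (fun k : ℕ => ENNReal.ofReal (exp (-(1 / ((k : ℝ) + 1)) * z.2 ^ 2)))
        Filter.atTop (nhds 1) := by
      have := ENNReal.tendsto_ofReal ((Real.continuous_exp.tendsto _).comp
        ((tendsto_one_div_add_atTop_nhds_zero_nat (𝕜 := ℝ)).neg.mul_const (z.2 ^ 2)))
      simpa using this
    simpa using ENNReal.Tendsto.mul_const h0 (.inl one_ne_zero)
  calc _ = ∫⁻ z, F z := by
        rw [Measure.volume_eq_prod, lintegral_prod_symm _ hFm.aemeasurable]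
    _ = ∫⁻ z, Filter.liminf (fun k : ℕ =>
          ENNReal.ofReal (exp (-(1 / ((k : ℝ) + 1)) * z.2 ^ 2)) * F z) Filter.atTop :=
        lintegral_congr fun z => (htend z).liminf_eq.symm
    _ ≤ Filter.liminf (fun k : ℕ =>
          ∫⁻ z, ENNReal.ofReal (exp (-(1 / ((k : ℝ) + 1)) * z.2 ^ 2)) * F z) Filter.atTop :=
        lintegral_liminf_le fun k => by fun_prop
    _ ≤ Filter.liminf (fun _ : ℕ => C * ∫⁻ ξ, ‖g ξ‖ₑ ^ 2) Filter.atTop :=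
        Filter.liminf_le_liminf (.of_forall fun k => h g hg hint _ (by positivity))
    _ = _ := Filter.liminf_const _

lemma fourierInt_eq_fourier {n : ℕ} (φ₀ : 𝓢(EuclideanSpace ℝ (Fin n), ℂ))
    (ξ : EuclideanSpace ℝ (Fin n)) :
    fourierInt (fun y => φ₀ y) ξ = FourierTransform.fourier φ₀ ((2 * π)⁻¹ • ξ) := by
  rw [SchwartzMap.fourier_coe, Real.fourier_eq', fourierInt]
  refine integral_congr_ae (.of_forall fun x => ?_)
  beta_reduce
  rw [smul_eq_mul, inner_smul_right]
  congr 2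
  rw [← mul_assoc, show -2 * π * (2 * π)⁻¹ = -1 by field_simp]
  push_cast
  ring

lemma SchwartzMap.integrable_norm_rpow_mul {n : ℕ} {α : ℝ} (hα : 0 ≤ α)
    (ψ : 𝓢(EuclideanSpace ℝ (Fin n), ℂ)) :
    Integrable fun ξ => ((‖ξ‖ ^ α : ℝ) : ℂ) * ψ ξ := by
  obtain ⟨k, hk⟩ := exists_nat_ge α
  refine ((ψ.integrable_pow_mul volume 0).add (ψ.integrable_pow_mul volume k)).mono'
    (by have := ψ.continuous.measurable; fun_prop) (.of_forall fun ξ => ?_)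
  rw [norm_mul, Complex.norm_real, Real.norm_of_nonneg (by positivity), Pi.add_apply, pow_zero,
    ← add_mul]
  gcongr
  rcases le_total ‖ξ‖ 1 with h | h
  · exact (Real.rpow_le_one (norm_nonneg _) h hα).trans (le_add_of_nonneg_right (by positivity))
  · refine (Real.rpow_le_rpow_of_exponent_le h hk).trans ?_
    rw [Real.rpow_natCast]
    exact le_add_of_nonneg_left zero_le_one

lemma integrable_norm_rpow_mul_fourierInt {n : ℕ} {α : ℝ} (hα : 0 ≤ α)
    (φ₀ : 𝓢(EuclideanSpace ℝ (Fin n), ℂ)) :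
    Integrable fun ξ => ((‖ξ‖ ^ α : ℝ) : ℂ) * fourierInt (fun y => φ₀ y) ξ := by
  have hpi : (2 * π)⁻¹ ≠ 0 := by positivity
  refine ((((FourierTransform.fourier φ₀).integrable_norm_rpow_mul hα).comp_smul
    hpi).const_mul (((2 * π) ^ α : ℝ) : ℂ)).congr (.of_forall fun ξ => ?_)
  beta_reduce
  rw [fourierInt_eq_fourier, ← mul_assoc, ← Complex.ofReal_mul, norm_smul,
    Real.norm_of_nonneg (by positivity), ← Real.mul_rpow (by positivity) (by positivity),
    mul_inv_cancel_left₀ (by positivity)]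

lemma SchwartzMap.lintegral_enorm_sq {n : ℕ} (ψ : 𝓢(EuclideanSpace ℝ (Fin n), ℂ)) :
    ∫⁻ x, ‖ψ x‖ₑ ^ 2 = ENNReal.ofReal (∫ x, ‖ψ x‖ ^ 2) := by
  rw [ofReal_integral_eq_lintegral_ofReal
    (by simpa using (ψ.memLp 2).integrable_norm_pow (by simp)) (.of_forall fun x => by positivity)]
  simp_rw [ENNReal.ofReal_pow (norm_nonneg _), ofReal_norm]

lemma lintegral_enorm_fourierInt_sq {n : ℕ} (φ₀ : 𝓢(EuclideanSpace ℝ (Fin n), ℂ)) :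
    ∫⁻ ξ, ‖fourierInt (fun y => φ₀ y) ξ‖ₑ ^ 2 =
      ENNReal.ofReal ((2 * π) ^ n) * ENNReal.ofReal (∫ x, ‖φ₀ x‖ ^ 2) := by
  simp_rw [fourierInt_eq_fourier]
  have h := (FourierTransform.fourier φ₀).continuous.measurable
  rw [← lintegral_map (f := fun ξ => ‖FourierTransform.fourier φ₀ ξ‖ₑ ^ 2) (by fun_prop)
    (measurable_const_smul (2 * π)⁻¹), Measure.map_addHaar_smul _ (by positivity),
    lintegral_smul_measure, SchwartzMap.lintegral_enorm_sq, SchwartzMap.integral_norm_sq_fourier,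
    finrank_euclideanSpace_fin, inv_pow, inv_inv, abs_of_pos (by positivity), smul_eq_mul]

lemma enorm_gradProp_sq_div {n : ℕ} (α β γ : ℝ) (φ₀ : 𝓢(EuclideanSpace ℝ (Fin n), ℂ))
    (x : EuclideanSpace ℝ (Fin n)) (t : ℝ) :
    ‖‖gradProp α β φ₀ x t‖ ^ 2 / ‖x‖ ^ γ‖ₑ =
      ENNReal.ofReal (((2 * π) ^ n)⁻¹ ^ 2) * (ENNReal.ofReal (‖x‖ ^ γ)⁻¹ *
        ‖∫ ξ, planeWave β (x, t) ξ *
          (((‖ξ‖ ^ α : ℝ) : ℂ) * fourierInt (fun y => φ₀ y) ξ)‖ₑ ^ 2) := by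
  have e : gradProp α β φ₀ x t = ((((2 * π) ^ n)⁻¹ : ℝ) : ℂ) * ∫ ξ, planeWave β (x, t) ξ *
      (((‖ξ‖ ^ α : ℝ) : ℂ) * fourierInt (fun y => φ₀ y) ξ) := by
    rw [gradProp, Complex.ofReal_inv]
    congr 1
    refine integral_congr_ae (.of_forall fun ξ => ?_)
    simp only [planeWave]
    ring
  rw [e, norm_mul, Complex.norm_real, Real.norm_of_nonneg (by positivity), mul_pow, div_eq_mul_inv,
    Real.enorm_of_nonneg (by positivity), ENNReal.ofReal_mul (by positivity),
    ENNReal.ofReal_mul (by positivity), ENNReal.ofReal_pow (norm_nonneg _), ofReal_norm]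
  ring

/-- Kato-type smoothing estimate for `i φ_t = (-Δ)^{β/2} φ` on `ℝⁿ`, `1 < β - 2α < n`. -/
theorem kato_smoothing_estimate (n : ℕ) (hn : 2 ≤ n) (α β : ℝ) (hα : 0 ≤ α)
    (h1 : 1 < β - 2 * α) (h2 : β - 2 * α < n) :
    ∃ C : ℝ, ∀ φ₀ : SchwartzMap (EuclideanSpace ℝ (Fin n)) ℂ,
      (∫ t : ℝ, ∫ x : EuclideanSpace ℝ (Fin n),
          ‖gradProp α β φ₀ x t‖ ^ 2 / ‖x‖ ^ (β - 2 * α)) ≤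
        C * ∫ x : EuclideanSpace ℝ (Fin n), ‖φ₀ x‖ ^ 2 := by
  obtain ⟨C, hC, h⟩ := exists_lintegral_smoothing_le hn hα h1 h2
  set c : ℝ≥0∞ := ENNReal.ofReal (((2 * π) ^ n)⁻¹ ^ 2) with hc
  refine ⟨(c * (C * ENNReal.ofReal ((2 * π) ^ n))).toReal, fun φ₀ => ?_⟩
  have hI : 0 ≤ ∫ x, ‖φ₀ x‖ ^ 2 := integral_nonneg fun x => by positivity
  have hm : Measurable (fourierInt fun y => φ₀ y) := by
    rw [funext (fourierInt_eq_fourier φ₀)]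
    exact (FourierTransform.fourier φ₀).continuous.measurable.comp (measurable_const_smul _)
  rw [← ENNReal.ofReal_le_ofReal_iff (by positivity)]
  calc _ ≤ ‖∫ t : ℝ, ∫ x : EuclideanSpace ℝ (Fin n),
          ‖gradProp α β φ₀ x t‖ ^ 2 / ‖x‖ ^ (β - 2 * α)‖ₑ := Real.ofReal_le_enorm _
    _ ≤ ∫⁻ t : ℝ, ∫⁻ x : EuclideanSpace ℝ (Fin n),
          ‖‖gradProp α β φ₀ x t‖ ^ 2 / ‖x‖ ^ (β - 2 * α)‖ₑ :=
        (enorm_integral_le_lintegral_enorm _).trans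
          (lintegral_mono fun t => enorm_integral_le_lintegral_enorm _)
    _ = c * ∫⁻ t : ℝ, ∫⁻ x : EuclideanSpace ℝ (Fin n), ENNReal.ofReal (‖x‖ ^ (β - 2 * α))⁻¹ *
            ‖∫ ξ, planeWave β (x, t) ξ *
              (((‖ξ‖ ^ α : ℝ) : ℂ) * fourierInt (fun y => φ₀ y) ξ)‖ₑ ^ 2 := by
        simp_rw [enorm_gradProp_sq_div, lintegral_const_mul' _ _ ENNReal.ofReal_ne_top, hc]
    _ ≤ c * (C * ∫⁻ ξ, ‖fourierInt (fun y => φ₀ y) ξ‖ₑ ^ 2) := by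
        gcongr
        exact h _ hm (integrable_norm_rpow_mul_fourierInt hα φ₀)
    _ = _ := by
        rw [lintegral_enorm_fourierInt_sq, ENNReal.ofReal_mul ENNReal.toReal_nonneg,
          ENNReal.ofReal_toReal (by finiteness)]
        ring
end

section
/- Let n ≥ 2, α ≥ 0 and β ∈ ℝ satisfy 1 < β − 2α < n. Then there exists a constant C = C(n, α, β) such that for every spherically symmetric (radial) Schwartz function φ₀ on ℝⁿ, the solution φ of i φ_t = (−Δ)^{β/2} φ with φ(·,0) = φ₀ satisfies the identity ∫_{−∞}^{∞} ∫_{ℝⁿ} | |∇|^α φ(x,t) |² / |x|^{β−2α} dx dt = C ‖φ₀‖_{L²(ℝⁿ)}², and moreover this same constant C satisfies ∫_{−∞}^{∞} ∫_{ℝⁿ} | |∇|^α φ(x,t) |² / |x|^{β−2α} dx dt ≤ C ‖φ₀‖_{L²(ℝⁿ)}² for every (not necessarily radial) Schwartz function φ₀. -/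
open MeasureTheory Real SchwartzMap

section Smoothing

open Set Metric Module
open scoped ENNReal ComplexConjugate FourierTransform Pointwise

lemma eLpNorm_two_sq {X F : Type*} [MeasurableSpace X] [NormedAddCommGroup F] (μ : Measure X)
    (u : X → F) : eLpNorm u 2 μ ^ 2 = ∫⁻ x, ‖u x‖ₑ ^ 2 ∂μ := by
  simpa using eLpNorm_nnreal_pow_eq_lintegral (f := u) (μ := μ) (p := 2) (by norm_num)

/-- Plancherel's theorem for functions in `L¹ ∩ L²`. -/
theorem lintegral_enorm_sq_fourier {h : ℝ → ℂ} (h1 : Integrable h) (h2 : MemLp h 2) :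
    ∫⁻ w, ‖𝓕 h w‖ₑ ^ 2 = ∫⁻ v, ‖h v‖ₑ ^ 2 := by
  set F : Lp ℂ 2 (volume : Measure ℝ) := h2.toLp h
  have hcont : Continuous (𝓕 h) :=
    VectorFourier.fourierIntegral_continuous Real.continuous_fourierChar continuous_inner h1
  have key : ∀ᵐ w, (𝓕 F : Lp ℂ 2 (volume : Measure ℝ)) w = 𝓕 h w := by
    apply ae_eq_of_integral_contDiff_smul_eq
    · exact (Lp.memLp _).locallyIntegrable (by norm_num)
    · exact hcont.locallyIntegrable
    · intro g hg hgc
      have hg₁ : HasCompactSupport (Complex.ofRealCLM ∘ g) := hgc.comp_left rfl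
      have hg₂ : ContDiff ℝ (⊤ : ℕ∞) (Complex.ofRealCLM ∘ g) := by fun_prop
      set G : 𝓢(ℝ, ℂ) := hg₁.toSchwartzMap hg₂
      have e1 : (𝓕 (F : 𝓢'(ℝ, ℂ))) G = ((𝓕 F : Lp ℂ 2 (volume : Measure ℝ)) : 𝓢'(ℝ, ℂ)) G := by
        rw [Lp.fourier_toTemperedDistribution_eq]
      rw [TemperedDistribution.fourier_apply, Lp.toTemperedDistribution_apply,
        Lp.toTemperedDistribution_apply] at e1
      have hG : ∀ x, G x = (g x : ℂ) := fun x => rfl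
      have e2 : ∫ x, (𝓕 G) x • F x = ∫ x, (𝓕 G) x • h x := by
        apply integral_congr_ae
        filter_upwards [h2.coeFn_toLp] with x hx
        rw [hx]
      have e3 : ∫ x, (𝓕 (G : ℝ → ℂ)) x • h x = ∫ x, G x • (𝓕 h) x := by
        simpa using! (VectorFourier.integral_fourierIntegral_smul_eq_flip (L := innerₗ ℝ)
          Real.continuous_fourierChar continuous_inner G.integrable h1)
      rw [e2, SchwartzMap.fourier_coe, e3] at e1
      simpa [hG] using e1.symm
  have hn : ‖(𝓕 F : Lp ℂ 2 (volume : Measure ℝ))‖ₑ = ‖F‖ₑ := by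
    rw [enorm_eq_iff_norm_eq, Lp.norm_fourier_eq]
  rw [← eLpNorm_two_sq, ← eLpNorm_two_sq, ← eLpNorm_congr_ae key, ← eLpNorm_congr_ae h2.coeFn_toLp,
    ← Lp.enorm_def, ← Lp.enorm_def, hn]

section Sphere

variable {E : Type*} [NormedAddCommGroup E] [InnerProductSpace ℝ E]

/-- The action of a linear isometry on the unit sphere. -/
def sphereIsometry (L : E ≃ₗᵢ[ℝ] E) (ω : sphere (0 : E) 1) : sphere (0 : E) 1 :=
  ⟨L ω, by simp⟩

lemma continuous_sphereIsometry (L : E ≃ₗᵢ[ℝ] E) : Continuous (sphereIsometry L) := by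
  unfold sphereIsometry
  fun_prop

end Sphere

section Polar

variable {E : Type*} [NormedAddCommGroup E] [InnerProductSpace ℝ E] [FiniteDimensional ℝ E]
  [MeasurableSpace E] [BorelSpace E]

/-- The measure `r ^ (d - 1) dr` on the half-line `(0, ∞)`, as a measure on `ℝ`. -/
noncomputable def radialMeasure (d : ℕ) : Measure ℝ :=
  (volume.restrict (Ioi 0)).withDensity fun r => ENNReal.ofReal (r ^ (d - 1))

lemma map_val_volumeIoiPow (d : ℕ) :
    (Measure.volumeIoiPow (d - 1)).map Subtype.val = radialMeasure d := by
  ext s hs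
  rw [Measure.map_apply measurable_subtype_coe hs, Measure.volumeIoiPow, radialMeasure,
    withDensity_apply _ (measurable_subtype_coe hs), withDensity_apply _ hs,
    Measure.restrict_restrict hs,
    setLIntegral_subtype measurableSet_Ioi _ fun a : ℝ ↦ ENNReal.ofReal (a ^ (d - 1)),
    Subtype.image_preimage_coe, inter_comm]

instance (d : ℕ) : SFinite (radialMeasure d) := by
  rw [← map_val_volumeIoiPow]; infer_instance

/-- Polar coordinates. -/
lemma measurePreserving_polar [Nontrivial E] :
    MeasurePreserving (fun p : sphere (0 : E) 1 × ℝ => p.2 • (p.1 : E))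
      ((volume : Measure E).toSphere.prod (radialMeasure (finrank ℝ E))) volume := by
  have hm : Measurable (fun p : sphere (0 : E) 1 × ℝ => p.2 • (p.1 : E)) := by fun_prop
  refine ⟨hm, ?_⟩
  have h1 : (volume : Measure E).toSphere.prod (radialMeasure (finrank ℝ E)) =
      ((volume : Measure E).toSphere.prod (Measure.volumeIoiPow (finrank ℝ E - 1))).map
        (Prod.map id Subtype.val) := by
    rw [← Measure.map_prod_map _ _ measurable_id measurable_subtype_coe, Measure.map_id,
      map_val_volumeIoiPow]
  have h2 := (MeasurePreserving.symm (homeomorphUnitSphereProd E).toMeasurableEquiv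
    (Measure.measurePreserving_homeomorphUnitSphereProd (volume : Measure E))).map_eq
  rw [h1, Measure.map_map hm (by fun_prop)]
  have h3 : (fun p : sphere (0 : E) 1 × ℝ => p.2 • (p.1 : E)) ∘ (Prod.map id Subtype.val) =
      Subtype.val ∘ (homeomorphUnitSphereProd E).toMeasurableEquiv.symm := by
    ext p; simp
  rw [h3, ← Measure.map_map measurable_subtype_coe (MeasurableEquiv.measurable _), h2,
    (MeasurableEmbedding.subtype_coe (measurableSet_singleton _).compl).map_comap,
    Subtype.range_coe, restrict_compl_singleton]

lemma lintegral_radialMeasure (d : ℕ) {f : ℝ → ℝ≥0∞} (hf : Measurable f) :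
    ∫⁻ r, f r ∂radialMeasure d = ∫⁻ r in Ioi 0, ENNReal.ofReal (r ^ (d - 1)) * f r := by
  rw [radialMeasure, lintegral_withDensity_eq_lintegral_mul _ (by fun_prop) hf]; rfl

lemma integral_radialMeasure (d : ℕ) (f : ℝ → ℂ) :
    ∫ r, f r ∂radialMeasure d = ∫ r in Ioi 0, ((r ^ (d - 1) : ℝ) : ℂ) * f r := by
  rw [radialMeasure]
  simp only [ENNReal.ofReal]
  rw [integral_withDensity_eq_integral_smul (by fun_prop)]
  refine setIntegral_congr_fun measurableSet_Ioi fun r (hr : 0 < r) => ?_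
  simp [NNReal.smul_def, Real.coe_toNNReal _ (pow_nonneg hr.le _)]

lemma lintegral_polar [Nontrivial E] {G : E → ℝ≥0∞} (hG : Measurable G) :
    ∫⁻ x, G x = ∫⁻ r in Ioi 0, ENNReal.ofReal (r ^ (finrank ℝ E - 1)) *
      ∫⁻ ω : sphere (0 : E) 1, G (r • (ω : E)) ∂(volume : Measure E).toSphere := by
  have hm : Measurable (fun p : sphere (0 : E) 1 × ℝ => G (p.2 • (p.1 : E))) := by fun_prop
  rw [← measurePreserving_polar.lintegral_comp hG, lintegral_prod_symm _ hm.aemeasurable,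
    lintegral_radialMeasure _ hm.lintegral_prod_left']

lemma integral_polar [Nontrivial E] {G : E → ℂ} (hG : Integrable G) :
    ∫ x, G x = ∫ r in Ioi 0, ((r ^ (finrank ℝ E - 1) : ℝ) : ℂ) *
      ∫ ω : sphere (0 : E) 1, G (r • (ω : E)) ∂(volume : Measure E).toSphere := by
  have hP := measurePreserving_polar (E := E)
  have hi : Integrable (fun p : sphere (0 : E) 1 × ℝ => G (p.2 • (p.1 : E)))
      ((volume : Measure E).toSphere.prod (radialMeasure (finrank ℝ E))) :=
    hP.integrable_comp_of_integrable hG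
  rw [← integral_radialMeasure, ← integral_prod_symm _ hi]
  conv_lhs => rw [← hP.map_eq]
  rw [integral_map hP.measurable.aemeasurable (by rw [hP.map_eq]; exact hG.1)]

lemma measurePreserving_sphereIsometry (L : E ≃ₗᵢ[ℝ] E) :
    MeasurePreserving (sphereIsometry L) (volume : Measure E).toSphere
      (volume : Measure E).toSphere := by
  have hm := (continuous_sphereIsometry L).measurable
  refine ⟨hm, ?_⟩
  ext s hs
  rw [Measure.map_apply hm hs, Measure.toSphere_apply' _ (hm hs), Measure.toSphere_apply' _ hs]
  congr 1
  have : Ioo (0 : ℝ) 1 • ((↑) '' (sphereIsometry L ⁻¹' s) : Set E) =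
      L ⁻¹' (Ioo (0 : ℝ) 1 • ((↑) '' s)) := by
    ext x
    simp only [mem_smul, mem_image, mem_preimage]
    constructor
    · rintro ⟨r, hr, _, ⟨ω, hω, rfl⟩, rfl⟩
      exact ⟨r, hr, _, ⟨_, hω, rfl⟩, by simp [sphereIsometry]⟩
    · rintro ⟨r, hr, _, ⟨ω, hω, rfl⟩, h⟩
      refine ⟨r, hr, _, ⟨sphereIsometry L.symm ω, ?_, rfl⟩, ?_⟩
      · simpa [sphereIsometry] using hω
      · apply L.injective
        rw [← h]; simp [sphereIsometry]
  rw [this, L.measurePreserving.measure_preimage_emb L.toHomeomorph.measurableEmbedding]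

/-- Integrals of zonal functions over the sphere do not depend on the pole. -/
lemma integral_sphere_dist {k : ℝ → ℝ} (hk : Continuous k) (ω₁ ω₂ : sphere (0 : E) 1) :
    ∫ ω : sphere (0 : E) 1, k ‖(ω₁ : E) - ω‖ ∂(volume : Measure E).toSphere =
      ∫ ω : sphere (0 : E) 1, k ‖(ω₂ : E) - ω‖ ∂(volume : Measure E).toSphere := by
  obtain ⟨L, hL⟩ : ∃ L : E ≃ₗᵢ[ℝ] E, L ω₁ = ω₂ :=
    ⟨(ℝ ∙ ((ω₁ : E) - ω₂))ᗮ.reflection, Submodule.reflection_sub (by simp)⟩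
  have hP := measurePreserving_sphereIsometry L
  conv_rhs => rw [← hP.map_eq]
  rw [integral_map hP.measurable.aemeasurable (by fun_prop)]
  congr with ω
  simp only [sphereIsometry]
  rw [← hL, ← map_sub, L.norm_map]

end Polar

section GaussianSphere

variable {E : Type*} [NormedAddCommGroup E] [InnerProductSpace ℝ E] [FiniteDimensional ℝ E]
  [MeasurableSpace E] [BorelSpace E]

/-- The Fourier transform `x ↦ ∫ e^{i x·ω} g(ω) dσ(ω)` of a density on the unit sphere. -/
noncomputable def sphereExtension (g : sphere (0 : E) 1 → ℂ) (x : E) : ℂ :=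
  ∫ ω : sphere (0 : E) 1, Complex.exp (Complex.I * ((inner ℝ x (ω : E) : ℝ) : ℂ)) * g ω
    ∂(volume : Measure E).toSphere

/-- The Fourier transform of the Gaussian `e^{-a|x|²}`, as a function of the radius. -/
noncomputable def gaussianKernel (d : ℕ) (a ρ : ℝ) : ℝ :=
  (π / a) ^ (d / 2 : ℝ) * exp (-ρ ^ 2 / (4 * a))

lemma gaussianKernel_nonneg (d : ℕ) {a : ℝ} (ha : 0 < a) (ρ : ℝ) : 0 ≤ gaussianKernel d a ρ := by
  unfold gaussianKernel; positivity

lemma continuous_gaussianKernel (d : ℕ) (a : ℝ) : Continuous (gaussianKernel d a) := by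
  unfold gaussianKernel; fun_prop

lemma norm_exp_I_mul (t : ℝ) : ‖Complex.exp (Complex.I * (t : ℂ))‖ = 1 := by
  rw [mul_comm, Complex.norm_exp_ofReal_mul_I]

lemma integrable_sphere {F : Type*} [NormedAddCommGroup F] {g : sphere (0 : E) 1 → F}
    (hg : Continuous g) : Integrable g (volume : Measure E).toSphere :=
  integrableOn_univ.1 (hg.continuousOn.integrableOn_compact isCompact_univ)

lemma integral_gaussian_mul_exp {a : ℝ} (ha : 0 < a) (v : E) :
    ∫ x : E, ((exp (-a * ‖x‖ ^ 2) : ℝ) : ℂ) * Complex.exp (Complex.I * ((inner ℝ x v : ℝ) : ℂ)) =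
      gaussianKernel (finrank ℝ E) a ‖v‖ := by
  have h := GaussianFourier.integral_cexp_neg_mul_sq_norm_add (V := E) (b := (a : ℂ))
    (by simpa using ha) Complex.I v
  have e : ∀ x : E, ((exp (-a * ‖x‖ ^ 2) : ℝ) : ℂ) *
      Complex.exp (Complex.I * ((inner ℝ x v : ℝ) : ℂ)) =
      Complex.exp (-(a : ℂ) * ‖x‖ ^ 2 + Complex.I * ((inner ℝ v x : ℝ) : ℂ)) := by
    intro x
    rw [Complex.exp_add, real_inner_comm]; push_cast; rfl
  simp_rw [e]
  rw [h, gaussianKernel, Complex.ofReal_mul, Complex.ofReal_cpow (by positivity)]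
  push_cast
  rw [Complex.I_sq]
  congr 2
  ring

lemma continuous_sphereExtension {g : sphere (0 : E) 1 → ℂ} (hg : Continuous g) :
    Continuous (sphereExtension g) := by
  unfold sphereExtension
  refine continuous_of_dominated (bound := fun ω => ‖g ω‖) (fun x => ?_) (fun x => ?_)
    (integrable_sphere hg).norm ?_
  · exact (by fun_prop : Continuous fun ω : sphere (0 : E) 1 =>
      Complex.exp (Complex.I * ((inner ℝ x (ω : E) : ℝ) : ℂ)) * g ω).aestronglyMeasurable
  · exact .of_forall fun ω => by rw [norm_mul, norm_exp_I_mul, one_mul]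
  · exact .of_forall fun ω => by fun_prop

lemma norm_sphereExtension_le (g : sphere (0 : E) 1 → ℂ) (x : E) :
    ‖sphereExtension g x‖ ≤ ∫ ω, ‖g ω‖ ∂(volume : Measure E).toSphere := by
  refine (norm_integral_le_integral_norm _).trans (le_of_eq ?_)
  simp

lemma integrable_gaussian {a : ℝ} (ha : 0 < a) : Integrable fun x : E => exp (-a * ‖x‖ ^ 2) := by
  have h := (GaussianFourier.integrable_cexp_neg_mul_sq_norm_add (V := E) (b := (a : ℂ))
    (by simpa using ha) 0 0).norm
  refine h.congr (.of_forall fun x => ?_)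
  simp [Complex.norm_exp, ← Complex.ofReal_pow]

lemma integral_gaussian_mul_sphereExtension {a : ℝ} (ha : 0 < a) {g : sphere (0 : E) 1 → ℂ}
    (hg : Continuous g) :
    ((∫ x : E, exp (-a * ‖x‖ ^ 2) * ‖sphereExtension g x‖ ^ 2 : ℝ) : ℂ) =
      ∫ p : sphere (0 : E) 1 × sphere (0 : E) 1, g p.1 * conj (g p.2) *
        (gaussianKernel (finrank ℝ E) a ‖(p.1 : E) - p.2‖ : ℂ)
        ∂((volume : Measure E).toSphere.prod (volume : Measure E).toSphere) := by
  set σ := (volume : Measure E).toSphere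
  set Φ : E → sphere (0 : E) 1 × sphere (0 : E) 1 → ℂ := fun x p =>
    ((exp (-a * ‖x‖ ^ 2) : ℝ) : ℂ) *
      Complex.exp (Complex.I * ((inner ℝ x ((p.1 : E) - p.2) : ℝ) : ℂ)) * (g p.1 * conj (g p.2))
  have hΦc : Continuous (Function.uncurry Φ) := by
    unfold Function.uncurry Φ
    fun_prop
  have hgg : Integrable (fun p : sphere (0 : E) 1 × sphere (0 : E) 1 => g p.1 * conj (g p.2))
      (σ.prod σ) :=
    (integrable_sphere hg).mul_prod (integrable_sphere (g := fun ω => conj (g ω)) (by fun_prop))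
  have hΦ : Integrable (Function.uncurry Φ) (volume.prod (σ.prod σ)) := by
    refine (((integrable_gaussian ha).norm).mul_prod hgg.norm).mono'
      hΦc.aestronglyMeasurable (.of_forall fun q => ?_)
    simp only [Function.uncurry, Φ]
    rw [norm_mul, norm_mul, norm_exp_I_mul, mul_one, Complex.norm_real]
  have h1 : ∀ x : E, ((exp (-a * ‖x‖ ^ 2) * ‖sphereExtension g x‖ ^ 2 : ℝ) : ℂ) =
      ∫ p, Φ x p ∂(σ.prod σ) := by
    intro x
    simp only [Φ, mul_assoc]
    rw [integral_const_mul, Complex.ofReal_mul, Complex.ofReal_pow, ← Complex.mul_conj']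
    congr 1
    rw [sphereExtension, ← integral_conj, ← integral_prod_mul]
    congr with p
    rw [map_mul, ← Complex.exp_conj, inner_sub_right]
    simp only [map_mul, Complex.conj_I, Complex.conj_ofReal, Complex.ofReal_sub, mul_sub,
      Complex.exp_sub, neg_mul, Complex.exp_neg]
    field_simp
  rw [← integral_complex_ofReal]
  simp_rw [h1]
  rw [integral_integral_swap hΦ]
  congr with p
  simp only [Φ]
  rw [integral_mul_const, integral_gaussian_mul_exp ha, mul_comm]

/-- The integral of the Gaussian kernel over the unit sphere, seen from the pole `ω₀`. -/
noncomputable def gaussianMass (ω₀ : sphere (0 : E) 1) (a : ℝ) : ℝ :=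
  ∫ ω : sphere (0 : E) 1, gaussianKernel (finrank ℝ E) a ‖(ω₀ : E) - ω‖
    ∂(volume : Measure E).toSphere

lemma gaussianMass_nonneg (ω₀ : sphere (0 : E) 1) {a : ℝ} (ha : 0 < a) : 0 ≤ gaussianMass ω₀ a :=
  integral_nonneg fun _ => gaussianKernel_nonneg _ ha _

lemma integral_gaussianKernel (ω₀ ω : sphere (0 : E) 1) (a : ℝ) :
    ∫ ω' : sphere (0 : E) 1, gaussianKernel (finrank ℝ E) a ‖(ω : E) - ω'‖
      ∂(volume : Measure E).toSphere = gaussianMass ω₀ a :=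
  integral_sphere_dist (continuous_gaussianKernel _ _) _ _

lemma integral_sq_mul_gaussianKernel (ω₀ : sphere (0 : E) 1) (a : ℝ) {u : sphere (0 : E) 1 → ℝ}
    (hu : Continuous u) :
    ∫ p : sphere (0 : E) 1 × sphere (0 : E) 1, u p.1 *
        gaussianKernel (finrank ℝ E) a ‖(p.1 : E) - p.2‖
        ∂((volume : Measure E).toSphere.prod (volume : Measure E).toSphere) =
      gaussianMass ω₀ a * ∫ ω, u ω ∂(volume : Measure E).toSphere := by
  have hk := continuous_gaussianKernel (finrank ℝ E) a
  have hc : Continuous fun p : sphere (0 : E) 1 × sphere (0 : E) 1 => u p.1 *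
        gaussianKernel (finrank ℝ E) a ‖(p.1 : E) - p.2‖ := by fun_prop
  rw [integral_prod _ (integrableOn_univ.1 (hc.continuousOn.integrableOn_compact isCompact_univ))]
  simp_rw [integral_const_mul, integral_gaussianKernel ω₀]
  rw [integral_mul_const, mul_comm]

lemma integral_gaussian_mul_sphereExtension_le (ω₀ : sphere (0 : E) 1) {a : ℝ} (ha : 0 < a)
    {g : sphere (0 : E) 1 → ℂ} (hg : Continuous g) :
    ∫ x : E, exp (-a * ‖x‖ ^ 2) * ‖sphereExtension g x‖ ^ 2 ≤
      gaussianMass ω₀ a * ∫ ω, ‖g ω‖ ^ 2 ∂(volume : Measure E).toSphere := by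
  set σ := (volume : Measure E).toSphere
  have hk := continuous_gaussianKernel (finrank ℝ E) a
  set k : sphere (0 : E) 1 × sphere (0 : E) 1 → ℝ :=
    fun p => gaussianKernel (finrank ℝ E) a ‖(p.1 : E) - p.2‖
  have hkc : Continuous k := by fun_prop
  have hcts : ∀ {u : sphere (0 : E) 1 × sphere (0 : E) 1 → ℝ}, Continuous u →
      Integrable u (σ.prod σ) := fun hu =>
    integrableOn_univ.1 (hu.continuousOn.integrableOn_compact isCompact_univ)
  have hk0 : ∀ p, 0 ≤ k p := fun p => gaussianKernel_nonneg _ ha _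
  have hswap : ∫ p, ‖g p.2‖ ^ 2 * k p ∂(σ.prod σ) = ∫ p, ‖g p.1‖ ^ 2 * k p ∂(σ.prod σ) := by
    rw [← integral_prod_swap]
    congr with p
    simp [k, norm_sub_rev]
  have hfst : ∫ p, ‖g p.1‖ ^ 2 * k p ∂(σ.prod σ) = gaussianMass ω₀ a * ∫ ω, ‖g ω‖ ^ 2 ∂σ :=
    integral_sq_mul_gaussianKernel ω₀ a (u := fun ω => ‖g ω‖ ^ 2) (by fun_prop)
  calc ∫ x : E, exp (-a * ‖x‖ ^ 2) * ‖sphereExtension g x‖ ^ 2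
      ≤ ‖((∫ x : E, exp (-a * ‖x‖ ^ 2) * ‖sphereExtension g x‖ ^ 2 : ℝ) : ℂ)‖ := by
        rw [Complex.norm_real]; exact le_abs_self _
    _ ≤ ∫ p, ‖g p.1 * conj (g p.2) * (k p : ℂ)‖ ∂(σ.prod σ) := by
        rw [integral_gaussian_mul_sphereExtension ha hg]
        exact norm_integral_le_integral_norm _
    _ ≤ ∫ p, ((1 / 2) * (‖g p.1‖ ^ 2 * k p) + (1 / 2) * (‖g p.2‖ ^ 2 * k p)) ∂(σ.prod σ) := by
        refine integral_mono (hcts (by fun_prop)) (hcts (by fun_prop)) fun p => ?_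
        simp only [norm_mul, RCLike.norm_conj, Complex.norm_real, Real.norm_of_nonneg (hk0 p)]
        nlinarith [mul_nonneg (sq_nonneg (‖g p.1‖ - ‖g p.2‖)) (hk0 p)]
    _ = gaussianMass ω₀ a * ∫ ω, ‖g ω‖ ^ 2 ∂σ := by
        rw [integral_add (hcts (by fun_prop)) (hcts (by fun_prop)), integral_const_mul,
          integral_const_mul, hswap, hfst]
        ring

lemma integral_gaussian_mul_sphereExtension_const (ω₀ : sphere (0 : E) 1) {a : ℝ} (ha : 0 < a)
    (c : ℂ) :
    ∫ x : E, exp (-a * ‖x‖ ^ 2) * ‖sphereExtension (fun _ : sphere (0 : E) 1 => c) x‖ ^ 2 =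
      gaussianMass ω₀ a * ∫ _ω : sphere (0 : E) 1, ‖c‖ ^ 2 ∂(volume : Measure E).toSphere := by
  rw [← Complex.ofReal_inj, integral_gaussian_mul_sphereExtension ha continuous_const,
    ← integral_sq_mul_gaussianKernel ω₀ a (u := fun _ => ‖c‖ ^ 2) continuous_const,
    ← integral_complex_ofReal]
  congr with p
  rw [Complex.mul_conj']
  push_cast
  rfl

end GaussianSphere

section InnerSphere

variable {E : Type*} [NormedAddCommGroup E] [InnerProductSpace ℝ E]

lemma norm_smul_sub_sq (ω₀ ω : sphere (0 : E) 1) (r : ℝ) :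
    ‖r • (ω : E) - ω₀‖ ^ 2 = (1 - r) ^ 2 + r * ‖(ω₀ : E) - ω‖ ^ 2 := by
  rw [norm_sub_sq_real, norm_sub_sq_real, norm_smul, inner_smul_left, real_inner_comm]
  simp
  ring

end InnerSphere

section GaussianMass

variable {E : Type*} [NormedAddCommGroup E] [InnerProductSpace ℝ E] [FiniteDimensional ℝ E]
  [MeasurableSpace E] [BorelSpace E]

lemma gaussianMass_eq (ω₀ : sphere (0 : E) 1) (a : ℝ) :
    gaussianMass ω₀ a = (π / a) ^ (finrank ℝ E / 2 : ℝ) *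
      ∫ ω : sphere (0 : E) 1, exp (-‖(ω₀ : E) - ω‖ ^ 2 / (4 * a))
        ∂(volume : Measure E).toSphere := by
  simp only [gaussianMass, gaussianKernel, integral_const_mul]

lemma gaussianMass_le_of_pos (ω₀ : sphere (0 : E) 1) {a : ℝ} (ha : 0 < a) :
    gaussianMass ω₀ a ≤ π ^ (finrank ℝ E / 2 : ℝ) * (volume : Measure E).toSphere.real univ *
      a ^ (-(finrank ℝ E / 2 : ℝ)) := by
  have h : ∫ ω : sphere (0 : E) 1, exp (-‖(ω₀ : E) - ω‖ ^ 2 / (4 * a))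
        ∂(volume : Measure E).toSphere ≤ (volume : Measure E).toSphere.real univ := by
    calc _ ≤ ∫ ω : sphere (0 : E) 1, (1 : ℝ) ∂(volume : Measure E).toSphere := by
          refine integral_mono (integrable_sphere (by fun_prop)) (integrable_const _) fun ω => ?_
          rw [exp_le_one_iff, neg_div, neg_nonpos]
          positivity
      _ = _ := by simp
  rw [gaussianMass_eq, div_rpow pi_pos.le ha.le, rpow_neg ha.le]
  calc _ ≤ π ^ (finrank ℝ E / 2 : ℝ) / a ^ (finrank ℝ E / 2 : ℝ) *
        (volume : Measure E).toSphere.real univ := by gcongr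
    _ = _ := by field_simp

lemma integral_sphere_gaussian_le [Nontrivial E] (ω₀ : sphere (0 : E) 1) {a : ℝ} (ha : 0 < a)
    (ha' : a ≤ 1 / 4) :
    √a * ((1 / 2) ^ (finrank ℝ E - 1) * exp (-(1 / 4)) *
      ∫ ω : sphere (0 : E) 1, exp (-‖(ω₀ : E) - ω‖ ^ 2 / (4 * a))
        ∂(volume : Measure E).toSphere) ≤ (π * (4 * a)) ^ (finrank ℝ E / 2 : ℝ) := by
  set σ := (volume : Measure E).toSphere
  set I := ∫ ω : sphere (0 : E) 1, exp (-‖(ω₀ : E) - ω‖ ^ 2 / (4 * a)) ∂σ with hI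
  have hI0 : 0 ≤ I := integral_nonneg fun _ => (exp_pos _).le
  have hs : √a ≤ 1 / 2 := by
    rw [show (1 / 2 : ℝ) = √(1 / 4) by rw [show (1 / 4 : ℝ) = (1 / 2) ^ 2 by norm_num]; simp]
    exact Real.sqrt_le_sqrt ha'
  have hs2 : √a ^ 2 = a := Real.sq_sqrt ha.le
  have hs0 : 0 < √a := Real.sqrt_pos.2 ha
  have hgi : Integrable fun x : E => exp (-‖x - ω₀‖ ^ 2 / (4 * a)) := by
    have := (integrable_gaussian (E := E) (a := 1 / (4 * a)) (by positivity)).comp_sub_right ω₀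
    refine this.congr (.of_forall fun x => ?_)
    dsimp only
    congr 1; ring
  have hgv : ∫ x : E, exp (-‖x - ω₀‖ ^ 2 / (4 * a)) = (π * (4 * a)) ^ (finrank ℝ E / 2 : ℝ) := by
    rw [integral_sub_right_eq_self (fun x : E => exp (-‖x‖ ^ 2 / (4 * a))) (ω₀ : E)]
    have := GaussianFourier.integral_rexp_neg_mul_sq_norm (V := E) (b := 1 / (4 * a))
      (by positivity)
    rw [show π / (1 / (4 * a)) = π * (4 * a) by field_simp] at this
    rw [← this]
    congr with x
    congr 1; ring
  rw [← ENNReal.ofReal_le_ofReal_iff (by positivity), ← hgv,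
    ofReal_integral_eq_lintegral_ofReal hgi (.of_forall fun _ => (exp_pos _).le),
    lintegral_polar (by fun_prop)]
  calc ENNReal.ofReal (√a * ((1 / 2) ^ (finrank ℝ E - 1) * exp (-(1 / 4)) * I))
      = ∫⁻ _r in Icc (1 - √a) 1,
          ENNReal.ofReal ((1 / 2) ^ (finrank ℝ E - 1)) * ENNReal.ofReal (exp (-(1 / 4)) * I) := by
        rw [setLIntegral_const, Real.volume_Icc, ← ENNReal.ofReal_mul (by positivity),
          ← ENNReal.ofReal_mul (by positivity)]
        congr 1; ring
    _ ≤ ∫⁻ r in Icc (1 - √a) 1, ENNReal.ofReal (r ^ (finrank ℝ E - 1)) *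
          ∫⁻ ω : sphere (0 : E) 1,
            ENNReal.ofReal (exp (-‖r • (ω : E) - ω₀‖ ^ 2 / (4 * a))) ∂σ := by
        refine setLIntegral_mono' measurableSet_Icc fun r hr => ?_
        have hr2 : 1 / 2 ≤ r := by linarith [hr.1]
        gcongr
        rw [hI, ← integral_const_mul, ofReal_integral_eq_lintegral_ofReal
          (integrable_sphere (by fun_prop)) (.of_forall fun _ => by positivity)]
        refine lintegral_mono fun ω => ENNReal.ofReal_le_ofReal ?_
        rw [← exp_add, exp_le_exp, norm_smul_sub_sq, ← sub_nonneg]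
        have h1 : (1 - r) ^ 2 ≤ a := by
          rw [← hs2]; exact pow_le_pow_left₀ (by linarith [hr.2]) (by linarith [hr.1]) 2
        have h2 : 0 ≤ (1 - r) * ‖(ω₀ : E) - ω‖ ^ 2 :=
          mul_nonneg (by linarith [hr.2]) (sq_nonneg _)
        rw [show -((1 - r) ^ 2 + r * ‖(ω₀ : E) - ω‖ ^ 2) / (4 * a) -
          (-(1 / 4) + -‖(ω₀ : E) - ω‖ ^ 2 / (4 * a)) =
          ((a - (1 - r) ^ 2) + (1 - r) * ‖(ω₀ : E) - ω‖ ^ 2) / (4 * a) by field_simp; ring]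
        exact div_nonneg (by linarith) (by positivity)
    _ ≤ _ := lintegral_mono_set fun r hr => mem_Ioi.2 (by linarith [hr.1])

lemma exists_gaussianMass_le [Nontrivial E] (ω₀ : sphere (0 : E) 1) :
    ∃ C : ℝ, 0 ≤ C ∧ ∀ a : ℝ, 0 < a → a ≤ 1 / 4 → gaussianMass ω₀ a ≤ C * a ^ (-(1 / 2) : ℝ) := by
  set D : ℝ := (finrank ℝ E / 2 : ℝ)
  refine ⟨(2 * π) ^ (2 * D) * ((1 / 2) ^ (finrank ℝ E - 1) * exp (-(1 / 4)))⁻¹, by positivity,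
    fun a ha ha' => ?_⟩
  have h := integral_sphere_gaussian_le ω₀ ha ha'
  rw [gaussianMass_eq]
  set I := ∫ ω : sphere (0 : E) 1, exp (-‖(ω₀ : E) - ω‖ ^ 2 / (4 * a))
        ∂(volume : Measure E).toSphere
  set c : ℝ := (1 / 2) ^ (finrank ℝ E - 1) * exp (-(1 / 4))
  have hc : 0 < c := by positivity
  have hsq : a ^ (-(1 / 2) : ℝ) = (√a)⁻¹ := by rw [rpow_neg ha.le, ← Real.sqrt_eq_rpow]
  have hs0 : 0 < √a := Real.sqrt_pos.2 ha
  have e : (π / a) ^ D * (π * (4 * a)) ^ D = (2 * π) ^ (2 * D) := by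
    rw [← mul_rpow (by positivity) (by positivity), rpow_mul (by positivity), rpow_two]
    congr 1; field_simp; ring
  rw [hsq]
  calc (π / a) ^ D * I = (π / a) ^ D * (√a * (c * I)) * c⁻¹ * (√a)⁻¹ := by field_simp
    _ ≤ (π / a) ^ D * (π * (4 * a)) ^ D * c⁻¹ * (√a)⁻¹ := by gcongr
    _ = _ := by rw [e]

/-- The constant in the weighted extension estimate on the unit sphere, before normalisation. -/
noncomputable def rieszMass (ω₀ : sphere (0 : E) 1) (s : ℝ) : ℝ≥0∞ :=
  ∫⁻ a in Ioi (0 : ℝ), ENNReal.ofReal (a ^ (s / 2 - 1) * gaussianMass ω₀ a)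

lemma rieszMass_lt_top [Nontrivial E] (ω₀ : sphere (0 : E) 1) {s : ℝ} (h1 : 1 < s)
    (h2 : s < finrank ℝ E) : rieszMass ω₀ s < ∞ := by
  obtain ⟨C, hC0, hC⟩ := exists_gaussianMass_le ω₀
  rw [rieszMass, ← Ioc_union_Ioi_eq_Ioi (show (0 : ℝ) ≤ 1 / 4 by norm_num)]
  refine (lintegral_union_le _ _ _).trans_lt (ENNReal.add_lt_top.2 ⟨?_, ?_⟩)
  · have hi : IntegrableOn (fun a : ℝ => C * a ^ (s / 2 - 3 / 2)) (Ioc 0 (1 / 4)) := by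
      have h : IntegrableOn (fun a : ℝ => a ^ (s / 2 - 3 / 2)) (Ioc 0 (1 / 4)) := by
        rw [← intervalIntegrable_iff_integrableOn_Ioc_of_le (by norm_num)]
        exact intervalIntegral.intervalIntegrable_rpow' (by linarith)
      exact h.const_mul _
    refine (setLIntegral_mono' measurableSet_Ioc fun a ha => ENNReal.ofReal_le_ofReal ?_).trans_lt
      hi.lintegral_lt_top
    calc a ^ (s / 2 - 1) * gaussianMass ω₀ a
        ≤ a ^ (s / 2 - 1) * (C * a ^ (-(1 / 2) : ℝ)) := by
          gcongr
          · exact rpow_nonneg ha.1.le _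
          · exact hC a ha.1 ha.2
      _ = C * a ^ (s / 2 - 3 / 2) := by
          rw [mul_left_comm, ← rpow_add ha.1]; congr 2; ring
  · set B := π ^ (finrank ℝ E / 2 : ℝ) * (volume : Measure E).toSphere.real univ
    have hi : IntegrableOn (fun a : ℝ => B * a ^ (s / 2 - 1 - finrank ℝ E / 2)) (Ioi (1 / 4)) :=
      (integrableOn_Ioi_rpow_of_lt (by linarith) (by norm_num)).const_mul _
    refine (setLIntegral_mono' measurableSet_Ioi fun a ha => ENNReal.ofReal_le_ofReal ?_).trans_lt
      hi.lintegral_lt_top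
    have ha0 : 0 < a := lt_trans (by norm_num) (mem_Ioi.1 ha)
    calc a ^ (s / 2 - 1) * gaussianMass ω₀ a
        ≤ a ^ (s / 2 - 1) * (B * a ^ (-(finrank ℝ E / 2 : ℝ))) := by
          gcongr
          exact gaussianMass_le_of_pos ω₀ ha0
      _ = B * a ^ (s / 2 - 1 - finrank ℝ E / 2) := by
          rw [mul_left_comm, ← rpow_add ha0]; congr 2

lemma lintegral_rpow_mul_gaussian {s : ℝ} (hs : 0 < s) {ρ : ℝ} (hρ : 0 < ρ) :
    ∫⁻ a in Ioi (0 : ℝ), ENNReal.ofReal (a ^ (s / 2 - 1) * exp (-a * ρ ^ 2)) =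
      ENNReal.ofReal (Gamma (s / 2)) * ENNReal.ofReal ((ρ ^ s)⁻¹) := by
  have hG : 0 < Gamma (s / 2) := Gamma_pos_of_pos (by linarith)
  have h := integral_rpow_mul_exp_neg_mul_Ioi (a := s / 2) (by linarith) (sq_pos_of_pos hρ)
  have hv : ∫ a in Ioi (0 : ℝ), a ^ (s / 2 - 1) * exp (-a * ρ ^ 2) =
      Gamma (s / 2) * (ρ ^ s)⁻¹ := by
    rw [show Gamma (s / 2) * (ρ ^ s)⁻¹ = (1 / ρ ^ 2) ^ (s / 2) * Gamma (s / 2) by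
      rw [one_div, inv_rpow (by positivity), ← rpow_natCast, ← rpow_mul hρ.le, mul_comm]
      congr 3; push_cast; ring, ← h]
    congr with a
    congr 2; ring
  rw [← ENNReal.ofReal_mul hG.le, ← hv, ofReal_integral_eq_lintegral_ofReal]
  · refine Integrable.of_integral_ne_zero ?_
    rw [hv]; positivity
  · exact (ae_restrict_iff' measurableSet_Ioi).2 (.of_forall fun a (ha : 0 < a) => by positivity)

lemma lintegral_gaussian_mul_sphereExtension {a : ℝ} (ha : 0 < a) {g : sphere (0 : E) 1 → ℂ}
    (hg : Continuous g) :
    ∫⁻ x : E, ENNReal.ofReal (exp (-a * ‖x‖ ^ 2)) * ‖sphereExtension g x‖ₑ ^ 2 =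
      ENNReal.ofReal (∫ x : E, exp (-a * ‖x‖ ^ 2) * ‖sphereExtension g x‖ ^ 2) := by
  have hc := continuous_sphereExtension hg
  rw [ofReal_integral_eq_lintegral_ofReal _ (.of_forall fun _ => by positivity)]
  · congr with x
    rw [ENNReal.ofReal_mul (exp_pos _).le, ENNReal.ofReal_pow (norm_nonneg _), ofReal_norm]
  · refine (integrable_gaussian ha).mul_bdd
      (c := (∫ ω, ‖g ω‖ ∂(volume : Measure E).toSphere) ^ 2) (by fun_prop) (.of_forall fun x => ?_)
    rw [norm_pow, norm_norm]
    gcongr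
    exact norm_sphereExtension_le g x

lemma lintegral_rpow_mul_sphereExtension [Nontrivial E] {s : ℝ} (hs : 0 < s)
    {g : sphere (0 : E) 1 → ℂ} (hg : Continuous g) :
    ENNReal.ofReal (Gamma (s / 2)) *
        ∫⁻ x : E, ENNReal.ofReal ((‖x‖ ^ s)⁻¹) * ‖sphereExtension g x‖ₑ ^ 2 =
      ∫⁻ a in Ioi (0 : ℝ), ENNReal.ofReal (a ^ (s / 2 - 1)) *
        ∫⁻ x : E, ENNReal.ofReal (exp (-a * ‖x‖ ^ 2)) * ‖sphereExtension g x‖ₑ ^ 2 := by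
  have hc := continuous_sphereExtension hg
  rw [← lintegral_const_mul _ (by fun_prop)]
  have e : ∀ᵐ x : E, ENNReal.ofReal (Gamma (s / 2)) *
      (ENNReal.ofReal ((‖x‖ ^ s)⁻¹) * ‖sphereExtension g x‖ₑ ^ 2) =
      ∫⁻ a in Ioi (0 : ℝ), ENNReal.ofReal (a ^ (s / 2 - 1) * exp (-a * ‖x‖ ^ 2)) *
        ‖sphereExtension g x‖ₑ ^ 2 := by
    filter_upwards [compl_mem_ae_iff.2 (measure_singleton (0 : E))] with x hx
    rw [lintegral_mul_const _ (by fun_prop), lintegral_rpow_mul_gaussian hs (norm_pos_iff.2 hx),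
      mul_assoc]
  rw [lintegral_congr_ae e, lintegral_lintegral_swap (by fun_prop)]
  refine setLIntegral_congr_fun measurableSet_Ioi fun a (ha : 0 < a) => ?_
  rw [← lintegral_const_mul _ (by fun_prop)]
  congr with x
  rw [ENNReal.ofReal_mul (by positivity), mul_assoc]

lemma lintegral_enorm_sq_sphere {g : sphere (0 : E) 1 → ℂ} (hg : Continuous g) :
    ∫⁻ ω, ‖g ω‖ₑ ^ 2 ∂(volume : Measure E).toSphere =
      ENNReal.ofReal (∫ ω, ‖g ω‖ ^ 2 ∂(volume : Measure E).toSphere) := by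
  rw [ofReal_integral_eq_lintegral_ofReal (integrable_sphere (by fun_prop))
    (.of_forall fun _ => by positivity)]
  congr with x
  rw [ENNReal.ofReal_pow (norm_nonneg _), ofReal_norm]

/-- The weighted `L²` estimate for the extension operator of the unit sphere. -/
lemma lintegral_rpow_mul_sphereExtension_le [Nontrivial E] (ω₀ : sphere (0 : E) 1) {s : ℝ}
    (hs : 0 < s) {g : sphere (0 : E) 1 → ℂ} (hg : Continuous g) :
    ENNReal.ofReal (Gamma (s / 2)) *
        ∫⁻ x : E, ENNReal.ofReal ((‖x‖ ^ s)⁻¹) * ‖sphereExtension g x‖ₑ ^ 2 ≤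
      rieszMass ω₀ s * ∫⁻ ω, ‖g ω‖ₑ ^ 2 ∂(volume : Measure E).toSphere := by
  rw [lintegral_rpow_mul_sphereExtension hs hg, rieszMass,
    ← lintegral_mul_const' _ _ (by rw [lintegral_enorm_sq_sphere hg]; simp)]
  refine setLIntegral_mono' measurableSet_Ioi fun a (ha : 0 < a) => ?_
  rw [lintegral_gaussian_mul_sphereExtension ha hg, lintegral_enorm_sq_sphere hg,
    ← ENNReal.ofReal_mul (by positivity), ← ENNReal.ofReal_mul
      (mul_nonneg (by positivity) (gaussianMass_nonneg _ ha)), mul_assoc]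
  gcongr
  exact integral_gaussian_mul_sphereExtension_le ω₀ ha hg

/-- Constants are extremal for `lintegral_rpow_mul_sphereExtension_le`. -/
lemma lintegral_rpow_mul_sphereExtension_const [Nontrivial E] (ω₀ : sphere (0 : E) 1) {s : ℝ}
    (hs : 0 < s) (c : ℂ) :
    ENNReal.ofReal (Gamma (s / 2)) * ∫⁻ x : E, ENNReal.ofReal ((‖x‖ ^ s)⁻¹) *
        ‖sphereExtension (fun _ : sphere (0 : E) 1 => c) x‖ₑ ^ 2 =
      rieszMass ω₀ s * ∫⁻ _ω : sphere (0 : E) 1, ‖c‖ₑ ^ 2 ∂(volume : Measure E).toSphere := by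
  have hg : Continuous fun _ : sphere (0 : E) 1 => c := continuous_const
  rw [lintegral_rpow_mul_sphereExtension hs hg, rieszMass,
    ← lintegral_mul_const' _ _ (by rw [lintegral_enorm_sq_sphere hg]; simp)]
  refine setLIntegral_congr_fun measurableSet_Ioi fun a (ha : 0 < a) => ?_
  rw [lintegral_gaussian_mul_sphereExtension ha hg, lintegral_enorm_sq_sphere hg,
    ← ENNReal.ofReal_mul (by positivity), ← ENNReal.ofReal_mul
      (mul_nonneg (by positivity) (gaussianMass_nonneg _ ha)), mul_assoc,
    integral_gaussian_mul_sphereExtension_const ω₀ ha]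

end GaussianMass

lemma lintegral_comp_smul {E : Type*} [NormedAddCommGroup E] [NormedSpace ℝ E]
    [FiniteDimensional ℝ E] [MeasurableSpace E] [BorelSpace E] (μ : Measure E)
    [μ.IsAddHaarMeasure] (f : E → ℝ≥0∞) {r : ℝ} (hr : 0 < r) :
    ∫⁻ x, f (r • x) ∂μ = ENNReal.ofReal ((r ^ finrank ℝ E)⁻¹) * ∫⁻ x, f x ∂μ := by
  have h := Measure.map_addHaar_smul μ hr.ne'
  have he : MeasurableEmbedding (fun x : E => r • x) :=
    (Homeomorph.smulOfNeZero r hr.ne').measurableEmbedding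
  rw [← he.lintegral_map, h, lintegral_smul_measure, abs_of_nonneg (by positivity), smul_eq_mul]

lemma lintegral_comp_rpow_Ioi {p : ℝ} (hp : 0 < p) (g : ℝ → ℝ≥0∞) :
    ∫⁻ x in Ioi 0, g x = ∫⁻ x in Ioi 0, ENNReal.ofReal (p * x ^ (p - 1)) * g (x ^ p) := by
  have a : (· ^ p) '' (Ioi 0) = Ioi (0 : ℝ) := by
    ext1 x; rw [mem_image]; constructor
    · rintro ⟨y, hy, rfl⟩; exact rpow_pos_of_pos hy p
    · exact fun hx ↦ ⟨x ^ (1 / p), rpow_pos_of_pos hx _, by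
        simp [← rpow_mul (le_of_lt (mem_Ioi.1 hx)), hp.ne']⟩
  have := lintegral_image_eq_lintegral_abs_deriv_mul measurableSet_Ioi
    (fun x hx ↦ (hasDerivAt_rpow_const (Or.inl (mem_Ioi.mp hx).ne')).hasDerivWithinAt)
    ((rpow_left_injOn hp.ne').mono (fun x (hx : 0 < x) => hx.le)) g
  rw [a] at this; rw [this]
  refine setLIntegral_congr_fun measurableSet_Ioi (fun x (hx : 0 < x) ↦ ?_)
  rw [abs_of_nonneg (by positivity)]

/-- Plancherel's theorem in time for superpositions of the oscillations `e^{-i t r^β}`. -/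
lemma lintegral_oscillatory {β : ℝ} (hβ : 0 < β) {G : ℝ → ℂ} (hG : IntegrableOn G (Ioi 0))
    (hG2 : ∫⁻ r in Ioi 0, ENNReal.ofReal (r ^ (1 - β)) * ‖G r‖ₑ ^ 2 < ∞) :
    ∫⁻ t : ℝ, ‖∫ r in Ioi 0,
        Complex.exp (-(Complex.I * (t : ℂ) * ((r ^ β : ℝ) : ℂ))) * G r‖ₑ ^ 2 =
      ENNReal.ofReal (2 * π / β) * ∫⁻ r in Ioi 0, ENNReal.ofReal (r ^ (1 - β)) * ‖G r‖ₑ ^ 2 := by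
  set h : ℝ → ℂ := (Ioi 0).indicator fun v => (β⁻¹ * v ^ (β⁻¹ - 1)) • G (v ^ β⁻¹) with hh
  have hβ' : 0 < β⁻¹ := inv_pos.2 hβ
  have h1 : Integrable h := by
    rw [hh, integrable_indicator_iff measurableSet_Ioi]
    simpa [abs_of_pos hβ] using (integrableOn_Ioi_comp_rpow_iff G hβ'.ne').2 hG
  have hsq : ∫⁻ v, ‖h v‖ₑ ^ 2 =
      ENNReal.ofReal β⁻¹ * ∫⁻ r in Ioi 0, ENNReal.ofReal (r ^ (1 - β)) * ‖G r‖ₑ ^ 2 := by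
    have e : (fun v => ‖h v‖ₑ ^ 2) = (Ioi 0).indicator fun v =>
        ‖(β⁻¹ * v ^ (β⁻¹ - 1)) • G (v ^ β⁻¹)‖ₑ ^ 2 := by
      ext v
      by_cases hv : v ∈ Ioi (0 : ℝ) <;> simp [hh, hv]
    rw [e, lintegral_indicator measurableSet_Ioi, lintegral_comp_rpow_Ioi hβ,
      ← lintegral_const_mul' _ _ (by simp)]
    refine setLIntegral_congr_fun measurableSet_Ioi fun r (hr : 0 < r) => ?_
    have e1 : (r ^ β) ^ β⁻¹ = r := rpow_rpow_inv hr.le hβ.ne'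
    have e2 : (r ^ β) ^ (β⁻¹ - 1) = r ^ (1 - β) := by
      rw [← rpow_mul hr.le]; congr 1; field_simp
    rw [e1, e2, enorm_smul, mul_pow, ← mul_assoc, ← mul_assoc,
      Real.enorm_of_nonneg (by positivity), ← ENNReal.ofReal_pow (by positivity),
      ← ENNReal.ofReal_mul (by positivity), ← ENNReal.ofReal_mul (by positivity)]
    congr 2
    have e3 : r ^ (β - 1) * r ^ (1 - β) = 1 := by
      rw [← rpow_add hr]; simp
    calc β * r ^ (β - 1) * (β⁻¹ * r ^ (1 - β)) ^ 2
        = β⁻¹ * r ^ (1 - β) * (r ^ (β - 1) * r ^ (1 - β)) := by field_simp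
      _ = _ := by rw [e3, mul_one]
  have h2 : MemLp h 2 := by
    refine ⟨h1.1, ?_⟩
    have : eLpNorm h 2 volume ^ 2 < ∞ := by
      rw [eLpNorm_two_sq, hsq]
      exact ENNReal.mul_lt_top ENNReal.ofReal_lt_top hG2
    simpa using this
  have hF : ∀ w : ℝ, 𝓕 h w = ∫ r in Ioi 0,
      Complex.exp (-(Complex.I * (((2 * π) • w : ℝ) : ℂ) * ((r ^ β : ℝ) : ℂ))) * G r := by
    intro w
    rw [Real.fourier_real_eq_integral_exp_smul, ← integral_comp_rpow_Ioi_of_pos hβ',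
      ← integral_indicator measurableSet_Ioi]
    congr with v
    by_cases hv : v ∈ Ioi (0 : ℝ)
    · simp only [hh, indicator_of_mem hv]
      rw [rpow_inv_rpow (le_of_lt hv) hβ.ne', smul_comm, smul_eq_mul]
      congr 3
      push_cast [smul_eq_mul]
      ring
    · simp [hh, indicator_of_notMem hv]
  have hpl := lintegral_enorm_sq_fourier h1 h2
  simp_rw [hF] at hpl
  rw [lintegral_comp_smul volume (fun t : ℝ => ‖∫ r in Ioi 0,
        Complex.exp (-(Complex.I * (t : ℂ) * ((r ^ β : ℝ) : ℂ))) * G r‖ₑ ^ 2)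
        (by positivity : 0 < 2 * π), hsq] at hpl
  rw [div_eq_mul_inv (2 * π), ENNReal.ofReal_mul (by positivity), mul_assoc, ← hpl, ← mul_assoc,
    ← ENNReal.ofReal_mul (by positivity)]
  rw [finrank_self, pow_one, mul_inv_cancel₀ (by positivity), ENNReal.ofReal_one, one_mul]

lemma integrableOn_rpow_mul_one_add_rpow {p q : ℝ} (hp : 0 ≤ p) (hpq : p - q < -1) :
    IntegrableOn (fun r : ℝ => r ^ p * (1 + r) ^ (-q)) (Ioi 0) := by
  have h := integrableOn_add_rpow_Ioi_of_lt (a := p - q) (c := 0) (m := 1) hpq (by norm_num)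
  refine Integrable.mono' h (by fun_prop) ?_
  refine (ae_restrict_iff' measurableSet_Ioi).2 (.of_forall fun r (hr : 0 < r) => ?_)
  rw [Real.norm_of_nonneg (by positivity), add_comm r 1, sub_eq_add_neg p q,
    rpow_add (by positivity)]
  gcongr
  linarith

section Dispersive

variable {E : Type*} [NormedAddCommGroup E] [InnerProductSpace ℝ E] [FiniteDimensional ℝ E]
  [MeasurableSpace E] [BorelSpace E]

/-- The superposition `∫ |ξ|^α e^{i x·ξ} e^{-i t |ξ|^β} f(ξ) dξ`. -/
noncomputable def dispersiveWave (α β : ℝ) (f : E → ℂ) (x : E) (t : ℝ) : ℂ :=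
  ∫ ξ : E, ((‖ξ‖ ^ α : ℝ) : ℂ) * Complex.exp (Complex.I * ((inner ℝ x ξ : ℝ) : ℂ)) *
    Complex.exp (-(Complex.I * (t : ℂ) * ((‖ξ‖ ^ β : ℝ) : ℂ))) * f ξ

/-- The contribution of the sphere of radius `r` to a superposition of plane waves at `x`. -/
noncomputable def shellWave (f : E → ℂ) (x : E) (r : ℝ) : ℂ :=
  sphereExtension (fun ω : sphere (0 : E) 1 => f (r • (ω : E))) (r • x)

lemma norm_exp_neg_I_mul_mul (t u : ℝ) :
    ‖Complex.exp (-(Complex.I * (t : ℂ) * (u : ℂ)))‖ = 1 := by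
  rw [show -(Complex.I * (t : ℂ) * (u : ℂ)) = Complex.I * ((-(t * u) : ℝ) : ℂ) by push_cast; ring,
    norm_exp_I_mul]

lemma measurable_dispersiveWave (α β : ℝ) {f : E → ℂ} (hf : Continuous f) :
    Measurable (fun p : E × ℝ => dispersiveWave α β f p.1 p.2) := by
  unfold dispersiveWave
  refine (StronglyMeasurable.integral_prod_right (ν := (volume : Measure E))
    (f := fun (p : E × ℝ) (ξ : E) => ((‖ξ‖ ^ α : ℝ) : ℂ) *
      Complex.exp (Complex.I * ((inner ℝ p.1 ξ : ℝ) : ℂ)) *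
      Complex.exp (-(Complex.I * (p.2 : ℂ) * ((‖ξ‖ ^ β : ℝ) : ℂ))) * f ξ) ?_).measurable
  have := hf.measurable
  refine Measurable.stronglyMeasurable ?_
  unfold Function.uncurry
  fun_prop

lemma measurable_shellWave {f : E → ℂ} (hf : Continuous f) :
    Measurable (fun p : E × ℝ => shellWave f p.1 p.2) := by
  unfold shellWave sphereExtension
  refine (StronglyMeasurable.integral_prod_right (ν := (volume : Measure E).toSphere)
    (f := fun (p : E × ℝ) (ω : sphere (0 : E) 1) =>
      Complex.exp (Complex.I * ((inner ℝ (p.2 • p.1) (ω : E) : ℝ) : ℂ)) * f (p.2 • (ω : E)))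
      ?_).measurable
  refine Continuous.stronglyMeasurable ?_
  unfold Function.uncurry
  fun_prop

lemma integrable_rpow_norm_mul {α : ℝ} (hα : 0 ≤ α) {f : E → ℂ} (hf : Continuous f)
    (hdec : ∀ N : ℕ, ∃ C : ℝ, 0 ≤ C ∧ ∀ ξ, ‖f ξ‖ ≤ C * (1 + ‖ξ‖) ^ (-(N : ℝ))) :
    Integrable fun ξ : E => ‖ξ‖ ^ α * ‖f ξ‖ := by
  obtain ⟨N, hN⟩ := exists_nat_gt (α + finrank ℝ E)
  obtain ⟨C, hC0, hC⟩ := hdec N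
  have hi := (integrable_one_add_norm (E := E) (μ := volume) (r := N - α) (by linarith)).const_mul C
  have := hf.measurable
  refine hi.mono' (by fun_prop) (.of_forall fun ξ => ?_)
  rw [Real.norm_of_nonneg (by positivity)]
  calc ‖ξ‖ ^ α * ‖f ξ‖ ≤ (1 + ‖ξ‖) ^ α * (C * (1 + ‖ξ‖) ^ (-(N : ℝ))) := by
        gcongr
        · linarith
        · exact hC ξ
    _ = C * (1 + ‖ξ‖) ^ (-(N - α)) := by
        rw [mul_left_comm, ← rpow_add (by positivity)]; congr 2; ring

lemma norm_shellWave_le {f : E → ℂ} {N : ℕ} {C : ℝ}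
    (hC : ∀ ξ, ‖f ξ‖ ≤ C * (1 + ‖ξ‖) ^ (-(N : ℝ))) (x : E) {r : ℝ} (hr : 0 < r) :
    ‖shellWave f x r‖ ≤ (volume : Measure E).toSphere.real univ * C * (1 + r) ^ (-(N : ℝ)) := by
  have h := norm_integral_le_of_norm_le_const (μ := (volume : Measure E).toSphere)
    (f := fun ω : sphere (0 : E) 1 =>
      Complex.exp (Complex.I * ((inner ℝ (r • x) (ω : E) : ℝ) : ℂ)) * f (r • (ω : E)))
    (C := C * (1 + r) ^ (-(N : ℝ))) (.of_forall fun ω => by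
      rw [norm_mul, norm_exp_I_mul, one_mul]
      simpa [norm_smul, abs_of_pos hr] using hC (r • (ω : E)))
  exact h.trans (le_of_eq (by ring))

attribute [irreducible] dispersiveWave shellWave

lemma integrableOn_rpow_mul_shellWave {p : ℝ} (hp : 0 ≤ p) {f : E → ℂ} (hf : Continuous f)
    (hdec : ∀ N : ℕ, ∃ C : ℝ, 0 ≤ C ∧ ∀ ξ, ‖f ξ‖ ≤ C * (1 + ‖ξ‖) ^ (-(N : ℝ))) (x : E)
    {m : ℕ} (hm : m ≠ 0) :
    IntegrableOn (fun r : ℝ => r ^ p * ‖shellWave f x r‖ ^ m) (Ioi 0) := by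
  obtain ⟨N, hN⟩ := exists_nat_gt (p + 1)
  obtain ⟨C, hC0, hC⟩ := hdec N
  have hm1 : (1 : ℝ) ≤ m := by exact_mod_cast Nat.one_le_iff_ne_zero.2 hm
  have hi := (integrableOn_rpow_mul_one_add_rpow (p := p) (q := N * m) hp
    (by nlinarith)).const_mul (((volume : Measure E).toSphere.real univ * C) ^ m)
  have hmeas : Measurable fun r => shellWave f x r :=
    (measurable_shellWave hf).comp measurable_prodMk_left
  refine hi.mono' (by fun_prop) ?_
  refine (ae_restrict_iff' measurableSet_Ioi).2 (.of_forall fun r (hr : 0 < r) => ?_)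
  rw [Real.norm_of_nonneg (by positivity)]
  calc r ^ p * ‖shellWave f x r‖ ^ m
      ≤ r ^ p * ((volume : Measure E).toSphere.real univ * C * (1 + r) ^ (-(N : ℝ))) ^ m := by
        gcongr
        exact norm_shellWave_le hC x hr
    _ = _ := by
        rw [mul_pow, ← rpow_mul_natCast (by positivity)]
        ring_nf

lemma dispersiveWave_eq [Nontrivial E] {α : ℝ} (hα : 0 ≤ α) (β : ℝ) {f : E → ℂ}
    (hf : Continuous f)
    (hdec : ∀ N : ℕ, ∃ C : ℝ, 0 ≤ C ∧ ∀ ξ, ‖f ξ‖ ≤ C * (1 + ‖ξ‖) ^ (-(N : ℝ))) (x : E) (t : ℝ) :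
    dispersiveWave α β f x t = ∫ r in Ioi 0,
      Complex.exp (-(Complex.I * (t : ℂ) * ((r ^ β : ℝ) : ℂ))) *
        (((r ^ (finrank ℝ E - 1 + α) : ℝ) : ℂ) * shellWave f x r) := by
  have hfm := hf.measurable
  rw [dispersiveWave, integral_polar]
  · refine setIntegral_congr_fun measurableSet_Ioi fun r (hr : 0 < r) => ?_
    have e1 : r ^ (finrank ℝ E - 1 + α : ℝ) = r ^ (finrank ℝ E - 1) * r ^ α := by
      rw [rpow_add hr, ← rpow_natCast, Nat.cast_sub finrank_pos, Nat.cast_one]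
    rw [e1, shellWave, sphereExtension, ← integral_const_mul, ← integral_const_mul,
      ← integral_const_mul]
    congr with ω
    rw [show ‖r • (ω : E)‖ = r by simp [norm_smul, abs_of_pos hr], inner_smul_left,
      inner_smul_right]
    push_cast
    simp only [conj_trivial]
    ring
  · refine (integrable_rpow_norm_mul hα hf hdec).mono' (by fun_prop) (.of_forall fun ξ => ?_)
    rw [norm_mul, norm_mul, norm_mul, norm_exp_I_mul, norm_exp_neg_I_mul_mul, mul_one, mul_one,
      Complex.norm_real, Real.norm_of_nonneg (by positivity)]

lemma lintegral_time_dispersiveWave [Nontrivial E] {α β : ℝ} (hα : 0 ≤ α) (h1 : 0 < β - 2 * α)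
    (h2 : β - 2 * α < finrank ℝ E) {f : E → ℂ} (hf : Continuous f)
    (hdec : ∀ N : ℕ, ∃ C : ℝ, 0 ≤ C ∧ ∀ ξ, ‖f ξ‖ ≤ C * (1 + ‖ξ‖) ^ (-(N : ℝ))) (x : E) :
    ∫⁻ t, ‖dispersiveWave α β f x t‖ₑ ^ 2 = ENNReal.ofReal (2 * π / β) *
      ∫⁻ r in Ioi 0, ENNReal.ofReal (r ^ (2 * finrank ℝ E - 1 - (β - 2 * α))) *
        ‖shellWave f x r‖ₑ ^ 2 := by
  have hβ : 0 < β := by linarith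
  have hd : (1 : ℝ) ≤ finrank ℝ E := by exact_mod_cast finrank_pos (R := ℝ) (M := E)
  have hmeas : Measurable fun r => shellWave f x r :=
    (measurable_shellWave hf).comp measurable_prodMk_left
  have key : ∀ r ∈ Ioi (0 : ℝ), ENNReal.ofReal (r ^ (1 - β)) *
      ‖((r ^ (finrank ℝ E - 1 + α) : ℝ) : ℂ) * shellWave f x r‖ₑ ^ 2 =
      ENNReal.ofReal (r ^ (2 * finrank ℝ E - 1 - (β - 2 * α))) * ‖shellWave f x r‖ₑ ^ 2 := by
    intro r hr
    have hr0 : 0 < r := hr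
    rw [enorm_mul, mul_pow, ← mul_assoc, ← ofReal_norm, Complex.norm_real,
      Real.norm_of_nonneg (by positivity), ← ENNReal.ofReal_pow (by positivity),
      ← ENNReal.ofReal_mul (by positivity), ← rpow_mul_natCast hr0.le, ← rpow_add hr0]
    congr 3
    push_cast; ring
  have hfin : ∫⁻ r in Ioi 0, ENNReal.ofReal (r ^ (2 * finrank ℝ E - 1 - (β - 2 * α))) *
        ‖shellWave f x r‖ₑ ^ 2 < ∞ := by
    have := (integrableOn_rpow_mul_shellWave (p := 2 * finrank ℝ E - 1 - (β - 2 * α))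
      (by linarith) hf hdec x two_ne_zero).lintegral_lt_top
    convert this using 1
    refine setLIntegral_congr_fun measurableSet_Ioi fun r (hr : 0 < r) => ?_
    rw [ENNReal.ofReal_mul (by positivity), ENNReal.ofReal_pow (norm_nonneg _), ofReal_norm]
  simp_rw [dispersiveWave_eq hα β hf hdec]
  rw [lintegral_oscillatory hβ]
  · rw [setLIntegral_congr_fun measurableSet_Ioi key]
  · refine Integrable.mono' (integrableOn_rpow_mul_shellWave (p := finrank ℝ E - 1 + α)
      (by linarith) hf hdec x one_ne_zero) (by fun_prop) ?_
    refine (ae_restrict_iff' measurableSet_Ioi).2 (.of_forall fun r (hr : 0 < r) => ?_)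
    rw [norm_mul, Complex.norm_real, Real.norm_of_nonneg (by positivity), pow_one]
  · rwa [setLIntegral_congr_fun measurableSet_Ioi key]

lemma lintegral_weight_shellWave {s : ℝ} {f : E → ℂ} {r : ℝ} (hr : 0 < r) :
    ∫⁻ x : E, ENNReal.ofReal ((‖x‖ ^ s)⁻¹) * ‖shellWave f x r‖ₑ ^ 2 =
      ENNReal.ofReal (r ^ (s - finrank ℝ E)) * ∫⁻ x : E, ENNReal.ofReal ((‖x‖ ^ s)⁻¹) *
        ‖sphereExtension (fun ω : sphere (0 : E) 1 => f (r • (ω : E))) x‖ₑ ^ 2 := by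
  have h := lintegral_comp_smul volume (fun x : E => ENNReal.ofReal ((‖x‖ ^ s)⁻¹) *
        ‖sphereExtension (fun ω : sphere (0 : E) 1 => f (r • (ω : E))) x‖ₑ ^ 2) hr
  have e : ∀ x : E, ENNReal.ofReal ((‖x‖ ^ s)⁻¹) * ‖shellWave f x r‖ₑ ^ 2 =
      ENNReal.ofReal (r ^ s) * (ENNReal.ofReal ((‖r • x‖ ^ s)⁻¹) *
        ‖sphereExtension (fun ω : sphere (0 : E) 1 => f (r • (ω : E))) (r • x)‖ₑ ^ 2) := by
    intro x
    rw [← mul_assoc, ← ENNReal.ofReal_mul (by positivity), norm_smul, Real.norm_of_nonneg hr.le,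
      mul_rpow hr.le (norm_nonneg _), mul_inv, mul_inv_cancel_left₀ (by positivity), shellWave]
  simp_rw [e]
  rw [lintegral_const_mul' _ _ (by simp), h, ← mul_assoc, ← ENNReal.ofReal_mul (by positivity),
    rpow_sub hr, rpow_natCast, div_eq_mul_inv]

/-- The smoothing functional in terms of the restrictions of `f` to spheres. -/
lemma lintegral_dispersiveWave [Nontrivial E] {α β : ℝ} (hα : 0 ≤ α) (h1 : 0 < β - 2 * α)
    (h2 : β - 2 * α < finrank ℝ E) {f : E → ℂ} (hf : Continuous f)
    (hdec : ∀ N : ℕ, ∃ C : ℝ, 0 ≤ C ∧ ∀ ξ, ‖f ξ‖ ≤ C * (1 + ‖ξ‖) ^ (-(N : ℝ))) :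
    ENNReal.ofReal (Gamma ((β - 2 * α) / 2)) * ∫⁻ t, ∫⁻ x : E,
      ENNReal.ofReal ((‖x‖ ^ (β - 2 * α))⁻¹) * ‖dispersiveWave α β f x t‖ₑ ^ 2 =
    ENNReal.ofReal (2 * π / β) * ∫⁻ r in Ioi 0, ENNReal.ofReal (r ^ (finrank ℝ E - 1)) *
      (ENNReal.ofReal (Gamma ((β - 2 * α) / 2)) * ∫⁻ x : E,
        ENNReal.ofReal ((‖x‖ ^ (β - 2 * α))⁻¹) *
          ‖sphereExtension (fun ω : sphere (0 : E) 1 => f (r • (ω : E))) x‖ₑ ^ 2) := by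
  set s := β - 2 * α with hs
  have hmw := measurable_dispersiveWave α β hf
  have hms := measurable_shellWave hf
  have hmw' : ∀ x, Measurable fun t => dispersiveWave α β f x t :=
    fun x => hmw.comp measurable_prodMk_left
  have hms' : ∀ x, Measurable fun t => shellWave f x t :=
    fun x => hms.comp measurable_prodMk_left
  have step1 : ∫⁻ t, ∫⁻ x : E, ENNReal.ofReal ((‖x‖ ^ s)⁻¹) * ‖dispersiveWave α β f x t‖ₑ ^ 2 =
      ∫⁻ x : E, ENNReal.ofReal (2 * π / β) * ∫⁻ r in Ioi 0,
        ENNReal.ofReal (r ^ (2 * finrank ℝ E - 1 - s)) *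
          (ENNReal.ofReal ((‖x‖ ^ s)⁻¹) * ‖shellWave f x r‖ₑ ^ 2) := by
    rw [← lintegral_lintegral_swap (by fun_prop)]
    refine lintegral_congr fun x => ?_
    rw [lintegral_const_mul' _ _ (by simp), lintegral_time_dispersiveWave hα h1 h2 hf hdec x,
      mul_left_comm, ← lintegral_const_mul' _ _ (by simp)]
    simp_rw [mul_left_comm]
    rfl
  rw [step1, lintegral_const_mul' _ _ (by simp), lintegral_lintegral_swap (by fun_prop),
    mul_left_comm, ← lintegral_const_mul' _ _ (by simp)]
  congr 1
  refine setLIntegral_congr_fun measurableSet_Ioi fun r (hr : 0 < r) => ?_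
  rw [lintegral_const_mul' _ _ (by simp), lintegral_weight_shellWave hr, mul_left_comm]
  have e : ENNReal.ofReal (r ^ (finrank ℝ E - 1)) =
      ENNReal.ofReal (r ^ (2 * finrank ℝ E - 1 - s)) *
        ENNReal.ofReal (r ^ (s - finrank ℝ E)) := by
    rw [← ENNReal.ofReal_mul (by positivity), ← rpow_add hr, ← rpow_natCast,
      Nat.cast_sub finrank_pos, Nat.cast_one]
    congr 2
    ring
  rw [e]
  ring

end Dispersive

section FourierInt

variable {n : ℕ}

local notation "𝔼" => EuclideanSpace ℝ (Fin n)

lemma fourierInt_eq (φ : 𝓢(𝔼, ℂ)) (ξ : 𝔼) :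
    fourierInt (fun y => φ y) ξ = 𝓕 φ ((2 * π)⁻¹ • ξ) := by
  rw [SchwartzMap.fourier_coe, Real.fourier_eq', fourierInt]
  congr with x
  rw [smul_eq_mul, inner_smul_right]
  congr 2
  push_cast
  field_simp

lemma continuous_fourierInt (φ : 𝓢(𝔼, ℂ)) : Continuous (fourierInt fun y => φ y) := by
  have := (𝓕 φ).continuous
  simp_rw [funext (fourierInt_eq φ)]
  fun_prop

lemma lintegral_enorm_sq_fourierInt (φ : 𝓢(𝔼, ℂ)) :
    ∫⁻ ξ, ‖fourierInt (fun y => φ y) ξ‖ₑ ^ 2 =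
      ENNReal.ofReal ((2 * π) ^ n * ∫ x, ‖φ x‖ ^ 2) := by
  have h2 : ∀ ψ : 𝓢(𝔼, ℂ), ∫⁻ x, ‖ψ x‖ₑ ^ 2 = ENNReal.ofReal (∫ x, ‖ψ x‖ ^ 2) := by
    intro ψ
    rw [ofReal_integral_eq_lintegral_ofReal]
    · simp_rw [ENNReal.ofReal_pow (norm_nonneg _), ofReal_norm]
    · simpa using (ψ.memLp 2).integrable_norm_pow (by norm_num)
    · exact .of_forall fun x => by positivity
  simp_rw [fourierInt_eq]
  rw [lintegral_comp_smul volume (fun ξ => ‖𝓕 φ ξ‖ₑ ^ 2) (by positivity), h2,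
    SchwartzMap.integral_norm_sq_fourier, ← ENNReal.ofReal_mul (by positivity),
    finrank_euclideanSpace_fin, inv_pow, inv_inv]

lemma exists_norm_fourierInt_le (φ : 𝓢(𝔼, ℂ)) (N : ℕ) :
    ∃ C : ℝ, 0 ≤ C ∧ ∀ ξ, ‖fourierInt (fun y => φ y) ξ‖ ≤ C * (1 + ‖ξ‖) ^ (-(N : ℝ)) := by
  set D := 2 ^ N * ((Finset.Iic (N, 0)).sup fun m => SchwartzMap.seminorm ℝ m.1 m.2) (𝓕 φ)
  refine ⟨(2 * π) ^ N * D, by positivity, fun ξ => ?_⟩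
  have h := SchwartzMap.one_add_le_sup_seminorm_apply (𝕜 := ℝ) (m := (N, 0)) (k := N) (n := 0)
    le_rfl le_rfl (𝓕 φ) ((2 * π)⁻¹ • ξ)
  rw [norm_iteratedFDeriv_zero, ← fourierInt_eq, norm_smul,
    Real.norm_of_nonneg (by positivity)] at h
  rw [rpow_neg (by positivity), rpow_natCast, ← div_eq_mul_inv, le_div_iff₀ (by positivity)]
  have hle : 1 + ‖ξ‖ ≤ (2 * π) * (1 + (2 * π)⁻¹ * ‖ξ‖) := by
    rw [mul_add, mul_inv_cancel_left₀ (by positivity)]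
    linarith [pi_gt_three]
  calc ‖fourierInt (fun y => φ y) ξ‖ * (1 + ‖ξ‖) ^ N
      ≤ ‖fourierInt (fun y => φ y) ξ‖ * ((2 * π) * (1 + (2 * π)⁻¹ * ‖ξ‖)) ^ N := by gcongr
    _ = (2 * π) ^ N * ((1 + (2 * π)⁻¹ * ‖ξ‖) ^ N * ‖fourierInt (fun y => φ y) ξ‖) := by
        rw [mul_pow]; ring
    _ ≤ (2 * π) ^ N * D := by gcongr

lemma fourierInt_isometry {f : 𝔼 → ℂ} (hf : ∀ x y, ‖x‖ = ‖y‖ → f x = f y) (L : 𝔼 ≃ₗᵢ[ℝ] 𝔼)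
    (ξ : 𝔼) : fourierInt f (L ξ) = fourierInt f ξ := by
  rw [fourierInt, ← L.measurePreserving.integral_comp L.toHomeomorph.measurableEmbedding,
    fourierInt]
  congr with x
  rw [L.inner_map_map, hf (L x) x (L.norm_map x)]

lemma fourierInt_radial {f : 𝔼 → ℂ} (hf : ∀ x y, ‖x‖ = ‖y‖ → f x = f y) {ξ η : 𝔼}
    (h : ‖ξ‖ = ‖η‖) : fourierInt f ξ = fourierInt f η := by
  rw [← fourierInt_isometry hf (ℝ ∙ (ξ - η))ᗮ.reflection ξ, Submodule.reflection_sub h]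

end FourierInt

section Assembly

variable {E : Type*} [NormedAddCommGroup E] [InnerProductSpace ℝ E] [FiniteDimensional ℝ E]
  [MeasurableSpace E] [BorelSpace E]

lemma lintegral_dispersiveWave_le [Nontrivial E] (ω₀ : sphere (0 : E) 1) {α β : ℝ} (hα : 0 ≤ α)
    (h1 : 1 < β - 2 * α) (h2 : β - 2 * α < finrank ℝ E) {f : E → ℂ} (hf : Continuous f)
    (hdec : ∀ N : ℕ, ∃ C : ℝ, 0 ≤ C ∧ ∀ ξ, ‖f ξ‖ ≤ C * (1 + ‖ξ‖) ^ (-(N : ℝ))) :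
    ENNReal.ofReal (Gamma ((β - 2 * α) / 2)) * ∫⁻ t, ∫⁻ x : E,
      ENNReal.ofReal ((‖x‖ ^ (β - 2 * α))⁻¹) * ‖dispersiveWave α β f x t‖ₑ ^ 2 ≤
    ENNReal.ofReal (2 * π / β) * (rieszMass ω₀ (β - 2 * α) * ∫⁻ ξ, ‖f ξ‖ₑ ^ 2) := by
  have h0 : 0 < β - 2 * α := by linarith
  have hfm := hf.measurable
  rw [lintegral_dispersiveWave hα h0 h2 hf hdec, lintegral_polar (by fun_prop),
    ← lintegral_const_mul' _ _ (rieszMass_lt_top ω₀ h1 h2).ne]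
  refine mul_le_mul' le_rfl (setLIntegral_mono' measurableSet_Ioi fun r _ => ?_)
  rw [mul_left_comm _ (ENNReal.ofReal (r ^ _))]
  exact mul_le_mul' le_rfl (lintegral_rpow_mul_sphereExtension_le ω₀ h0
    (g := fun ω => f (r • (ω : E))) (by fun_prop))

lemma lintegral_dispersiveWave_eq_of_radial [Nontrivial E] (ω₀ : sphere (0 : E) 1) {α β : ℝ}
    (hα : 0 ≤ α) (h1 : 1 < β - 2 * α) (h2 : β - 2 * α < finrank ℝ E) {f : E → ℂ}
    (hf : Continuous f)
    (hdec : ∀ N : ℕ, ∃ C : ℝ, 0 ≤ C ∧ ∀ ξ, ‖f ξ‖ ≤ C * (1 + ‖ξ‖) ^ (-(N : ℝ)))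
    (hrad : ∀ ξ η, ‖ξ‖ = ‖η‖ → f ξ = f η) :
    ENNReal.ofReal (Gamma ((β - 2 * α) / 2)) * ∫⁻ t, ∫⁻ x : E,
      ENNReal.ofReal ((‖x‖ ^ (β - 2 * α))⁻¹) * ‖dispersiveWave α β f x t‖ₑ ^ 2 =
    ENNReal.ofReal (2 * π / β) * (rieszMass ω₀ (β - 2 * α) * ∫⁻ ξ, ‖f ξ‖ₑ ^ 2) := by
  have h0 : 0 < β - 2 * α := by linarith
  have hfm := hf.measurable
  rw [lintegral_dispersiveWave hα h0 h2 hf hdec, lintegral_polar (by fun_prop),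
    ← lintegral_const_mul' _ _ (rieszMass_lt_top ω₀ h1 h2).ne]
  congr 1
  refine setLIntegral_congr_fun measurableSet_Ioi fun r _ => ?_
  have hc : ∀ ω : sphere (0 : E) 1, f (r • (ω : E)) = f (r • (ω₀ : E)) :=
    fun ω => hrad _ _ (by simp [norm_smul])
  simp_rw [hc]
  rw [mul_left_comm _ (ENNReal.ofReal (r ^ _)), lintegral_rpow_mul_sphereExtension_const ω₀ h0]

lemma integral_integral_eq_toReal_lintegral {X Y : Type*} [MeasurableSpace X] [MeasurableSpace Y]
    {μ : Measure X} {ν : Measure Y} [SFinite ν] {F : X → Y → ℝ}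
    (hF : Measurable (Function.uncurry F)) (h0 : ∀ t x, 0 ≤ F t x)
    (hfin : ∫⁻ t, ∫⁻ x, ENNReal.ofReal (F t x) ∂ν ∂μ < ∞) :
    ∫ t, ∫ x, F t x ∂ν ∂μ = (∫⁻ t, ∫⁻ x, ENNReal.ofReal (F t x) ∂ν ∂μ).toReal := by
  have hm : Measurable fun t => ∫⁻ x, ENNReal.ofReal (F t x) ∂ν :=
    hF.ennreal_ofReal.lintegral_prod_right'
  rw [← integral_toReal hm.aemeasurable (ae_lt_top hm hfin.ne)]
  congr with t
  exact integral_eq_lintegral_of_nonneg_ae (.of_forall fun x => h0 t x)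
    (hF.comp measurable_prodMk_left).aestronglyMeasurable

lemma integral_dispersiveWave (α β : ℝ) {f : E → ℂ} (hf : Continuous f)
    (hfin : ∫⁻ t, ∫⁻ x : E, ENNReal.ofReal ((‖x‖ ^ (β - 2 * α))⁻¹) *
      ‖dispersiveWave α β f x t‖ₑ ^ 2 < ∞) :
    ∫ t : ℝ, ∫ x : E, ‖dispersiveWave α β f x t‖ ^ 2 / ‖x‖ ^ (β - 2 * α) =
      (∫⁻ t, ∫⁻ x : E, ENNReal.ofReal ((‖x‖ ^ (β - 2 * α))⁻¹) *
        ‖dispersiveWave α β f x t‖ₑ ^ 2).toReal := by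
  have e : ∀ (t : ℝ) (x : E), ENNReal.ofReal ((‖x‖ ^ (β - 2 * α))⁻¹) *
      ‖dispersiveWave α β f x t‖ₑ ^ 2 =
      ENNReal.ofReal (‖dispersiveWave α β f x t‖ ^ 2 / ‖x‖ ^ (β - 2 * α)) := by
    intro t x
    rw [div_eq_mul_inv, mul_comm (_ ^ 2), ENNReal.ofReal_mul (by positivity),
      ENNReal.ofReal_pow (norm_nonneg _), ofReal_norm]
  simp_rw [e] at hfin ⊢
  have hm : Measurable fun p : ℝ × E => dispersiveWave α β f p.2 p.1 :=
    (measurable_dispersiveWave α β hf).comp measurable_swap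
  refine integral_integral_eq_toReal_lintegral ?_ (fun t x => by positivity) hfin
  unfold Function.uncurry
  fun_prop

end Assembly

end Smoothing

/-- For radial data the Kato-type smoothing estimate is an identity: there is a constant
`C = C(n, α, β)` such that equality holds for every radial Schwartz datum, and the
inequality with the same constant holds for every Schwartz datum. -/
theorem kato_smoothing_radial_identity (n : ℕ) (hn : 2 ≤ n) (α β : ℝ) (hα : 0 ≤ α)
    (h1 : 1 < β - 2 * α) (h2 : β - 2 * α < n) :
    ∃ C : ℝ,
      (∀ φ₀ : SchwartzMap (EuclideanSpace ℝ (Fin n)) ℂ,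
        (∀ x y : EuclideanSpace ℝ (Fin n), ‖x‖ = ‖y‖ → φ₀ x = φ₀ y) →
        (∫ t : ℝ, ∫ x : EuclideanSpace ℝ (Fin n),
            ‖gradProp α β φ₀ x t‖ ^ 2 / ‖x‖ ^ (β - 2 * α)) =
          C * ∫ x : EuclideanSpace ℝ (Fin n), ‖φ₀ x‖ ^ 2) ∧
      (∀ φ₀ : SchwartzMap (EuclideanSpace ℝ (Fin n)) ℂ,
        (∫ t : ℝ, ∫ x : EuclideanSpace ℝ (Fin n),
            ‖gradProp α β φ₀ x t‖ ^ 2 / ‖x‖ ^ (β - 2 * α)) ≤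
          C * ∫ x : EuclideanSpace ℝ (Fin n), ‖φ₀ x‖ ^ 2) := by
  have : Nontrivial (EuclideanSpace ℝ (Fin n)) :=
    Module.nontrivial_of_finrank_pos (R := ℝ) (by rw [finrank_euclideanSpace_fin]; lia)
  obtain ⟨ω, hω⟩ := exists_norm_eq (EuclideanSpace ℝ (Fin n)) zero_le_one
  set ω₀ : Metric.sphere (0 : EuclideanSpace ℝ (Fin n)) 1 := ⟨ω, by simpa using hω⟩
  have hdim : β - 2 * α < Module.finrank ℝ (EuclideanSpace ℝ (Fin n)) := by
    rwa [finrank_euclideanSpace_fin]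
  have hβ : 0 < β := by linarith
  have hΓ : 0 < Gamma ((β - 2 * α) / 2) := Gamma_pos_of_pos (by linarith)
  have hR := rieszMass_lt_top ω₀ h1 hdim
  set L : SchwartzMap (EuclideanSpace ℝ (Fin n)) ℂ → ENNReal := fun φ₀ =>
    ∫⁻ t, ∫⁻ x : EuclideanSpace ℝ (Fin n), ENNReal.ofReal ((‖x‖ ^ (β - 2 * α))⁻¹) *
      ‖dispersiveWave α β (fourierInt fun y => φ₀ y) x t‖ₑ ^ 2 with hL
  have hle : ∀ φ₀, ENNReal.ofReal (Gamma ((β - 2 * α) / 2)) * L φ₀ ≤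
      ENNReal.ofReal (2 * π / β) * (rieszMass ω₀ (β - 2 * α) *
        ENNReal.ofReal ((2 * π) ^ n * ∫ x, ‖φ₀ x‖ ^ 2)) := fun φ₀ => by
    rw [← lintegral_enorm_sq_fourierInt]
    exact lintegral_dispersiveWave_le ω₀ hα h1 hdim (continuous_fourierInt φ₀)
      (exists_norm_fourierInt_le φ₀)
  have htop : ∀ φ₀ : SchwartzMap (EuclideanSpace ℝ (Fin n)) ℂ,
      ENNReal.ofReal (2 * π / β) * (rieszMass ω₀ (β - 2 * α) *
        ENNReal.ofReal ((2 * π) ^ n * ∫ x, ‖φ₀ x‖ ^ 2)) < ⊤ := fun φ₀ =>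
    ENNReal.mul_lt_top ENNReal.ofReal_lt_top (ENNReal.mul_lt_top hR ENNReal.ofReal_lt_top)
  have hfin : ∀ φ₀, L φ₀ < ⊤ := fun φ₀ =>
    ENNReal.lt_top_of_mul_ne_top_right ((hle φ₀).trans_lt (htop φ₀)).ne (by simpa using hΓ)
  have hgrad : ∀ φ₀ : SchwartzMap (EuclideanSpace ℝ (Fin n)) ℂ,
      (∫ t : ℝ, ∫ x : EuclideanSpace ℝ (Fin n),
        ‖gradProp α β φ₀ x t‖ ^ 2 / ‖x‖ ^ (β - 2 * α)) =
      (((2 * π) ^ n)⁻¹ ^ 2 * (Gamma ((β - 2 * α) / 2))⁻¹) *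
        (ENNReal.ofReal (Gamma ((β - 2 * α) / 2)) * L φ₀).toReal := fun φ₀ => by
    rw [ENNReal.toReal_mul, ENNReal.toReal_ofReal hΓ.le, mul_assoc,
      inv_mul_cancel_left₀ hΓ.ne', hL,
      ← integral_dispersiveWave α β (continuous_fourierInt φ₀) (hfin φ₀), ← integral_const_mul]
    congr with t
    rw [← integral_const_mul]
    congr with x
    have : gradProp α β φ₀ x t =
        ((((2 * π) ^ n : ℝ)⁻¹ : ℝ) : ℂ) * dispersiveWave α β (fourierInt fun y => φ₀ y) x t := by
      rw [gradProp, dispersiveWave, Complex.ofReal_inv]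
    rw [this, norm_mul, Complex.norm_real, Real.norm_of_nonneg (by positivity), mul_pow,
      mul_div_assoc]
  have hrhs : ∀ φ₀ : SchwartzMap (EuclideanSpace ℝ (Fin n)) ℂ,
      (ENNReal.ofReal (2 * π / β) * (rieszMass ω₀ (β - 2 * α) *
        ENNReal.ofReal ((2 * π) ^ n * ∫ x, ‖φ₀ x‖ ^ 2))).toReal =
      2 * π / β * ((rieszMass ω₀ (β - 2 * α)).toReal * (2 * π) ^ n) * ∫ x, ‖φ₀ x‖ ^ 2 :=
    fun φ₀ => by
    rw [ENNReal.toReal_mul, ENNReal.toReal_mul, ENNReal.toReal_ofReal (by positivity),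
      ENNReal.toReal_ofReal (by positivity)]
    ring
  refine ⟨(((2 * π) ^ n)⁻¹ ^ 2 * (Gamma ((β - 2 * α) / 2))⁻¹) *
    (2 * π / β * ((rieszMass ω₀ (β - 2 * α)).toReal * (2 * π) ^ n)), fun φ₀ hφ => ?_, fun φ₀ => ?_⟩
  · rw [hgrad, mul_assoc _ (2 * π / β * _), ← hrhs, ← lintegral_enorm_sq_fourierInt,
      ← lintegral_dispersiveWave_eq_of_radial ω₀ hα h1 hdim (continuous_fourierInt φ₀)
        (exists_norm_fourierInt_le φ₀) fun _ _ => fourierInt_radial hφ]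
  · rw [hgrad, mul_assoc _ (2 * π / β * _), ← hrhs]
    exact mul_le_mul_of_nonneg_left (ENNReal.toReal_mono (htop φ₀).ne (hle φ₀)) (by positivity)
end

section
/- Let ψ₀ be a spherically symmetric (radial) Schwartz function on ℝ³ and let ψ be the solution of the free Schrödinger equation i ψ_t = −Δψ in ℝ^{3+1} with ψ(·,0) = ψ₀. Then ∫_{−∞}^{∞} ∫_{ℝ³} |ψ(x,t)|² / |x|² dx dt = π ‖ψ₀‖_{L²(ℝ³)}². In particular, the best constant π/(n−2) = π in the classical Kato smoothing estimate on ℝ³ is attained at every radial datum. -/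
open MeasureTheory Real SchwartzMap

noncomputable section

/-- The Fourier transform `ψ̂₀(ξ) = ∫ e^{-i x·ξ} ψ₀(x) dx` on `ℝ³`. -/
def fourierInt3 (f : EuclideanSpace ℝ (Fin 3) → ℂ) (ξ : EuclideanSpace ℝ (Fin 3)) : ℂ :=
  ∫ x : EuclideanSpace ℝ (Fin 3), Complex.exp (-(Complex.I * ((inner ℝ x ξ : ℝ) : ℂ))) * f x

/-- The solution `ψ(x,t) = (2π)^{-3} ∫ e^{i x·ξ} e^{-i t |ξ|²} ψ̂₀(ξ) dξ` of the free
Schrödinger equation `i ψ_t = -Δψ` on `ℝ^{3+1}` with initial data `ψ₀`. -/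
def schrodingerSol3 (ψ₀ : 𝓢(EuclideanSpace ℝ (Fin 3), ℂ))
    (x : EuclideanSpace ℝ (Fin 3)) (t : ℝ) : ℂ :=
  ((2 * π) ^ 3 : ℝ)⁻¹ *
    ∫ ξ : EuclideanSpace ℝ (Fin 3),
      Complex.exp (Complex.I * ((inner ℝ x ξ : ℝ) : ℂ)) *
        Complex.exp (-(Complex.I * (t : ℂ) * ((‖ξ‖ ^ 2 : ℝ) : ℂ))) *
          fourierInt3 (fun y => ψ₀ y) ξ

end

open scoped FourierTransform ENNReal ContDiff

/-- Polar coordinates for the lower Lebesgue integral of a radial function. -/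
theorem lintegral_fun_norm_addHaar {E : Type*} [NormedAddCommGroup E] [NormedSpace ℝ E]
    [Nontrivial E] [MeasurableSpace E] [BorelSpace E] [FiniteDimensional ℝ E]
    (μ : Measure E) [μ.IsAddHaarMeasure] {f : ℝ → ℝ≥0∞} (hf : Measurable f) :
    ∫⁻ x, f ‖x‖ ∂μ = (Module.finrank ℝ E * μ (Metric.ball 0 1)) *
      ∫⁻ r in Set.Ioi (0 : ℝ), ENNReal.ofReal (r ^ (Module.finrank ℝ E - 1)) * f r := by
  calc
    ∫⁻ x, f ‖x‖ ∂μ = ∫⁻ x : ({(0)}ᶜ : Set E), f (‖x.1‖) ∂(μ.comap (↑)) := by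
      rw [lintegral_subtype_comap (measurableSet_singleton _).compl fun x ↦ f (‖x‖),
        restrict_compl_singleton]
    _ = ∫⁻ x, f x.2 ∂μ.toSphere.prod (.volumeIoiPow (Module.finrank ℝ E - 1)) := by
      simpa using μ.measurePreserving_homeomorphUnitSphereProd.lintegral_comp_emb
        (Homeomorph.measurableEmbedding _) (f ∘ Subtype.val ∘ Prod.snd)
    _ = μ.toSphere Set.univ *
        ∫⁻ x : Set.Ioi (0 : ℝ), f x ∂.volumeIoiPow (Module.finrank ℝ E - 1) := by
      rw [lintegral_prod _ (by fun_prop)]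
      simp [mul_comm]
    _ = _ := by
      rw [μ.toSphere_apply_univ, Measure.volumeIoiPow,
        lintegral_withDensity_eq_lintegral_mul _ (by fun_prop) (by fun_prop),
        ← lintegral_subtype_comap measurableSet_Ioi]
      rfl

theorem volume_ball_three :
    volume (Metric.ball (0 : EuclideanSpace ℝ (Fin 3)) 1) = ENNReal.ofReal (4 * π / 3) := by
  have h := InnerProductSpace.volume_ball_of_dim_odd (k := 1) (E := EuclideanSpace ℝ (Fin 3))
    (by simp) 0 1
  rw [h]
  simp [Nat.doubleFactorial]
  ring_nf

theorem volume_ball_two :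
    volume (Metric.ball (0 : EuclideanSpace ℝ (Fin 2)) 1) = ENNReal.ofReal π := by
  have h := InnerProductSpace.volume_ball_of_dim_even (k := 1) (E := EuclideanSpace ℝ (Fin 2))
    (by simp) 0 1
  rw [h]
  simp

theorem integral_exp_symm (a s : ℝ) (ha : a ≠ 0) :
    ∫ z in (-s)..s, Complex.exp (Complex.I * (a * z : ℝ)) =
      ((2 * Real.sin (s * a) / a : ℝ) : ℂ) := by
  have := integral_exp_mul_complex (a := -s) (b := s) (c := Complex.I * a) (by simp [ha])
  simp only [Complex.ofReal_mul, ← mul_assoc]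
  rw [this]
  have ha' : (a : ℂ) ≠ 0 := by exact_mod_cast ha
  have e1 : Complex.I * a * s = (s * a : ℝ) * Complex.I := by push_cast; ring
  have e2 : Complex.I * a * (-s : ℝ) = (-(s * a) : ℝ) * Complex.I := by push_cast; ring
  rw [e1, e2, Complex.exp_mul_I, Complex.exp_mul_I]
  push_cast
  rw [Complex.cos_neg, Complex.sin_neg]
  field_simp
  ring

/-- The `L²` Fourier transform agrees with the Fourier integral on `L¹ ∩ L²`. -/
theorem fourier_toLp_ae_eq {f : ℝ → ℂ} (hf : Integrable f) (hf2 : MemLp f 2) :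
    (𝓕 (hf2.toLp f) : Lp ℂ 2 (volume : Measure ℝ)) =ᵐ[volume] 𝓕 f := by
  have hcont : Continuous (𝓕 f) :=
    VectorFourier.fourierIntegral_continuous Real.continuous_fourierChar
      (by fun_prop) hf
  apply ae_eq_of_integral_contDiff_smul_eq
  · exact (Lp.memLp _).locallyIntegrable (by norm_num)
  · exact hcont.locallyIntegrable
  intro g g_smooth g_cpt
  have hg₁ : HasCompactSupport (Complex.ofRealCLM ∘ g) := g_cpt.comp_left rfl
  have hg₂ : ContDiff ℝ ∞ (Complex.ofRealCLM ∘ g) := by fun_prop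
  set U : Lp ℂ 2 (volume : Measure ℝ) := 𝓕 (hf2.toLp f) with hU
  set φ := hg₁.toSchwartzMap hg₂ with hφ
  have hφg : ∀ x, φ x = (g x : ℂ) := fun x => by simp [hφ]
  have h1 : ∫ x, g x • U x = ∫ x, φ x • U x := by
    simp [hφg]
  have h2 : ∫ x, g x • 𝓕 f x = ∫ x, φ x • 𝓕 f x := by
    simp [hφg]
  rw [h1, h2, ← Lp.toTemperedDistribution_apply, hU, ← Lp.fourier_toTemperedDistribution_eq,
    TemperedDistribution.fourier_apply, Lp.toTemperedDistribution_apply]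
  have h3 : ∫ x, (𝓕 φ) x • hf2.toLp f x = ∫ x, (𝓕 φ) x • f x := by
    apply integral_congr_ae
    filter_upwards [hf2.coeFn_toLp] with x hx
    rw [hx]
  rw [h3]
  have := VectorFourier.integral_fourierIntegral_smul_eq_flip (μ := volume) (ν := volume)
    (e := 𝐞) (L := innerₗ ℝ) Real.continuous_fourierChar (by fun_prop) φ.integrable hf
  rw [flip_innerₗ] at this
  exact this

theorem lintegral_enorm_sq_fourier_s4 {f : ℝ → ℂ} (hf : Integrable f) (hf2 : MemLp f 2) :
    ∫⁻ t, ‖𝓕 f t‖ₑ ^ 2 = ∫⁻ s, ‖f s‖ₑ ^ 2 := by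
  have h : ‖(𝓕 (hf2.toLp f) : Lp ℂ 2 (volume : Measure ℝ))‖ₑ = ‖hf2.toLp f‖ₑ := by
    rw [← ofReal_norm, ← ofReal_norm, Lp.norm_fourier_eq]
  rw [Lp.enorm_def, Lp.enorm_def, eLpNorm_congr_ae (fourier_toLp_ae_eq hf hf2),
    eLpNorm_congr_ae hf2.coeFn_toLp, eLpNorm_eq_lintegral_rpow_enorm_toReal (by simp) (by simp),
    eLpNorm_eq_lintegral_rpow_enorm_toReal (by simp) (by simp)] at h
  have := ENNReal.rpow_left_injective (by norm_num) h
  simpa using this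

theorem lintegral_sq_sin_div_sq {r : ℝ} (hr : 0 < r) :
    ∫⁻ R in Set.Ioi (0 : ℝ), ENNReal.ofReal (Real.sin (r * R) ^ 2 / R ^ 2) =
      ENNReal.ofReal (π * r / 2) := by
  set s : ℝ := r / (2 * π) with hs
  have hspos : 0 < s := by positivity
  set f : ℝ → ℂ := (Set.Ioc (-s) s).indicator 1 with hf
  have hfi : Integrable f := by
    rw [hf, integrable_indicator_iff measurableSet_Ioc]
    exact integrableOn_const (by simp)
  have hf2 : MemLp f 2 := memLp_indicator_const 2 measurableSet_Ioc 1 (Or.inr (by simp))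
  have hF : ∀ w : ℝ, w ≠ 0 → ‖𝓕 f w‖ₑ ^ 2 =
      ENNReal.ofReal (π⁻¹ ^ 2) * ENNReal.ofReal (Real.sin (r * ‖w‖) ^ 2 / ‖w‖ ^ 2) := by
    intro w hw
    have h1 : 𝓕 f w = ((Real.sin (r * w) / (π * w) : ℝ) : ℂ) := by
      rw [Real.fourier_real_eq_integral_exp_smul]
      have h2 := integral_exp_symm (-(2 * π * w)) s (by simp [hw, pi_ne_zero])
      rw [intervalIntegral.integral_of_le (by linarith)] at h2
      rw [← integral_indicator measurableSet_Ioc] at h2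
      have h3 : 2 * Real.sin (s * -(2 * π * w)) / -(2 * π * w) = Real.sin (r * w) / (π * w) := by
        have : s * -(2 * π * w) = -(r * w) := by rw [hs]; field_simp
        rw [this, Real.sin_neg]
        field_simp
      rw [← h3, ← h2]
      congr 1
      ext v
      by_cases hv : v ∈ Set.Ioc (-s) s
      · simp only [hf, Set.indicator_of_mem hv, Pi.one_apply, smul_eq_mul, mul_one]
        congr 1
        push_cast
        ring
      · simp [hf, Set.indicator_of_notMem hv]
    rw [h1, ← ofReal_norm, ← ENNReal.ofReal_pow (norm_nonneg _),
      ← ENNReal.ofReal_mul (by positivity), Complex.norm_real]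
    congr 1
    rw [Real.norm_eq_abs, Real.norm_eq_abs, sq_abs, sq_abs, div_pow, mul_pow]
    rcases abs_cases w with ⟨h, _⟩ | ⟨h, _⟩ <;> rw [h]
    · field_simp
    · rw [mul_neg, Real.sin_neg, neg_sq]; field_simp
  have hP := lintegral_enorm_sq_fourier_s4 hfi hf2
  have hL : ∫⁻ t, ‖𝓕 f t‖ₑ ^ 2 = ENNReal.ofReal (π⁻¹ ^ 2) *
      ∫⁻ w : ℝ, ENNReal.ofReal (Real.sin (r * ‖w‖) ^ 2 / ‖w‖ ^ 2) := by
    rw [← lintegral_const_mul _ (by fun_prop)]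
    apply lintegral_congr_ae
    filter_upwards [compl_mem_ae_iff.mpr (measure_singleton (0 : ℝ))] with w hw
    exact hF w hw
  have hR : ∫⁻ t, ‖f t‖ₑ ^ 2 = ENNReal.ofReal (r / π) := by
    have : ∀ t, ‖f t‖ₑ ^ 2 = (Set.Ioc (-s) s).indicator 1 t := by
      intro t
      by_cases hv : t ∈ Set.Ioc (-s) s <;> simp [hf, hv]
    simp_rw [this]
    rw [lintegral_indicator_one measurableSet_Ioc, Real.volume_Ioc]
    congr 1
    rw [hs]; field_simp; ring
  rw [hL, hR, lintegral_fun_norm_addHaar volume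
    (f := fun R => ENNReal.ofReal (Real.sin (r * R) ^ 2 / R ^ 2)) (by fun_prop)] at hP
  simp only [Module.finrank_self, Real.volume_ball, tsub_self, pow_zero, ENNReal.ofReal_one,
    one_mul, Nat.cast_one, ← mul_assoc] at hP
  rw [← ENNReal.ofReal_mul (by positivity)] at hP
  have hne : ENNReal.ofReal (π⁻¹ ^ 2 * (2 * 1)) ≠ 0 := by simp; positivity
  rw [← ENNReal.mul_right_inj hne ENNReal.ofReal_ne_top, hP, ← ENNReal.ofReal_mul (by positivity)]
  congr 1
  field_simp

/-- Cylindrical splitting of `ℝ³` as `ℝ × ℝ²`. -/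
noncomputable def euclideanSplit :
    EuclideanSpace ℝ (Fin 3) ≃ᵐ ℝ × EuclideanSpace ℝ (Fin 2) :=
  (MeasurableEquiv.toLp 2 (Fin 3 → ℝ)).symm.trans
    ((MeasurableEquiv.piFinSuccAbove (fun _ => ℝ) 0).trans
      ((MeasurableEquiv.refl ℝ).prodCongr (MeasurableEquiv.toLp 2 (Fin 2 → ℝ))))

theorem measurePreserving_euclideanSplit : MeasurePreserving euclideanSplit := by
  unfold euclideanSplit
  refine (PiLp.volume_preserving_ofLp (Fin 3)).trans
    ((volume_preserving_piFinSuccAbove (fun _ : Fin 3 => ℝ) 0).trans ?_)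
  exact (MeasurePreserving.id volume).prod (PiLp.volume_preserving_toLp (Fin 2))

theorem euclideanSplit_fst (x : EuclideanSpace ℝ (Fin 3)) : (euclideanSplit x).1 = x 0 := rfl

theorem norm_euclideanSplit (x : EuclideanSpace ℝ (Fin 3)) :
    √((euclideanSplit x).1 ^ 2 + ‖(euclideanSplit x).2‖ ^ 2) = ‖x‖ := by
  have h0 : (euclideanSplit x).2 0 = x 1 := rfl
  have h1 : (euclideanSplit x).2 1 = x 2 := rfl
  rw [EuclideanSpace.norm_eq x, EuclideanSpace.norm_sq_eq]
  congr 1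
  simp [Fin.sum_univ_succ, h0, h1, euclideanSplit_fst]

theorem integral_plane_sqrt (z : ℝ) (h : ℝ → ℂ) :
    ∫ y : EuclideanSpace ℝ (Fin 2), h (√(z ^ 2 + ‖y‖ ^ 2)) =
      2 * π * ∫ s in Set.Ioi |z|, s * h s := by
  have hpos : ∀ ρ ∈ Set.Ioi (0 : ℝ), 0 < z ^ 2 + ρ ^ 2 := by
    intro ρ hρ
    have : 0 < ρ := hρ
    positivity
  have himg : (fun ρ : ℝ => √(z ^ 2 + ρ ^ 2)) '' Set.Ioi 0 = Set.Ioi |z| := by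
    ext s
    constructor
    · rintro ⟨ρ, hρ, rfl⟩
      have : 0 < ρ := hρ
      rw [Set.mem_Ioi, ← Real.sqrt_sq_eq_abs]
      exact Real.sqrt_lt_sqrt (sq_nonneg _) (by nlinarith)
    · intro hs
      have hs : |z| < s := hs
      have hs0 : 0 < s := (abs_nonneg z).trans_lt hs
      have hlt : z ^ 2 < s ^ 2 := sq_lt_sq.mpr (by rwa [abs_of_pos hs0])
      refine ⟨√(s ^ 2 - z ^ 2), Real.sqrt_pos.mpr (by linarith), ?_⟩
      simp only
      rw [Real.sq_sqrt (by linarith)]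
      rw [add_sub_cancel, Real.sqrt_sq hs0.le]
  rw [integral_fun_norm_addHaar volume (fun ρ => h (√(z ^ 2 + ρ ^ 2))), ← himg,
    integral_image_eq_integral_abs_deriv_smul (f' := fun ρ => ρ / √(z ^ 2 + ρ ^ 2))
      measurableSet_Ioi _ _]
  · have hv : volume.real (Metric.ball (0 : EuclideanSpace ℝ (Fin 2)) 1) = π := by
      rw [Measure.real, volume_ball_two, ENNReal.toReal_ofReal pi_nonneg]
    rw [hv]
    simp only [finrank_euclideanSpace, Fintype.card_fin, nsmul_eq_mul, Complex.real_smul]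
    push_cast
    rw [mul_assoc]
    congr 2
    apply setIntegral_congr_fun measurableSet_Ioi
    intro ρ hρ
    have h1 : 0 < √(z ^ 2 + ρ ^ 2) := Real.sqrt_pos.mpr (hpos ρ hρ)
    have h2 : (√(z ^ 2 + ρ ^ 2) : ℂ) ≠ 0 := by exact_mod_cast h1.ne'
    simp only
    rw [abs_of_pos (div_pos hρ h1)]
    push_cast
    field_simp
  · intro ρ hρ
    have hd : HasDerivAt (fun ρ : ℝ => z ^ 2 + ρ ^ 2) (2 * ρ) ρ := by
      simpa using (hasDerivAt_pow 2 ρ).const_add (z ^ 2)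
    have := (hd.sqrt (hpos ρ hρ).ne').hasDerivWithinAt (s := Set.Ioi 0)
    rwa [mul_div_mul_left _ _ two_ne_zero] at this
  · intro a ha b hb hab
    have ha : 0 < a := ha
    have hb : 0 < b := hb
    have := (Real.sqrt_inj (hpos a ha).le (hpos b hb).le).mp hab
    exact (pow_left_inj₀ ha.le hb.le two_ne_zero).mp (by linarith)

theorem integral_exp_coord_mul_radial {a : ℝ} (ha : 0 < a) {h : ℝ → ℂ} (hc : Continuous h)
    (hi : Integrable (fun x : EuclideanSpace ℝ (Fin 3) => h ‖x‖)) :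
    ∫ x : EuclideanSpace ℝ (Fin 3), Complex.exp (Complex.I * (a * x 0 : ℝ)) * h ‖x‖ =
      (4 * π / a : ℝ) * ∫ s in Set.Ioi (0 : ℝ), (s * Real.sin (s * a) : ℝ) * h s := by
  have hnorm : ∀ z : ℝ, ‖Complex.exp (Complex.I * (z : ℝ))‖ = 1 := fun z => by
    rw [mul_comm]; exact Complex.norm_exp_ofReal_mul_I z
  have hi2 : IntegrableOn (fun s : ℝ => s ^ 2 • h s) (Set.Ioi 0) := by
    have := (integrable_fun_norm_addHaar volume).mp hi
    simpa using this
  set G : ℝ × EuclideanSpace ℝ (Fin 2) → ℂ := fun p =>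
    Complex.exp (Complex.I * (a * p.1 : ℝ)) * h (√(p.1 ^ 2 + ‖p.2‖ ^ 2)) with hG
  have hGe : ∀ x, G (euclideanSplit x) = Complex.exp (Complex.I * (a * x 0 : ℝ)) * h ‖x‖ := by
    intro x
    simp only [hG]
    rw [norm_euclideanSplit, euclideanSplit_fst]
  have hFi : Integrable
      (fun x : EuclideanSpace ℝ (Fin 3) => Complex.exp (Complex.I * (a * x 0 : ℝ)) * h ‖x‖) := by
    refine hi.bdd_mul (c := 1) (by fun_prop) (Filter.Eventually.of_forall fun x => ?_)
    exact (hnorm _).le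
  have hGi : Integrable G := by
    rw [← measurePreserving_euclideanSplit.integrable_comp_emb
      euclideanSplit.measurableEmbedding]
    exact hFi.congr (Filter.Eventually.of_forall fun x => (hGe x).symm)
  simp_rw [← hGe]
  rw [measurePreserving_euclideanSplit.integral_comp', Measure.volume_eq_prod,
    integral_prod _ hGi]
  simp only [hG]
  simp_rw [integral_const_mul, integral_plane_sqrt]
  -- the kernel in the variables `(z, s)`
  set K : ℝ × ℝ → ℂ := fun p => {p : ℝ × ℝ | |p.1| < p.2}.indicator
    (fun p => Complex.exp (Complex.I * (a * p.1 : ℝ)) * (p.2 * h p.2)) p with hK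
  have hKm : MeasurableSet {p : ℝ × ℝ | |p.1| < p.2} :=
    measurableSet_lt (by fun_prop) (by fun_prop)
  have hKmeas : AEStronglyMeasurable K (volume.prod volume) := by
    refine Continuous.aestronglyMeasurable ?_ |>.indicator hKm
    fun_prop
  have hKz : ∀ s z : ℝ, K (z, s) = (Set.Ioo (-s) s).indicator
      (fun z => Complex.exp (Complex.I * (a * z : ℝ)) * (s * h s)) z := by
    intro s z
    simp only [hK, Set.indicator, Set.mem_ofPred_eq, abs_lt, Set.mem_Ioo]
  have hKs : ∀ z s : ℝ, K (z, s) = (Set.Ioi |z|).indicator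
      (fun s => Complex.exp (Complex.I * (a * z : ℝ)) * (s * h s)) s := by
    intro z s
    simp only [hK, Set.indicator, Set.mem_ofPred_eq, Set.mem_Ioi]
  have hKi : Integrable K (volume.prod volume) := by
    rw [integrable_prod_iff' hKmeas]
    constructor
    · refine Filter.Eventually.of_forall fun s => ?_
      simp_rw [hKz]
      rw [integrable_indicator_iff measurableSet_Ioo]
      refine Continuous.integrableOn_Icc ?_ |>.mono_set Set.Ioo_subset_Icc_self
      fun_prop
    · have : ∀ s, ∫ z, ‖K (z, s)‖ = (Set.Ioi 0).indicator (fun s => 2 * ‖s ^ 2 • h s‖) s := by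
        intro s
        simp_rw [hKz, norm_indicator_eq_indicator_norm, norm_mul, hnorm, one_mul]
        rw [integral_indicator measurableSet_Ioo, setIntegral_const]
        by_cases hs : 0 < s
        · rw [Set.indicator_of_mem (Set.mem_Ioi.mpr hs)]
          simp [Measure.real, hs.le, abs_of_pos hs]
          ring
        · rw [Set.indicator_of_notMem (by simpa using hs)]
          simp [not_lt.mp hs]
      simp_rw [this]
      rw [integrable_indicator_iff measurableSet_Ioi]
      exact hi2.norm.const_mul 2
  have e1 : ∀ z : ℝ, Complex.exp (Complex.I * (a * z : ℝ)) *
      (2 * π * ∫ s in Set.Ioi |z|, s * h s) = 2 * π * ∫ s, K (z, s) := by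
    intro z
    simp_rw [hKs]
    rw [integral_indicator measurableSet_Ioi, integral_const_mul]
    ring
  simp_rw [e1]
  rw [integral_const_mul, integral_integral_swap (f := fun z s => K (z, s)) hKi]
  have e2 : ∀ s : ℝ, ∫ z, K (z, s) = (Set.Ioi (0 : ℝ)).indicator
      (fun s => (2 / a : ℝ) * ((s * Real.sin (s * a) : ℝ) * h s)) s := by
    intro s
    simp_rw [hKz]
    rw [integral_indicator measurableSet_Ioo, integral_mul_const]
    by_cases hs : 0 < s
    · rw [Set.indicator_of_mem (Set.mem_Ioi.mpr hs), ← integral_Ioc_eq_integral_Ioo,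
        ← intervalIntegral.integral_of_le (by linarith), integral_exp_symm a s ha.ne']
      push_cast
      ring
    · rw [Set.indicator_of_notMem (by simpa using hs),
        Set.Ioo_eq_empty (show ¬ (-s < s) by linarith)]
      simp
  simp_rw [e2]
  rw [integral_indicator measurableSet_Ioi, integral_const_mul]
  push_cast
  ring

theorem exists_linearIsometryEquiv_apply_eq {E : Type*} [NormedAddCommGroup E]
    [InnerProductSpace ℝ E] {v w : E} (h : ‖v‖ = ‖w‖) : ∃ T : E ≃ₗᵢ[ℝ] E, T v = w :=
  ⟨_, Submodule.reflection_sub h⟩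

/-- The Fourier integral of a radial function on `ℝ³` as a one-dimensional sine integral. -/
theorem integral_exp_inner_mul_radial {x : EuclideanSpace ℝ (Fin 3)} (hx : x ≠ 0) {h : ℝ → ℂ}
    (hc : Continuous h) (hi : Integrable (fun x : EuclideanSpace ℝ (Fin 3) => h ‖x‖)) :
    ∫ ξ : EuclideanSpace ℝ (Fin 3), Complex.exp (Complex.I * (inner ℝ x ξ : ℝ)) * h ‖ξ‖ =
      (4 * π / ‖x‖ : ℝ) * ∫ s in Set.Ioi (0 : ℝ), (s * Real.sin (s * ‖x‖) : ℝ) * h s := by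
  rw [← integral_exp_coord_mul_radial (norm_pos_iff.mpr hx) hc hi]
  obtain ⟨T, hT⟩ := exists_linearIsometryEquiv_apply_eq
    (v := x) (w := EuclideanSpace.single (0 : Fin 3) ‖x‖) (by simp)
  rw [← T.measurePreserving.integral_comp T.toHomeomorph.measurableEmbedding
    (fun ξ => Complex.exp (Complex.I * (‖x‖ * ξ 0 : ℝ)) * h ‖ξ‖)]
  congr 1
  ext ξ
  have : inner ℝ x ξ = ‖x‖ * (T ξ) 0 := by
    rw [← T.inner_map_map, hT, EuclideanSpace.inner_single_left]
    simp
  rw [this, T.norm_map]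

theorem image_sq_Ioi : (fun r : ℝ => r ^ 2) '' Set.Ioi 0 = Set.Ioi 0 := by
  ext s
  constructor
  · rintro ⟨r, hr, rfl⟩
    exact pow_pos (Set.mem_Ioi.mp hr) 2
  · intro hs
    exact ⟨√s, Real.sqrt_pos.mpr hs, Real.sq_sqrt (le_of_lt hs)⟩

theorem hasDerivWithinAt_sq_Ioi (r : ℝ) :
    HasDerivWithinAt (fun r : ℝ => r ^ 2) (2 * r) (Set.Ioi 0) r := by
  simpa using (hasDerivAt_pow 2 r).hasDerivWithinAt

theorem injOn_sq_Ioi : Set.InjOn (fun r : ℝ => r ^ 2) (Set.Ioi 0) := fun _ ha _ hb hab =>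
  (pow_left_inj₀ (le_of_lt ha) (le_of_lt hb) two_ne_zero).mp hab

/-- The one-dimensional oscillatory integral to which the radial Schrödinger flow reduces. -/
noncomputable def radialOsc (g : ℝ → ℂ) (R t : ℝ) : ℂ :=
  ∫ r in Set.Ioi (0 : ℝ), (r * Real.sin (r * R) : ℝ) *
    (Complex.exp (-(Complex.I * t * (r ^ 2 : ℝ))) * g r)

theorem lintegral_enorm_sq_radialOsc (g : 𝓢(ℝ, ℂ)) (R : ℝ) :
    ∫⁻ t, ‖radialOsc g R t‖ₑ ^ 2 = ENNReal.ofReal π *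
      ∫⁻ r in Set.Ioi (0 : ℝ), ENNReal.ofReal (r * Real.sin (r * R) ^ 2 * ‖g r‖ ^ 2) := by
  set F₀ : ℝ → ℂ := fun s => (Real.sin (√s * R) / 2 : ℝ) * g √s with hF₀
  set F : ℝ → ℂ := (Set.Ioi 0).indicator F₀ with hF
  have hF₀c : Continuous F₀ := by fun_prop
  have hF₀sq : ∀ r ∈ Set.Ioi (0 : ℝ), F₀ (r ^ 2) = (Real.sin (r * R) / 2 : ℝ) * g r := by
    intro r hr
    simp only [hF₀, Real.sqrt_sq (le_of_lt (Set.mem_Ioi.mp hr))]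
  have hsin : ∀ r : ℝ, |Real.sin (r * R)| ≤ 1 := fun r => Real.abs_sin_le_one _
  have hFi : Integrable F := by
    rw [hF, integrable_indicator_iff measurableSet_Ioi, ← image_sq_Ioi,
      integrableOn_image_iff_integrableOn_abs_deriv_smul measurableSet_Ioi
        (fun r _ => hasDerivWithinAt_sq_Ioi r) injOn_sq_Ioi]
    have hg := (g.integrable_pow_mul volume 1).integrableOn (s := Set.Ioi (0 : ℝ))
    refine hg.mono' ?_ ?_
    · exact Continuous.aestronglyMeasurable (by fun_prop)
    · filter_upwards [ae_restrict_mem measurableSet_Ioi] with r hr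
      rw [hF₀sq r hr, norm_smul, norm_mul, Complex.norm_real, pow_one]
      have hr : 0 < r := hr
      simp only [Real.norm_eq_abs, abs_abs, abs_mul, abs_div, abs_two]
      have := mul_le_mul_of_nonneg_left (hsin r) (mul_nonneg (abs_nonneg r) (norm_nonneg (g r)))
      linarith
  obtain ⟨C, hC⟩ := g.decay 0 0
  have hgb : ∀ r, ‖g r‖ ≤ C := fun r => by simpa using hC.2 r
  have hF2 : MemLp F 2 := by
    rw [memLp_two_iff_integrable_sq_norm hFi.aestronglyMeasurable]
    simp_rw [pow_two]
    refine hFi.norm.bdd_mul (c := C) hFi.norm.aestronglyMeasurable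
      (Filter.Eventually.of_forall fun s => ?_)
    rw [norm_norm]
    by_cases hs : s ∈ Set.Ioi (0 : ℝ)
    · rw [hF, Set.indicator_of_mem hs, norm_mul, Complex.norm_real]
      have h1 : ‖Real.sin (√s * R) / 2‖ ≤ 1 := by
        rw [norm_div, Real.norm_eq_abs, Real.norm_two]
        linarith [hsin √s]
      calc _ ≤ 1 * ‖g √s‖ := by gcongr
        _ ≤ C := by rw [one_mul]; exact hgb _
    · rw [hF, Set.indicator_of_notMem hs, norm_zero]
      exact (norm_nonneg _).trans (hgb 0)
  have hT : ∀ w : ℝ, radialOsc g R (2 * π * w) = 𝓕 F w := by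
    intro w
    rw [Real.fourier_real_eq_integral_exp_smul, radialOsc]
    have : ∀ s : ℝ, Complex.exp (↑(-2 * π * s * w) * Complex.I) • F s =
        (Set.Ioi 0).indicator
          (fun s => Complex.exp (↑(-2 * π * s * w) * Complex.I) • F₀ s) s := by
      intro s
      by_cases hs : s ∈ Set.Ioi (0 : ℝ) <;> simp [hF, hs]
    simp_rw [this]
    rw [integral_indicator measurableSet_Ioi]
    conv_rhs => rw [← image_sq_Ioi]
    rw [integral_image_eq_integral_abs_deriv_smul measurableSet_Ioi
        (fun r _ => hasDerivWithinAt_sq_Ioi r) injOn_sq_Ioi]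
    refine setIntegral_congr_fun measurableSet_Ioi fun r hr => ?_
    rw [hF₀sq r hr, abs_of_pos (by have : 0 < r := hr; linarith)]
    have e : -(Complex.I * (2 * π * w : ℝ) * (r ^ 2 : ℝ)) =
        (-2 * π * r ^ 2 * w : ℝ) * Complex.I := by push_cast; ring
    rw [e, Complex.real_smul, smul_eq_mul]
    push_cast
    ring
  have hscale : ∫⁻ t, ‖radialOsc g R t‖ₑ ^ 2 = ENNReal.ofReal (2 * π) *
      ∫⁻ w, ‖radialOsc g R (2 * π * w)‖ₑ ^ 2 := by
    have himg : (fun w : ℝ => 2 * π * w) '' Set.univ = Set.univ := by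
      rw [Set.image_univ]
      exact (mul_left_surjective₀ (by positivity)).range_eq
    have := lintegral_image_eq_lintegral_abs_deriv_mul (s := Set.univ)
      (f := fun w : ℝ => 2 * π * w) (f' := fun _ => 2 * π) MeasurableSet.univ
      (fun w _ => by simpa using (hasDerivAt_id' w).const_mul (2 * π))
      (mul_right_injective₀ (by positivity)).injOn (fun t => ‖radialOsc g R t‖ₑ ^ 2)
    rw [himg, setLIntegral_univ, setLIntegral_univ, abs_of_pos (by positivity)] at this
    rw [this, lintegral_const_mul' _ _ ENNReal.ofReal_ne_top]
  rw [hscale]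
  simp_rw [hT]
  rw [lintegral_enorm_sq_fourier_s4 hFi hF2]
  have : ∀ s, ‖F s‖ₑ ^ 2 = (Set.Ioi 0).indicator (fun s => ‖F₀ s‖ₑ ^ 2) s := by
    intro s
    by_cases hs : s ∈ Set.Ioi (0 : ℝ) <;> simp [hF, hs]
  simp_rw [this]
  rw [lintegral_indicator measurableSet_Ioi]
  conv_lhs => rw [← image_sq_Ioi]
  rw [lintegral_image_eq_lintegral_abs_deriv_mul measurableSet_Ioi
      (fun r _ => hasDerivWithinAt_sq_Ioi r) injOn_sq_Ioi,
    ← lintegral_const_mul' _ _ ENNReal.ofReal_ne_top,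
    ← lintegral_const_mul' _ _ ENNReal.ofReal_ne_top]
  refine setLIntegral_congr_fun measurableSet_Ioi fun r hr => ?_
  have hr0 : 0 < r := hr
  rw [hF₀sq r hr, ← ofReal_norm, ← ENNReal.ofReal_pow (norm_nonneg _),
    ← ENNReal.ofReal_mul (by positivity), ← ENNReal.ofReal_mul (by positivity),
    ← ENNReal.ofReal_mul (by positivity), abs_of_pos (by positivity), norm_mul, mul_pow,
    Complex.norm_real, Real.norm_eq_abs, sq_abs]
  congr 1
  ring

theorem lintegral_fun_norm_three {f : ℝ → ℝ≥0∞} (hf : Measurable f) :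
    ∫⁻ x : EuclideanSpace ℝ (Fin 3), f ‖x‖ = ENNReal.ofReal (4 * π) *
      ∫⁻ r in Set.Ioi (0 : ℝ), ENNReal.ofReal (r ^ 2) * f r := by
  rw [lintegral_fun_norm_addHaar volume hf, volume_ball_three, finrank_euclideanSpace,
    Fintype.card_fin, ← ENNReal.ofReal_natCast, ← ENNReal.ofReal_mul (by positivity)]
  congr 2
  push_cast
  ring

theorem fourierInt3_eq_fourier (ψ₀ : 𝓢(EuclideanSpace ℝ (Fin 3), ℂ))
    (ξ : EuclideanSpace ℝ (Fin 3)) :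
    fourierInt3 (fun y => ψ₀ y) ξ = (𝓕 ψ₀) ((2 * π)⁻¹ • ξ) := by
  rw [SchwartzMap.fourier_coe, Real.fourier_eq', fourierInt3]
  congr 1
  ext v
  rw [smul_eq_mul, inner_smul_right]
  congr 2
  have : (π : ℂ) ≠ 0 := by exact_mod_cast pi_ne_zero
  push_cast
  field_simp

theorem fourierInt3_radial {f : EuclideanSpace ℝ (Fin 3) → ℂ}
    (hrad : ∀ x y : EuclideanSpace ℝ (Fin 3), ‖x‖ = ‖y‖ → f x = f y)
    {ξ η : EuclideanSpace ℝ (Fin 3)} (h : ‖ξ‖ = ‖η‖) : fourierInt3 f ξ = fourierInt3 f η := by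
  obtain ⟨T, rfl⟩ := exists_linearIsometryEquiv_apply_eq h
  rw [fourierInt3, fourierInt3,
    ← T.measurePreserving.integral_comp T.toHomeomorph.measurableEmbedding
      (fun x => Complex.exp (-(Complex.I * ((inner ℝ x (T ξ) : ℝ) : ℂ))) * f x)]
  congr 1
  ext x
  rw [T.inner_map_map, hrad (T x) x (T.norm_map x)]

theorem exists_schwartz_profile_fourierInt3 (ψ₀ : 𝓢(EuclideanSpace ℝ (Fin 3), ℂ))
    (hrad : ∀ x y : EuclideanSpace ℝ (Fin 3), ‖x‖ = ‖y‖ → ψ₀ x = ψ₀ y) :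
    ∃ g : 𝓢(ℝ, ℂ), ∀ ξ, fourierInt3 (fun y => ψ₀ y) ξ = g ‖ξ‖ := by
  set e : EuclideanSpace ℝ (Fin 3) := EuclideanSpace.single 0 1 with he
  have hen : ‖e‖ = 1 := by simp [he]
  set L : ℝ →L[ℝ] EuclideanSpace ℝ (Fin 3) := ContinuousLinearMap.toSpanSingleton ℝ
    ((2 * π)⁻¹ • e) with hL
  have hanti : AntilipschitzWith (2 * π).toNNReal L := by
    refine AddMonoidHomClass.antilipschitz_of_bound L fun r => ?_
    rw [hL, ContinuousLinearMap.toSpanSingleton_apply, norm_smul, norm_smul, hen]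
    rw [norm_inv, Real.norm_of_nonneg two_pi_pos.le, Real.coe_toNNReal _ two_pi_pos.le]
    exact le_of_eq (by field_simp)
  refine ⟨compCLMOfAntilipschitz ℂ L.hasTemperateGrowth hanti (𝓕 ψ₀), fun ξ => ?_⟩
  rw [compCLMOfAntilipschitz_apply, fourierInt3_radial hrad (η := ‖ξ‖ • e)
    (by simp [norm_smul, hen]), fourierInt3_eq_fourier]
  simp only [Function.comp, hL, ContinuousLinearMap.toSpanSingleton_apply]
  rw [smul_comm]

theorem integrable_fourierInt3 (ψ₀ : 𝓢(EuclideanSpace ℝ (Fin 3), ℂ)) :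
    Integrable (fourierInt3 (fun y => ψ₀ y)) := by
  have := (𝓕 ψ₀).integrable (μ := volume) |>.comp_smul (R := (2 * π)⁻¹) (by positivity)
  exact this.congr (Filter.Eventually.of_forall fun ξ => (fourierInt3_eq_fourier ψ₀ ξ).symm)

theorem continuous_fourierInt3 (ψ₀ : 𝓢(EuclideanSpace ℝ (Fin 3), ℂ)) :
    Continuous (fourierInt3 (fun y => ψ₀ y)) := by
  have : fourierInt3 (fun y => ψ₀ y) = fun ξ => (𝓕 ψ₀) ((2 * π)⁻¹ • ξ) :=
    funext (fourierInt3_eq_fourier ψ₀)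
  rw [this]
  fun_prop

theorem lintegral_norm_sq_fourierInt3 (ψ₀ : 𝓢(EuclideanSpace ℝ (Fin 3), ℂ)) :
    ∫⁻ ξ, ENNReal.ofReal (‖fourierInt3 (fun y => ψ₀ y) ξ‖ ^ 2) =
      ENNReal.ofReal ((2 * π) ^ 3 * ∫ x, ‖ψ₀ x‖ ^ 2) := by
  have hi : Integrable fun ξ => ‖(𝓕 ψ₀) ξ‖ ^ 2 :=
    (memLp_two_iff_integrable_sq_norm (𝓕 ψ₀).continuous.aestronglyMeasurable).mp
      ((𝓕 ψ₀).memLp 2 volume)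
  have hi2 := hi.comp_smul (R := (2 * π)⁻¹) (by positivity)
  have hs := Measure.integral_comp_smul volume
    (fun ξ : EuclideanSpace ℝ (Fin 3) => ‖(𝓕 ψ₀) ξ‖ ^ 2) (2 * π)⁻¹
  simp_rw [fourierInt3_eq_fourier]
  rw [← ofReal_integral_eq_lintegral_ofReal hi2
      (Filter.Eventually.of_forall fun ξ => by positivity),
    hs, integral_norm_sq_fourier, finrank_euclideanSpace, Fintype.card_fin, smul_eq_mul,
    inv_pow, inv_inv, abs_of_pos (by positivity)]

theorem schrodingerSol3_eq_radialOsc {ψ₀ : 𝓢(EuclideanSpace ℝ (Fin 3), ℂ)} {g : 𝓢(ℝ, ℂ)}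
    (hg : ∀ ξ, fourierInt3 (fun y => ψ₀ y) ξ = g ‖ξ‖) {x : EuclideanSpace ℝ (Fin 3)}
    (hx : x ≠ 0) (t : ℝ) :
    schrodingerSol3 ψ₀ x t = (1 / (2 * π ^ 2 * ‖x‖) : ℝ) * radialOsc g ‖x‖ t := by
  set h : ℝ → ℂ := fun r => Complex.exp (-(Complex.I * t * (r ^ 2 : ℝ))) * g r with hh
  have hc : Continuous h := by fun_prop
  have hi : Integrable (fun ξ : EuclideanSpace ℝ (Fin 3) => h ‖ξ‖) := by
    have h0 : Integrable (fun ξ : EuclideanSpace ℝ (Fin 3) => g ‖ξ‖) := by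
      simpa only [← hg] using integrable_fourierInt3 ψ₀
    refine h0.bdd_mul (c := 1) (by fun_prop) (Filter.Eventually.of_forall fun ξ => ?_)
    have : -(Complex.I * t * (‖ξ‖ ^ 2 : ℝ)) = (-(t * ‖ξ‖ ^ 2) : ℝ) * Complex.I := by
      push_cast; ring
    rw [this, Complex.norm_exp_ofReal_mul_I]
  have := integral_exp_inner_mul_radial hx hc hi
  rw [schrodingerSol3]
  simp_rw [hg, mul_assoc]
  simp only [hh] at this
  simp only [← mul_assoc] at this ⊢
  rw [this]
  have h1 : (π : ℂ) ≠ 0 := by exact_mod_cast pi_ne_zero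
  have h2 : (‖x‖ : ℂ) ≠ 0 := by exact_mod_cast norm_ne_zero_iff.mpr hx
  rw [radialOsc]
  simp only [← mul_assoc]
  congr 1
  push_cast
  field_simp
  norm_num

theorem stronglyMeasurable_schrodingerSol3 (ψ₀ : 𝓢(EuclideanSpace ℝ (Fin 3), ℂ)) :
    StronglyMeasurable fun p : ℝ × EuclideanSpace ℝ (Fin 3) => schrodingerSol3 ψ₀ p.2 p.1 := by
  have hc := continuous_fourierInt3 ψ₀
  refine StronglyMeasurable.const_mul (StronglyMeasurable.integral_prod_right'
    (f := fun q : (ℝ × EuclideanSpace ℝ (Fin 3)) × EuclideanSpace ℝ (Fin 3) =>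
      Complex.exp (Complex.I * ((inner ℝ q.1.2 q.2 : ℝ) : ℂ)) *
        Complex.exp (-(Complex.I * (q.1.1 : ℂ) * ((‖q.2‖ ^ 2 : ℝ) : ℂ))) *
          fourierInt3 (fun y => ψ₀ y) q.2) ?_) _
  exact Continuous.stronglyMeasurable (by fun_prop)

/-- The time integral of `|ψ|² / |x|²` at a fixed point `x ≠ 0`. -/
theorem lintegral_time_schrodingerSol3 {ψ₀ : 𝓢(EuclideanSpace ℝ (Fin 3), ℂ)} {g : 𝓢(ℝ, ℂ)}
    (hg : ∀ ξ, fourierInt3 (fun y => ψ₀ y) ξ = g ‖ξ‖) {x : EuclideanSpace ℝ (Fin 3)}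
    (hx : x ≠ 0) :
    ∫⁻ t, ENNReal.ofReal (‖schrodingerSol3 ψ₀ x t‖ ^ 2 / ‖x‖ ^ 2) =
      ENNReal.ofReal (1 / (4 * π ^ 3 * ‖x‖ ^ 4)) *
        ∫⁻ r in Set.Ioi (0 : ℝ), ENNReal.ofReal (r * Real.sin (r * ‖x‖) ^ 2 * ‖g r‖ ^ 2) := by
  have hx' : 0 < ‖x‖ := norm_pos_iff.mpr hx
  have : ∀ t, ENNReal.ofReal (‖schrodingerSol3 ψ₀ x t‖ ^ 2 / ‖x‖ ^ 2) =
      ENNReal.ofReal (1 / (4 * π ^ 4 * ‖x‖ ^ 4)) * ‖radialOsc g ‖x‖ t‖ₑ ^ 2 := by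
    intro t
    rw [schrodingerSol3_eq_radialOsc hg hx, ← ofReal_norm, ← ENNReal.ofReal_pow (norm_nonneg _),
      ← ENNReal.ofReal_mul (by positivity), norm_mul, Complex.norm_real, mul_pow,
      Real.norm_eq_abs, sq_abs]
    congr 1
    field_simp
    ring
  simp_rw [this]
  rw [lintegral_const_mul' _ _ ENNReal.ofReal_ne_top, lintegral_enorm_sq_radialOsc, ← mul_assoc,
    ← ENNReal.ofReal_mul (by positivity)]
  congr 2
  field_simp

theorem lintegral_kato_radial (ψ₀ : 𝓢(EuclideanSpace ℝ (Fin 3), ℂ))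
    (hrad : ∀ x y : EuclideanSpace ℝ (Fin 3), ‖x‖ = ‖y‖ → ψ₀ x = ψ₀ y) :
    ∫⁻ x : EuclideanSpace ℝ (Fin 3), ∫⁻ t : ℝ,
        ENNReal.ofReal (‖schrodingerSol3 ψ₀ x t‖ ^ 2 / ‖x‖ ^ 2) =
      ENNReal.ofReal (π * ∫ x, ‖ψ₀ x‖ ^ 2) := by
  obtain ⟨g, hg⟩ := exists_schwartz_profile_fourierInt3 ψ₀ hrad
  set H : ℝ → ℝ≥0∞ := fun R => ENNReal.ofReal (1 / (4 * π ^ 3 * R ^ 4)) *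
    ∫⁻ r in Set.Ioi (0 : ℝ), ENNReal.ofReal (r * Real.sin (r * R) ^ 2 * ‖g r‖ ^ 2) with hH
  have hHm : Measurable H := by
    refine Measurable.mul (by fun_prop) (Measurable.lintegral_prod_right' (f := fun p : ℝ × ℝ =>
      ENNReal.ofReal (p.2 * Real.sin (p.2 * p.1) ^ 2 * ‖g p.2‖ ^ 2)) ?_)
    exact (Continuous.measurable (by fun_prop)).ennreal_ofReal
  have h1 : ∫⁻ x : EuclideanSpace ℝ (Fin 3), ∫⁻ t : ℝ,
      ENNReal.ofReal (‖schrodingerSol3 ψ₀ x t‖ ^ 2 / ‖x‖ ^ 2) =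
      ∫⁻ x : EuclideanSpace ℝ (Fin 3), H ‖x‖ := by
    apply lintegral_congr_ae
    filter_upwards [compl_mem_ae_iff.mpr
      (measure_singleton (0 : EuclideanSpace ℝ (Fin 3)))] with x hx
    exact lintegral_time_schrodingerSol3 hg hx
  have h2 : ∀ R ∈ Set.Ioi (0 : ℝ), ENNReal.ofReal (R ^ 2) * H R =
      ∫⁻ r in Set.Ioi (0 : ℝ), ENNReal.ofReal (r / (4 * π ^ 3) * ‖g r‖ ^ 2) *
        ENNReal.ofReal (Real.sin (r * R) ^ 2 / R ^ 2) := by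
    intro R hR
    have hR : 0 < R := hR
    simp only [hH]
    rw [← mul_assoc, ← ENNReal.ofReal_mul (by positivity),
      ← lintegral_const_mul' _ _ ENNReal.ofReal_ne_top]
    refine setLIntegral_congr_fun measurableSet_Ioi fun r hr => ?_
    have hr : 0 < r := hr
    rw [← ENNReal.ofReal_mul (by positivity), ← ENNReal.ofReal_mul (by positivity)]
    congr 1
    field_simp
  have h3 : ∫⁻ R in Set.Ioi (0 : ℝ), ENNReal.ofReal (R ^ 2) * H R =
      ENNReal.ofReal (1 / (8 * π ^ 2)) * ∫⁻ r in Set.Ioi (0 : ℝ), ENNReal.ofReal (r ^ 2) *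
        ENNReal.ofReal (‖g r‖ ^ 2) := by
    have hm : Measurable (Function.uncurry fun R r : ℝ =>
        ENNReal.ofReal (r / (4 * π ^ 3) * ‖g r‖ ^ 2) *
          ENNReal.ofReal (Real.sin (r * R) ^ 2 / R ^ 2)) :=
      (Continuous.measurable (by fun_prop)).ennreal_ofReal.mul (by fun_prop)
    rw [setLIntegral_congr_fun measurableSet_Ioi h2, lintegral_lintegral_swap hm.aemeasurable,
      ← lintegral_const_mul' _ _ ENNReal.ofReal_ne_top]
    refine setLIntegral_congr_fun measurableSet_Ioi fun r hr => ?_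
    have hr : 0 < r := hr
    rw [lintegral_const_mul' _ _ ENNReal.ofReal_ne_top, lintegral_sq_sin_div_sq hr,
      ← ENNReal.ofReal_mul (by positivity), ← ENNReal.ofReal_mul (by positivity),
      ← ENNReal.ofReal_mul (by positivity)]
    congr 1
    field_simp
    ring
  have h4 := lintegral_norm_sq_fourierInt3 ψ₀
  simp_rw [hg] at h4
  rw [lintegral_fun_norm_three (f := fun r => ENNReal.ofReal (‖g r‖ ^ 2))
    (Continuous.measurable (by fun_prop)).ennreal_ofReal] at h4
  rw [h1, lintegral_fun_norm_three hHm, h3, mul_left_comm, h4,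
    ← ENNReal.ofReal_mul (by positivity)]
  congr 1
  field_simp
  norm_num

/-- The best constant `π = π/(n-2)` in the classical Kato smoothing estimate on `ℝ³` is
attained, with equality, at every radial Schwartz datum. -/
theorem kato_identity_free_schrodinger_radial_3d
    (ψ₀ : SchwartzMap (EuclideanSpace ℝ (Fin 3)) ℂ)
    (hrad : ∀ x y : EuclideanSpace ℝ (Fin 3), ‖x‖ = ‖y‖ → ψ₀ x = ψ₀ y) :
    (∫ t : ℝ, ∫ x : EuclideanSpace ℝ (Fin 3),
        ‖schrodingerSol3 ψ₀ x t‖ ^ 2 / ‖x‖ ^ (2 : ℝ)) =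
      π * ∫ x : EuclideanSpace ℝ (Fin 3), ‖ψ₀ x‖ ^ 2 := by
  simp_rw [Real.rpow_two]
  set f : ℝ × EuclideanSpace ℝ (Fin 3) → ℝ := fun p =>
    ‖schrodingerSol3 ψ₀ p.2 p.1‖ ^ 2 / ‖p.2‖ ^ 2 with hf
  have hfm : Measurable f :=
    ((stronglyMeasurable_schrodingerSol3 ψ₀).measurable.norm.pow_const 2).div (by fun_prop)
  have hf0 : 0 ≤ᵐ[volume.prod volume] f :=
    Filter.Eventually.of_forall fun p => by simp only [hf, Pi.zero_apply]; positivity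
  have hl : ∫⁻ p, ENNReal.ofReal (f p) ∂(volume.prod volume) =
      ENNReal.ofReal (π * ∫ x, ‖ψ₀ x‖ ^ 2) := by
    rw [lintegral_prod_symm' _ (by fun_prop), ← lintegral_kato_radial ψ₀ hrad]
  have hfi : Integrable f (volume.prod volume) := by
    refine ⟨hfm.aestronglyMeasurable, ?_⟩
    rw [hasFiniteIntegral_iff_ofReal hf0, hl]
    exact ENNReal.ofReal_lt_top
  rw [← integral_prod f hfi, integral_eq_lintegral_of_nonneg_ae hf0 hfm.aestronglyMeasurable, hl,
    ENNReal.toReal_ofReal]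
  exact mul_nonneg pi_nonneg (integral_nonneg fun x => by positivity)
end
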